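/- arXiv:1706.03724 — 7 statements merged into one kernel-verified Lean document; each statement's English description precedes it below -/
import Mathlib

section
/- Let Φ > 1, let a ≥ 0, b ≥ 0 be constants, and let ξ be a Borel measure on (0,∞) with ∫ min(1,t) ξ(dt) < ∞, such that not all of a, b, ξ are zero. Define W(x) = e^{Φx} ( a + bx + ∫_{(0,∞)} (1 − e^{−xt}) ξ(dt) ) for x > 0. Then W is three times differentiable on (0,∞), and the function x ↦ W′(x) − W″(x) is strictly decreasing on (0,∞). Consequently, as x increases over (0,∞), the quantity W′(x) − W″(x) changes sign at most once, and if it does change sign it changes from being positive to being negative. -/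
open MeasureTheory Real Set Filter Topology

/-- `t ^ (n + 1) * e^{-ct}` is dominated by a multiple of `min 1 t` on the positive half-line. -/
lemma pow_succ_mul_exp_neg_le (n : ℕ) {c t : ℝ} (hc : 0 < c) (ht : 0 < t) :
    t ^ (n + 1) * exp (-(c * t)) ≤
      (n.factorial / c ^ n + (n + 1).factorial / c ^ (n + 1)) * min 1 t := by
  have key (m : ℕ) : t ^ m * exp (-(c * t)) ≤ m.factorial / c ^ m := by
    have h := pow_div_factorial_le_exp (c * t) (by positivity) m
    rw [div_le_iff₀ (by positivity), mul_pow] at h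
    rw [le_div_iff₀ (by positivity), exp_neg, ← div_eq_mul_inv, div_mul_eq_mul_div,
      div_le_iff₀ (exp_pos _)]
    linarith
  have h₁ : (0 : ℝ) ≤ n.factorial / c ^ n := by positivity
  have h₂ : (0 : ℝ) ≤ (n + 1).factorial / c ^ (n + 1) := by positivity
  rcases min_cases 1 t with ⟨h, -⟩ | ⟨h, -⟩ <;> rw [h]
  · linarith [key (n + 1)]
  · rw [pow_succ]
    nlinarith [mul_le_mul_of_nonneg_right (key n) ht.le, mul_nonneg h₂ ht.le]

section LaplaceTransform

variable {ξ : Measure ℝ}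

lemma ae_pos_of_measure_Iic_eq_zero (hξ : ξ (Iic 0) = 0) : ∀ᵐ t ∂ξ, 0 < t := by
  rw [ae_iff]
  simpa only [not_lt, Iic] using hξ

lemma integrable_min_one (hξ : ξ (Iic 0) = 0)
    (hint : ∫⁻ t, ENNReal.ofReal (min 1 t) ∂ξ ≠ ⊤) : Integrable (fun t ↦ min 1 t) ξ := by
  refine ⟨by fun_prop, ?_⟩
  rw [hasFiniteIntegral_iff_ofReal]
  · exact hint.lt_top
  · filter_upwards [ae_pos_of_measure_Iic_eq_zero hξ] with t ht
    exact le_min zero_le_one ht.le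

lemma integrable_pow_succ_mul_exp_neg (hξ : ξ (Iic 0) = 0)
    (hint : Integrable (fun t ↦ min 1 t) ξ) (n : ℕ) {c : ℝ} (hc : 0 < c) :
    Integrable (fun t ↦ t ^ (n + 1) * exp (-(c * t))) ξ := by
  refine (hint.const_mul (n.factorial / c ^ n + (n + 1).factorial / c ^ (n + 1))).mono'
    (by fun_prop) ?_
  filter_upwards [ae_pos_of_measure_Iic_eq_zero hξ] with t ht
  rw [norm_of_nonneg (by positivity)]
  exact pow_succ_mul_exp_neg_le n hc ht

lemma integrable_one_sub_exp_neg (hξ : ξ (Iic 0) = 0)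
    (hint : Integrable (fun t ↦ min 1 t) ξ) {x : ℝ} (hx : 0 < x) :
    Integrable (fun t ↦ 1 - exp (-(x * t))) ξ := by
  refine (hint.const_mul (1 + x)).mono' (by fun_prop) ?_
  filter_upwards [ae_pos_of_measure_Iic_eq_zero hξ] with t ht
  have hxt : 0 < x * t := mul_pos hx ht
  have h₁ : exp (-(x * t)) ≤ 1 := exp_le_one_iff.2 (by linarith)
  rw [norm_of_nonneg (by linarith)]
  rcases min_cases 1 t with ⟨h, -⟩ | ⟨h, -⟩ <;> rw [h]
  · linarith [exp_pos (-(x * t))]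
  · linarith [add_one_le_exp (-(x * t))]

/-- Differentiation under the integral sign for kernels whose derivative is, up to sign,
`t ^ (n + 1) * e^{-xt}`. -/
lemma hasDerivAt_integral_of_deriv_pow_mul_exp (hξ : ξ (Iic 0) = 0)
    (hint : Integrable (fun t ↦ min 1 t) ξ) (n : ℕ) {x ε : ℝ} (hx : 0 < x) (hε : |ε| = 1)
    {F : ℝ → ℝ → ℝ} (hF : ∀ y, Continuous (F y)) (hFint : Integrable (F x) ξ)
    (hF' : ∀ y t, HasDerivAt (fun y ↦ F y t) (ε * (t ^ (n + 1) * exp (-(y * t)))) y) :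
    HasDerivAt (fun y ↦ ∫ t, F y t ∂ξ) (ε * ∫ t, t ^ (n + 1) * exp (-(x * t)) ∂ξ) x := by
  have h := (hasDerivAt_integral_of_dominated_loc_of_deriv_le (μ := ξ)
    (F' := fun y t ↦ ε * (t ^ (n + 1) * exp (-(y * t))))
    (bound := fun t ↦ t ^ (n + 1) * exp (-(x / 2 * t))) (Ioi_mem_nhds (half_lt_self hx))
    (Eventually.of_forall fun y ↦ (hF y).aestronglyMeasurable) hFint (by fun_prop) ?_
    (integrable_pow_succ_mul_exp_neg hξ hint n (half_pos hx))
    (Eventually.of_forall fun t y _ ↦ hF' y t)).2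
  · rwa [integral_const_mul] at h
  · filter_upwards [ae_pos_of_measure_Iic_eq_zero hξ] with t ht y hy
    rw [norm_mul, norm_eq_abs, hε, one_mul, norm_of_nonneg (by positivity)]
    have : x / 2 * t ≤ y * t := mul_le_mul_of_nonneg_right (le_of_lt hy) ht.le
    gcongr

lemma hasDerivAt_integral_pow_mul_exp_neg (hξ : ξ (Iic 0) = 0)
    (hint : Integrable (fun t ↦ min 1 t) ξ) (n : ℕ) {x : ℝ} (hx : 0 < x) :
    HasDerivAt (fun y ↦ ∫ t, t ^ (n + 1) * exp (-(y * t)) ∂ξ)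
      (-∫ t, t ^ (n + 2) * exp (-(x * t)) ∂ξ) x := by
  rw [← neg_one_mul]
  refine hasDerivAt_integral_of_deriv_pow_mul_exp hξ hint (n + 1) hx (by simp)
    (fun y ↦ by fun_prop) (integrable_pow_succ_mul_exp_neg hξ hint n hx) fun y t ↦ ?_
  refine ((((hasDerivAt_id' y).mul_const t).fun_neg.exp).const_mul (t ^ (n + 1))).congr_deriv ?_
  ring

lemma hasDerivAt_integral_one_sub_exp_neg (hξ : ξ (Iic 0) = 0)
    (hint : Integrable (fun t ↦ min 1 t) ξ) {x : ℝ} (hx : 0 < x) :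
    HasDerivAt (fun y ↦ ∫ t, (1 - exp (-(y * t))) ∂ξ)
      (∫ t, t ^ 1 * exp (-(x * t)) ∂ξ) x := by
  rw [← one_mul (∫ t, t ^ 1 * exp (-(x * t)) ∂ξ)]
  refine hasDerivAt_integral_of_deriv_pow_mul_exp hξ hint 0 hx (by simp)
    (fun y ↦ by fun_prop) (integrable_one_sub_exp_neg hξ hint hx) fun y t ↦ ?_
  refine (((hasDerivAt_id' y).mul_const t).fun_neg.exp.const_sub 1).congr_deriv ?_
  ring

end LaplaceTransform

lemma hasDerivAt_exp_const_mul_mul {f : ℝ → ℝ} {f' x : ℝ} (Φ : ℝ) (hf : HasDerivAt f f' x) :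
    HasDerivAt (fun y ↦ exp (Φ * y) * f y) (exp (Φ * x) * (Φ * f x + f')) x := by
  refine ((((hasDerivAt_id' x).const_mul Φ).exp).mul hf).congr_deriv ?_
  ring

lemma sq_mul_sub_one_mul_exp_neg_lt {Φ x t : ℝ} (hΦ : 1 < Φ) (hx : 0 < x) (ht : 0 < t) :
    (Φ - t) ^ 2 * (Φ - t - 1) * exp (-(x * t)) < Φ ^ 2 * (Φ - 1) := by
  have hpos : 0 < Φ ^ 2 * (Φ - 1) := mul_pos (by positivity) (by linarith)
  rcases le_or_gt (Φ - t - 1) 0 with h | h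
  · exact (mul_nonpos_of_nonpos_of_nonneg
      (mul_nonpos_of_nonneg_of_nonpos (sq_nonneg _) h) (exp_pos _).le).trans_lt hpos
  · have hexp : exp (-(x * t)) ≤ 1 := exp_le_one_iff.2 (by nlinarith)
    calc (Φ - t) ^ 2 * (Φ - t - 1) * exp (-(x * t)) ≤ (Φ - t) ^ 2 * (Φ - t - 1) :=
          mul_le_of_le_one_right (by positivity) hexp
      _ ≤ Φ ^ 2 * (Φ - t - 1) := by gcongr <;> linarith
      _ < Φ ^ 2 * (Φ - 1) := by gcongr; linarith

/-- With `g x = a + b x + ∫ (1 - e^{-xt}) ξ(dt)`, the second minus the third derivative of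
`e^{Φx} g x`, divided by `e^{Φx}`, is negative. -/
lemma second_sub_third_deriv_neg {Φ a b x : ℝ} {ξ : Measure ℝ} (hΦ : 1 < Φ) (ha : 0 ≤ a)
    (hb : 0 ≤ b) (hξ : ξ (Iic 0) = 0) (hint : Integrable (fun t ↦ min 1 t) ξ)
    (hnontriv : ¬ (a = 0 ∧ b = 0 ∧ ξ = 0)) (hx : 0 < x) :
    Φ ^ 2 * (1 - Φ) * (a + b * x + ∫ t, (1 - exp (-(x * t))) ∂ξ)
      + (2 * Φ - 3 * Φ ^ 2) * (b + ∫ t, t ^ 1 * exp (-(x * t)) ∂ξ)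
      + (1 - 3 * Φ) * (-∫ t, t ^ 2 * exp (-(x * t)) ∂ξ)
      - ∫ t, t ^ 3 * exp (-(x * t)) ∂ξ < 0 := by
  set k : ℝ → ℝ := fun t ↦ Φ ^ 2 * (Φ - 1) - (Φ - t) ^ 2 * (Φ - t - 1) * exp (-(x * t)) with hk
  have hi₀ := (integrable_one_sub_exp_neg hξ hint hx).const_mul (Φ ^ 2 * (Φ - 1))
  have hi₁ := (integrable_pow_succ_mul_exp_neg hξ hint 0 hx).const_mul (3 * Φ ^ 2 - 2 * Φ)
  have hi₂ := (integrable_pow_succ_mul_exp_neg hξ hint 1 hx).const_mul (1 - 3 * Φ)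
  have hi₃ := integrable_pow_succ_mul_exp_neg hξ hint 2 hx
  have hk_eq : k = fun t ↦ Φ ^ 2 * (Φ - 1) * (1 - exp (-(x * t)))
      + (3 * Φ ^ 2 - 2 * Φ) * (t ^ (0 + 1) * exp (-(x * t)))
      + (1 - 3 * Φ) * (t ^ (1 + 1) * exp (-(x * t))) + t ^ (2 + 1) * exp (-(x * t)) := by
    funext t
    simp only [hk]
    ring
  have hk_int : Integrable k ξ := by
    rw [hk_eq]
    exact ((hi₀.add hi₁).add hi₂).add hi₃
  have hk_val : ∫ t, k t ∂ξ = Φ ^ 2 * (Φ - 1) * ∫ t, (1 - exp (-(x * t))) ∂ξ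
      + (3 * Φ ^ 2 - 2 * Φ) * ∫ t, t ^ 1 * exp (-(x * t)) ∂ξ
      + (1 - 3 * Φ) * ∫ t, t ^ 2 * exp (-(x * t)) ∂ξ + ∫ t, t ^ 3 * exp (-(x * t)) ∂ξ := by
    rw [hk_eq, integral_add ((hi₀.fun_add hi₁).fun_add hi₂) hi₃, integral_add (hi₀.fun_add hi₁) hi₂,
      integral_add hi₀ hi₁, integral_const_mul, integral_const_mul, integral_const_mul]
  have hk_pos : ∀ᵐ t ∂ξ, 0 < k t := by
    filter_upwards [ae_pos_of_measure_Iic_eq_zero hξ] with t ht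
    exact sub_pos.2 (sq_mul_sub_one_mul_exp_neg_lt hΦ hx ht)
  have hk_nonneg : 0 ≤ᵐ[ξ] k := hk_pos.mono fun t ht ↦ ht.le
  have hI : 0 ≤ ∫ t, k t ∂ξ := integral_nonneg_of_ae hk_nonneg
  have hA : 0 < Φ ^ 2 * (Φ - 1) := mul_pos (by positivity) (by linarith)
  have hB : 0 < Φ ^ 2 * (Φ - 1) * x + (3 * Φ ^ 2 - 2 * Φ) := by
    have := mul_pos hA hx
    nlinarith
  suffices h : 0 < Φ ^ 2 * (Φ - 1) * a + (Φ ^ 2 * (Φ - 1) * x + (3 * Φ ^ 2 - 2 * Φ)) * b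
      + ∫ t, k t ∂ξ by
    rw [hk_val] at h
    linarith
  have hAa := mul_nonneg hA.le ha
  have hBb := mul_nonneg hB.le hb
  by_contra! hle
  refine hnontriv ⟨?_, ?_, ?_⟩
  · exact (mul_eq_zero.1 (by linarith : Φ ^ 2 * (Φ - 1) * a = 0)).resolve_left hA.ne'
  · exact (mul_eq_zero.1 (by linarith :
      (Φ ^ 2 * (Φ - 1) * x + (3 * Φ ^ 2 - 2 * Φ)) * b = 0)).resolve_left hB.ne'
  · have hk_zero := (integral_eq_zero_iff_of_nonneg_ae hk_nonneg hk_int).1 (by linarith)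
    rw [← ae_eq_bot, ← eventually_false_iff_eq_bot]
    filter_upwards [hk_pos, hk_zero] with t ht hzero
    exact absurd hzero ht.ne'

/-- Key analytic content of Lemma B.2: for a scale-function-type representation
`W(x) = e^{Φx}(a + bx + ∫ (1 − e^{−xt}) ξ(dt))` with `Φ > 1`, the function
`W′ − W″` is strictly decreasing on `(0,∞)`, hence changes sign at most once,
from positive to negative. -/
theorem stmt0
    (Φ a b : ℝ) (hΦ : 1 < Φ) (ha : 0 ≤ a) (hb : 0 ≤ b)
    (ξ : Measure ℝ)
    (hξsupp : ξ (Set.Iic 0) = 0)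
    (hξint : ∫⁻ t, ENNReal.ofReal (min 1 t) ∂ξ ≠ ⊤)
    (hnontriv : ¬ (a = 0 ∧ b = 0 ∧ ξ = 0))
    (W : ℝ → ℝ)
    (hW : ∀ x : ℝ, 0 < x →
      W x = Real.exp (Φ * x) * (a + b * x + ∫ t, (1 - Real.exp (-(x * t))) ∂ξ)) :
    ∃ W1 W2 W3 : ℝ → ℝ,
      (∀ x : ℝ, 0 < x →
        HasDerivAt W (W1 x) x ∧ HasDerivAt W1 (W2 x) x ∧ HasDerivAt W2 (W3 x) x) ∧
      StrictAntiOn (fun x => W1 x - W2 x) (Set.Ioi 0) ∧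
      (∀ x y : ℝ, 0 < x → x < y → W1 x - W2 x ≤ 0 → W1 y - W2 y < 0) := by
  have hint := integrable_min_one hξsupp hξint
  let G : ℕ → ℝ → ℝ := fun n x ↦ ∫ t, t ^ n * exp (-(x * t)) ∂ξ
  let g : ℝ → ℝ := fun x ↦ a + b * x + ∫ t, (1 - exp (-(x * t))) ∂ξ
  have hg (x : ℝ) (hx : 0 < x) : HasDerivAt g (b + G 1 x) x := by
    refine ((((hasDerivAt_id' x).const_mul b).const_add a).add
      (hasDerivAt_integral_one_sub_exp_neg hξsupp hint hx)).congr_deriv ?_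
    rw [mul_one]
  have hg₁ (x : ℝ) (hx : 0 < x) : HasDerivAt (fun y ↦ b + G 1 y) (-G 2 x) x :=
    (hasDerivAt_integral_pow_mul_exp_neg hξsupp hint 0 hx).const_add b
  have hg₂ (x : ℝ) (hx : 0 < x) : HasDerivAt (fun y ↦ -G 2 y) (G 3 x) x :=
    (hasDerivAt_integral_pow_mul_exp_neg hξsupp hint 1 hx).neg.congr_deriv (neg_neg _)
  let h₁ : ℝ → ℝ := fun x ↦ Φ * g x + (b + G 1 x)
  let h₁' : ℝ → ℝ := fun x ↦ Φ * (b + G 1 x) + -G 2 x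
  let h₁'' : ℝ → ℝ := fun x ↦ Φ * -G 2 x + G 3 x
  have hh₁ (x : ℝ) (hx : 0 < x) : HasDerivAt h₁ (h₁' x) x :=
    ((hg x hx).const_mul Φ).add (hg₁ x hx)
  have hh₁' (x : ℝ) (hx : 0 < x) : HasDerivAt h₁' (h₁'' x) x :=
    ((hg₁ x hx).const_mul Φ).add (hg₂ x hx)
  let W1 : ℝ → ℝ := fun x ↦ exp (Φ * x) * h₁ x
  let W2 : ℝ → ℝ := fun x ↦ exp (Φ * x) * (Φ * h₁ x + h₁' x)
  let W3 : ℝ → ℝ := fun x ↦ exp (Φ * x) * (Φ * (Φ * h₁ x + h₁' x) + (Φ * h₁' x + h₁'' x))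
  have hW1 (x : ℝ) (hx : 0 < x) : HasDerivAt W1 (W2 x) x := hasDerivAt_exp_const_mul_mul Φ (hh₁ x hx)
  have hW2 (x : ℝ) (hx : 0 < x) : HasDerivAt W2 (W3 x) x :=
    hasDerivAt_exp_const_mul_mul Φ (((hh₁ x hx).const_mul Φ).add (hh₁' x hx))
  have hanti : StrictAntiOn (fun x ↦ W1 x - W2 x) (Ioi 0) := by
    have hd (x : ℝ) (hx : 0 < x) : HasDerivAt (fun x ↦ W1 x - W2 x) (W2 x - W3 x) x :=
      (hW1 x hx).sub (hW2 x hx)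
    refine strictAntiOn_of_deriv_neg (convex_Ioi 0)
      (fun x hx ↦ (hd x hx).continuousAt.continuousWithinAt) fun x hx ↦ ?_
    rw [interior_Ioi] at hx
    rw [(hd x hx).deriv]
    have hneg := mul_neg_of_pos_of_neg (exp_pos (Φ * x))
      (second_sub_third_deriv_neg hΦ ha hb hξsupp hint hnontriv hx)
    refine lt_of_eq_of_lt ?_ hneg
    simp only [W2, W3, h₁, h₁', h₁'', g, G]
    ring
  refine ⟨W1, W2, W3, fun x hx ↦ ⟨?_, hW1 x hx, hW2 x hx⟩, hanti, fun x y hx hxy hle ↦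
    (hanti hx (hx.trans hxy) hxy).trans_le hle⟩
  refine (hasDerivAt_exp_const_mul_mul Φ (hg x hx)).congr_of_eventuallyEq ?_
  filter_upwards [Ioi_mem_nhds hx] with y hy using hW y hy
end

section
/- For all real numbers x > 0, Φ > 1 and t < Φ, one has t²(1 − t)e^{tx} > Φ²(1 − Φ)e^{Φx}. -/
/-- For all real `x > 0`, `Φ > 1` and `t < Φ`, one has
`t²(1 − t)e^{tx} > Φ²(1 − Φ)e^{Φx}`. -/
theorem stmt1 :
    ∀ x : ℝ, 0 < x → ∀ Φ : ℝ, 1 < Φ → ∀ t : ℝ, t < Φ →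
      t ^ 2 * (1 - t) * Real.exp (t * x) > Φ ^ 2 * (1 - Φ) * Real.exp (Φ * x) := by
  intro x hx Φ hΦ t ht
  have hΦ' : 0 < Φ - 1 := sub_pos.mpr hΦ
  rcases le_or_gt t 1 with h | h
  · have hl : 0 ≤ t ^ 2 * (1 - t) * Real.exp (t * x) :=
      mul_nonneg (mul_nonneg (sq_nonneg t) (sub_nonneg.mpr h)) (Real.exp_pos _).le
    have hr : 0 < Φ ^ 2 * (Φ - 1) * Real.exp (Φ * x) := by positivity
    linarith
  · have ht' : 0 < t - 1 := sub_pos.mpr h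
    have key : t ^ 2 * (t - 1) * Real.exp (t * x) < Φ ^ 2 * (Φ - 1) * Real.exp (Φ * x) := by
      gcongr
    linarith
end

section
/- The function I^{(r,q)} satisfies: (i) I^{(r,q)}(x) = e^{Φ(r+q)x}/q for every x ≤ 0; (ii) if W^{(r)} is continuous on ℝ∖{0}, then I^{(r,q)} is continuously differentiable on ℝ∖{0} with (I^{(r,q)})′(x) = Φ(r+q)·I^{(r,q)}(x) − W^{(r)}(x) for all x ≠ 0; (iii) if moreover W^{(r)} is continuously differentiable on (0,∞), then I^{(r,q)} is twice continuously differentiable on (0,∞) with (I^{(r,q)})″(x) = Φ(r+q)·(I^{(r,q)})′(x) − (W^{(r)})′(x) for all x > 0. -/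
open MeasureTheory Real Set Filter Topology

/-- A function on `ℝ` that vanishes on the negative half-line and is integrable on the positive
half-line is integrable. -/
theorem integrable_of_integrableOn_Ioi_of_neg {g : ℝ → ℝ} (h : IntegrableOn g (Ioi 0))
    (h0 : ∀ x < 0, g x = 0) : Integrable g := by
  have hIio : IntegrableOn g (Iio 0) :=
    (integrableOn_zero (ε' := ℝ)).congr_fun (fun x hx => (h0 x hx).symm) measurableSet_Iio
  have hIic : IntegrableOn g (Iic 0) := (integrableOn_Iic_iff_integrableOn_Iio (by simp)).2 hIio
  rw [← integrableOn_univ, ← Iic_union_Ioi (a := (0 : ℝ))]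
  exact hIic.union h

/-- The exponentially weighted tail integral of `w`, as an exponential times a tail of the
Laplace transform. -/
theorem integral_exp_mul_comp_add_eq {w : ℝ → ℝ} {c : ℝ}
    (h : Integrable fun v => exp (-c * v) * w v) (x : ℝ) :
    ∫ u in Ioi (0 : ℝ), exp (-c * u) * w (u + x) =
      exp (c * x) * ((∫ v in Ioi (0 : ℝ), exp (-c * v) * w v) -
        ∫ v in (0 : ℝ)..x, exp (-c * v) * w v) := by
  have hshift : ∫ u in Ioi (0 : ℝ), exp (-c * (u + x)) * w (u + x) =
      ∫ v in Ioi x, exp (-c * v) * w v := by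
    have := (measurePreserving_add_right volume x).setIntegral_preimage_emb
      (measurableEmbedding_addRight x) (fun v => exp (-c * v) * w v) (Ioi x)
    simpa using this
  have htail : (∫ v in Ioi (0 : ℝ), exp (-c * v) * w v) -
      ∫ v in (0 : ℝ)..x, exp (-c * v) * w v = ∫ v in Ioi x, exp (-c * v) * w v := by
    rw [← intervalIntegral.integral_Ioi_sub_Ioi' h.integrableOn h.integrableOn, sub_sub_cancel]
  rw [htail, ← hshift, ← integral_const_mul]
  congr 1 with u
  rw [← mul_assoc, ← exp_add]
  ring_nf

/-- Basic properties of `I^{(r,q)}(x) = ∫₀^∞ e^{−Φ(r+q)u} W^{(r)}(u+x) du`: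
its value for `x ≤ 0`, and its first and second derivatives in terms of the
scale function `W^{(r)}`. -/
theorem stmt2
    (μ σ : ℝ) (ν : MeasureTheory.Measure ℝ)
    (hν : ν (Set.Ici 0) = 0)
    (hνint : ∫⁻ x, ENNReal.ofReal (min 1 (x ^ 2)) ∂ν ≠ ⊤)
    (ψ : ℝ → ℝ)
    (hψ : ∀ β : ℝ, 0 ≤ β →
      ψ β = μ * β + σ ^ 2 / 2 * β ^ 2 +
        ∫ z, (Real.exp (β * z) - 1 -
          Set.indicator (Set.Ioi (-1 : ℝ)) (fun t => β * t) z) ∂ν)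
    (Φ : ℝ → ℝ)
    (hΦ : ∀ s : ℝ, 0 ≤ s → 0 ≤ Φ s ∧ ψ (Φ s) = s ∧ ∀ β : ℝ, Φ s < β → s < ψ β)
    (W : ℝ → ℝ → ℝ)
    (hWnn : ∀ s : ℝ, 0 ≤ s → ∀ x : ℝ, 0 ≤ W s x)
    (hWzero : ∀ s : ℝ, 0 ≤ s → ∀ x : ℝ, x < 0 → W s x = 0)
    (hWcont : ∀ s : ℝ, 0 ≤ s → ContinuousOn (W s) (Set.Ici 0))
    (hWmono : ∀ s : ℝ, 0 ≤ s → MonotoneOn (W s) (Set.Ici 0))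
    (hWlap : ∀ s : ℝ, 0 ≤ s → ∀ β : ℝ, Φ s < β →
      ∫ x in Set.Ioi (0 : ℝ), Real.exp (-β * x) * W s x = 1 / (ψ β - s))
    (r q : ℝ) (hr : 0 < r) (hq : 0 < q)
    (I : ℝ → ℝ)
    (hI : ∀ x : ℝ, I x = ∫ u in Set.Ioi (0 : ℝ), Real.exp (-Φ (r + q) * u) * W r (u + x))
    :
    (∀ x : ℝ, x ≤ 0 → I x = Real.exp (Φ (r + q) * x) / q) ∧
    (ContinuousOn (W r) {(0 : ℝ)}ᶜ →
      (∀ x : ℝ, x ≠ 0 → HasDerivAt I (Φ (r + q) * I x - W r x) x) ∧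
      ContinuousOn (fun x => Φ (r + q) * I x - W r x) {(0 : ℝ)}ᶜ) ∧
    (ContinuousOn (W r) {(0 : ℝ)}ᶜ →
      ∀ I' W' : ℝ → ℝ,
        (∀ x : ℝ, x ≠ 0 → HasDerivAt I (I' x) x) →
        (∀ x : ℝ, 0 < x → HasDerivAt (W r) (W' x) x) →
        ContinuousOn W' (Set.Ioi 0) →
        (∀ x : ℝ, 0 < x → HasDerivAt I' (Φ (r + q) * I' x - W' x) x) ∧
        ContinuousOn (fun x => Φ (r + q) * I' x - W' x) (Set.Ioi 0)) := by
  have hrq : 0 ≤ r + q := by positivity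
  obtain ⟨-, hψc, hgt⟩ := hΦ (r + q) hrq
  have hψr := (hΦ r hr.le).2.1
  have hlt : Φ r < Φ (r + q) := by
    rcases lt_trichotomy (Φ r) (Φ (r + q)) with h | h | h
    · exact h
    · rw [← h] at hψc; linarith
    · have := hgt _ h
      linarith
  have hlap := hWlap r hr.le _ hlt
  rw [hψc, add_sub_cancel_left] at hlap
  set c := Φ (r + q)
  have hint : Integrable fun v => exp (-c * v) * W r v := by
    refine integrable_of_integrableOn_Ioi_of_neg ?_ fun x hx => by
      rw [hWzero r hr.le x hx, mul_zero]
    by_contra hni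
    have hz := integral_undef hni
    rw [hlap] at hz
    exact (one_div_pos.2 hq).ne' hz
  have hI' : ∀ x, I x =
      exp (c * x) * (1 / q - ∫ v in (0 : ℝ)..x, exp (-c * v) * W r v) := fun x => by
    rw [hI, integral_exp_mul_comp_add_eq hint, hlap]
  have hderiv (hcont : ContinuousOn (W r) {(0 : ℝ)}ᶜ) (x : ℝ) (hx : x ≠ 0) :
      HasDerivAt I (c * I x - W r x) x := by
    have hWx : ContinuousAt (W r) x := hcont.continuousAt (isOpen_compl_singleton.mem_nhds hx)
    have hg : HasDerivAt (fun x => ∫ v in (0 : ℝ)..x, exp (-c * v) * W r v)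
        (exp (-c * x) * W r x) x :=
      intervalIntegral.integral_hasDerivAt_right hint.intervalIntegrable
        hint.aestronglyMeasurable.stronglyMeasurableAtFilter
        (ContinuousAt.mul (by fun_prop) hWx)
    have he : HasDerivAt (fun x => exp (c * x)) (exp (c * x) * (c * 1)) x :=
      ((hasDerivAt_id x).const_mul c).exp
    rw [funext hI']
    refine (he.mul (hg.const_sub (1 / q))).congr_deriv ?_
    have hexp : exp (c * x) * exp (-c * x) = 1 := by
      rw [← exp_add]; simp
    linear_combination -W r x * hexp
  refine ⟨fun x hx => ?_, fun hcont => ⟨hderiv hcont, ?_⟩,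
    fun hcont I' W' hdI hdW hW' => ?_⟩
  · have hz : ∫ v in (0 : ℝ)..x, exp (-c * v) * W r v = 0 := by
      rw [intervalIntegral.integral_symm, intervalIntegral.integral_of_le hx,
        integral_Ioc_eq_integral_Ioo, setIntegral_eq_zero_of_forall_eq_zero, neg_zero]
      exact fun v hv => by rw [hWzero r hr.le v hv.2, mul_zero]
    rw [hI', hz, sub_zero, mul_one_div]
  · exact ContinuousOn.sub (continuousOn_const.mul fun x hx =>
      (hderiv hcont x hx).continuousAt.continuousWithinAt) hcont
  · have hder (x : ℝ) (hx : 0 < x) : HasDerivAt I' (c * I' x - W' x) x := by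
      refine (((hdI x hx.ne').const_mul c).sub (hdW x hx)).congr_of_eventuallyEq ?_
      filter_upwards [isOpen_compl_singleton.mem_nhds hx.ne'] with y hy
      exact (hdI y hy).unique (hderiv hcont y hy)
    exact ⟨hder, ContinuousOn.sub (continuousOn_const.mul fun x hx =>
      (hder x hx).continuousAt.continuousWithinAt) hW'⟩
end

section
/- Assume W^{(r)} is twice continuously differentiable on (0,∞) and that the tail measure Π̄(x) := Π((−∞,−x)), x > 0, either admits a completely monotone density or is log-convex. Then (I^{(r,q)})″(x) ≥ (I^{(r,q)})′(x) for all x > 0 if and only if (Φ(r+q) − 1)·(Φ(r+q) − q·W^{(r)}(0)) − q·(W^{(r)})′(0+) ≥ 0. -/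
open MeasureTheory Real Set Filter Topology

open ProbabilityTheory in
/-- A measure on `ℝ` is determined by its two-sided Laplace transform on a half-line. -/
lemma measure_ext_of_laplace {μ₁ μ₂ : Measure ℝ} {p : ℝ}
    (h : ∀ β, p < β → ∫⁻ x, ENNReal.ofReal (exp (-β * x)) ∂μ₁ =
      ∫⁻ x, ENNReal.ofReal (exp (-β * x)) ∂μ₂)
    (hfin : ∀ β, p < β → ∫⁻ x, ENNReal.ofReal (exp (-β * x)) ∂μ₁ ≠ ⊤) : μ₁ = μ₂ := by
  set f : ℝ → ENNReal := fun x => ENNReal.ofReal (exp (-(p + 1) * x)) with hf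
  have hfm : Measurable f := by fun_prop
  have key : ∀ (μ : Measure ℝ) (t : ℝ),
      ∫⁻ x, ENNReal.ofReal (exp (t * x)) ∂(μ.withDensity f) =
        ∫⁻ x, ENNReal.ofReal (exp (-(p + 1 - t) * x)) ∂μ := by
    intro μ t
    rw [lintegral_withDensity_eq_lintegral_mul _ hfm (by fun_prop)]
    congr 1 with x
    simp only [hf, Pi.mul_apply]
    rw [← ENNReal.ofReal_mul (exp_pos _).le, ← exp_add]
    ring_nf
  have hfinm : ∀ μ : Measure ℝ, (∀ β, p < β → ∫⁻ x, ENNReal.ofReal (exp (-β * x)) ∂μ ≠ ⊤) →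
      IsFiniteMeasure (μ.withDensity f) ∧ Iio 1 ⊆ integrableExpSet id (μ.withDensity f) := by
    intro μ hμ
    refine ⟨⟨?_⟩, ?_⟩
    · have := key μ 0
      simp only [zero_mul, exp_zero, ENNReal.ofReal_one, lintegral_const, one_mul, sub_zero] at this
      rw [this]
      exact (hμ _ (by linarith)).lt_top
    · intro t ht
      refine ⟨by fun_prop, ?_⟩
      rw [hasFiniteIntegral_iff_ofReal (ae_of_all _ fun _ => (exp_pos _).le)]
      simp only [id]
      rw [key μ t]
      exact (hμ _ (by simp only [mem_Iio] at ht; linarith)).lt_top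
  obtain ⟨hf1, hs1⟩ := hfinm μ₁ hfin
  obtain ⟨hf2, hs2⟩ := hfinm μ₂ (fun β hβ => by rw [← h β hβ]; exact hfin β hβ)
  have hmgf : ∀ t < 1, mgf id (μ₁.withDensity f) t = mgf id (μ₂.withDensity f) t := by
    intro t ht
    simp only [mgf, id]
    rw [integral_eq_lintegral_of_nonneg_ae (ae_of_all _ fun _ => (exp_pos _).le) (by fun_prop),
      integral_eq_lintegral_of_nonneg_ae (ae_of_all _ fun _ => (exp_pos _).le) (by fun_prop),
      key, key, h _ (by linarith)]
  have hsub : ∀ μ : Measure ℝ, Iio 1 ⊆ integrableExpSet id μ →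
      AnalyticOnNhd ℂ (complexMGF id μ) {z | z.re ∈ Iio (1 : ℝ)} := by
    intro μ hμ z hz
    exact analyticOnNhd_complexMGF z (interior_maximal hμ isOpen_Iio hz)
  have heq : Set.EqOn (complexMGF id (μ₁.withDensity f)) (complexMGF id (μ₂.withDensity f))
      {z | z.re ∈ Iio (1 : ℝ)} := by
    refine AnalyticOnNhd.eqOn_of_preconnected_of_frequently_eq (hsub _ hs1) (hsub _ hs2)
      ((convex_Iio (1 : ℝ)).linear_preimage Complex.reLm).isPreconnected
      (z₀ := ((0 : ℝ) : ℂ)) (by simp) ?_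
    have h_real : ∃ᶠ (x : ℝ) in 𝓝[≠] (0 : ℝ),
        complexMGF id (μ₁.withDensity f) x = complexMGF id (μ₂.withDensity f) x := by
      have : ∀ᶠ x : ℝ in 𝓝[≠] (0 : ℝ), x < 1 :=
        eventually_nhdsWithin_of_eventually_nhds (Iio_mem_nhds one_pos)
      refine (this.mono fun y hy => ?_).frequently
      rw [complexMGF_ofReal, complexMGF_ofReal, hmgf y hy]
    rw [frequently_iff_seq_forall] at h_real ⊢
    obtain ⟨xs, hx_tendsto, hx_eq⟩ := h_real
    refine ⟨fun n ↦ xs n, ?_, fun n ↦ ?_⟩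
    · rw [tendsto_nhdsWithin_iff] at hx_tendsto ⊢
      constructor
      · rw [Filter.tendsto_ofReal_iff]
        exact hx_tendsto.1
      · simpa using hx_tendsto.2
    · simp [hx_eq]
  have hmeas : μ₁.withDensity f = μ₂.withDensity f := by
    apply Measure.ext_of_charFun
    ext t
    rw [← complexMGF_id_mul_I, ← complexMGF_id_mul_I]
    exact heq (by simp)
  have hne : ∀ x, f x ≠ 0 := fun x => by simp [hf, exp_pos]
  rw [← withDensity_inv_same hfm (μ := μ₁) (ae_of_all _ hne) (ae_of_all _ fun x => by simp [hf]),
    ← withDensity_inv_same hfm (μ := μ₂) (ae_of_all _ hne) (ae_of_all _ fun x => by simp [hf]),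
    hmeas]

/-- The measure with density `k⁺` on `(0,∞)`. -/
noncomputable def densityMeasure (k : ℝ → ℝ) : Measure ℝ :=
  (volume.restrict (Ioi 0)).withDensity fun x => ENNReal.ofReal (k x)

noncomputable instance (k : ℝ → ℝ) : SFinite (densityMeasure k) := by
  unfold densityMeasure; infer_instance

/-- Lebesgue integral form of the Laplace transform. -/
noncomputable def laplaceMeasure (μ : Measure ℝ) (β : ℝ) : ENNReal :=
  ∫⁻ x, ENNReal.ofReal (exp (-β * x)) ∂μ

lemma laplaceMeasure_densityMeasure {k : ℝ → ℝ}
    (hk : AEMeasurable k (volume.restrict (Ioi 0))) (β : ℝ) :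
    laplaceMeasure (densityMeasure k) β =
      ∫⁻ x in Ioi 0, ENNReal.ofReal (exp (-β * x) * k x) := by
  unfold laplaceMeasure densityMeasure
  rw [lintegral_withDensity_eq_lintegral_mul₀ hk.ennreal_ofReal (by fun_prop)]
  congr 1 with x
  rw [Pi.mul_apply, ENNReal.ofReal_mul (exp_pos _).le, mul_comm]

lemma laplaceMeasure_densityMeasure_of_nonneg {k : ℝ → ℝ}
    (hk : AEMeasurable k (volume.restrict (Ioi 0))) (h0 : ∀ x, 0 < x → 0 ≤ k x) {β : ℝ}
    (hint : IntegrableOn (fun x => exp (-β * x) * k x) (Ioi 0)) :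
    laplaceMeasure (densityMeasure k) β =
      ENNReal.ofReal (∫ x in Ioi 0, exp (-β * x) * k x) := by
  rw [laplaceMeasure_densityMeasure hk, ofReal_integral_eq_lintegral_ofReal hint]
  filter_upwards [ae_restrict_mem measurableSet_Ioi] with x hx
  exact mul_nonneg (exp_pos _).le (h0 x hx)

lemma laplaceMeasure_conv (μ₁ μ₂ : Measure ℝ) [SFinite μ₂] (β : ℝ) :
    laplaceMeasure (μ₁.conv μ₂) β = laplaceMeasure μ₁ β * laplaceMeasure μ₂ β := by
  unfold laplaceMeasure
  rw [Measure.lintegral_conv (by fun_prop)]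
  rw [← lintegral_mul_const _ (by fun_prop)]
  congr 1 with x
  rw [← lintegral_const_mul _ (by fun_prop)]
  congr 1 with y
  rw [← ENNReal.ofReal_mul (exp_pos _).le, ← exp_add]
  ring_nf

lemma laplaceMeasure_add (μ₁ μ₂ : Measure ℝ) (β : ℝ) :
    laplaceMeasure (μ₁ + μ₂) β = laplaceMeasure μ₁ β + laplaceMeasure μ₂ β :=
  lintegral_add_measure _ _ _

lemma laplaceMeasure_smul_dirac (c : ENNReal) (β : ℝ) :
    laplaceMeasure (c • Measure.dirac 0) β = c := by
  unfold laplaceMeasure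
  rw [lintegral_smul_measure, lintegral_dirac' _ (by fun_prop)]
  simp

/-- A continuous function whose Laplace transform is that of a positive measure, here a
convolution, is nonnegative. -/
lemma nonneg_of_laplace_eq_mul {h : ℝ → ℝ} (hc : ContinuousOn h (Ioi 0)) {p : ℝ}
    (hint : ∀ β, p < β → IntegrableOn (fun x => exp (-β * x) * h x) (Ioi 0))
    {m₁ m₂ : Measure ℝ} [SFinite m₂] {a b : ℝ → ℝ}
    (ha : ∀ β, p < β → 0 ≤ a β) (hb : ∀ β, p < β → 0 ≤ b β)
    (h₁ : ∀ β, p < β → laplaceMeasure m₁ β = ENNReal.ofReal (a β))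
    (h₂ : ∀ β, p < β → laplaceMeasure m₂ β = ENNReal.ofReal (b β))
    (heq : ∀ β, p < β → ∫ x in Ioi 0, exp (-β * x) * h x = a β * b β)
    {x : ℝ} (hx : 0 < x) : 0 ≤ h x := by
  have hm : AEMeasurable h (volume.restrict (Ioi 0)) := hc.aemeasurable measurableSet_Ioi
  have hmn : AEMeasurable (fun x => -h x) (volume.restrict (Ioi 0)) := hm.neg
  have hplus : ∀ β, p < β → laplaceMeasure (densityMeasure h) β ≠ ⊤ := by
    intro β hβ
    rw [laplaceMeasure_densityMeasure hm]
    exact (hint β hβ).lintegral_lt_top.ne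
  have hEq : densityMeasure h = densityMeasure (fun x => -h x) + m₁.conv m₂ := by
    refine measure_ext_of_laplace (p := p) (fun β hβ => ?_) hplus
    change laplaceMeasure _ β = laplaceMeasure _ β
    rw [laplaceMeasure_add, laplaceMeasure_conv, h₁ β hβ, h₂ β hβ, ← ENNReal.ofReal_mul (ha β hβ),
      ← heq β hβ]
    have hneg : laplaceMeasure (densityMeasure (fun x => -h x)) β ≠ ⊤ := by
      rw [laplaceMeasure_densityMeasure hmn]
      simpa using (hint β hβ).neg.lintegral_lt_top.ne
    rw [← ENNReal.toReal_eq_toReal_iff' (hplus β hβ)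
      (ENNReal.add_ne_top.2 ⟨hneg, ENNReal.ofReal_ne_top⟩),
      ENNReal.toReal_add hneg ENNReal.ofReal_ne_top,
      ENNReal.toReal_ofReal (by rw [heq β hβ]; exact mul_nonneg (ha β hβ) (hb β hβ)),
      integral_eq_lintegral_pos_part_sub_lintegral_neg_part (hint β hβ),
      laplaceMeasure_densityMeasure hm, laplaceMeasure_densityMeasure hmn]
    simp
  by_contra hneg
  push Not at hneg
  obtain ⟨S, hSs, hSo, hxS⟩ : ∃ S ⊆ {y | 0 < y ∧ h y < 0}, IsOpen S ∧ x ∈ S := by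
    have h1 : ∀ᶠ y in 𝓝 x, 0 < y := Ioi_mem_nhds hx
    have h2 : ∀ᶠ y in 𝓝 x, h y < 0 :=
      (hc.continuousAt (Ioi_mem_nhds hx)).eventually (Iio_mem_nhds hneg)
    exact mem_nhds_iff.1 (h1.and h2)
  have hz : densityMeasure h S = 0 := by
    unfold densityMeasure
    rw [withDensity_apply _ hSo.measurableSet, setLIntegral_eq_zero_iff' hSo.measurableSet]
    · filter_upwards with y hy
      simpa using (hSs hy).2.le
    · exact hm.ennreal_ofReal.restrict
  rw [hEq, Measure.add_apply] at hz
  have hz' := (add_eq_zero.1 hz).1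
  unfold densityMeasure at hz'
  rw [withDensity_apply _ hSo.measurableSet, setLIntegral_eq_zero_iff' hSo.measurableSet
    hmn.ennreal_ofReal.restrict, ae_restrict_iff' measurableSet_Ioi] at hz'
  have hnull : volume S = 0 := by
    refine measure_mono_null (fun y hy => ?_) (ae_iff.1 hz')
    simp only [mem_ofPred_eq]
    push Not
    exact ⟨(hSs hy).1, hy, by simpa using (hSs hy).2⟩
  exact (hSo.measure_pos volume ⟨x, hxS⟩).ne' hnull

lemma integrableOn_exp_mul_of_bound {f : ℝ → ℝ} {C c β : ℝ} (hf : ContinuousOn f (Ioi 0))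
    (hb : ∀ x, 0 < x → |f x| ≤ C * exp (c * x)) (hβ : c < β) :
    IntegrableOn (fun x => exp (-β * x) * f x) (Ioi 0) := by
  have h1 : IntegrableOn (fun x => C * exp (-(β - c) * x)) (Ioi 0) :=
    (exp_neg_integrableOn_Ioi 0 (sub_pos.2 hβ)).const_mul C
  refine Integrable.mono' h1 ?_ ?_
  · exact ContinuousOn.aestronglyMeasurable (by fun_prop) measurableSet_Ioi
  · filter_upwards [ae_restrict_mem measurableSet_Ioi] with x hx
    rw [norm_mul, norm_of_nonneg (exp_pos _).le, norm_eq_abs]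
    calc exp (-β * x) * |f x| ≤ exp (-β * x) * (C * exp (c * x)) := by
          gcongr; exact hb x hx
      _ = C * exp (-(β - c) * x) := by
          rw [mul_left_comm, ← exp_add]; ring_nf

/-- Initial value theorem for the Laplace transform. -/
lemma tendsto_mul_laplace {f : ℝ → ℝ} {C c L : ℝ} (hf : ContinuousOn f (Ioi 0))
    (hb : ∀ x, 0 < x → |f x| ≤ C * exp (c * x)) (h0 : Tendsto f (𝓝[>] 0) (𝓝 L)) :
    Tendsto (fun β => β * ∫ x in Ioi 0, exp (-β * x) * f x) atTop (𝓝 L) := by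
  have hC : 0 ≤ C := by
    have := (abs_nonneg _).trans (hb 1 one_pos)
    exact nonneg_of_mul_nonneg_left this (exp_pos _)
  have hlim : Tendsto (fun β : ℝ => ∫ y in Ioi (0 : ℝ), exp (-y) * f (β⁻¹ * y)) atTop
      (𝓝 (∫ y in Ioi (0 : ℝ), exp (-y) * L)) := by
    refine tendsto_integral_filter_of_dominated_convergence (fun y => C * exp (-(1 / 2) * y))
      ?_ ?_ ((exp_neg_integrableOn_Ioi 0 (by norm_num)).const_mul C) ?_
    · filter_upwards [eventually_gt_atTop 0] with β hβ
      refine ContinuousOn.aestronglyMeasurable ?_ measurableSet_Ioi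
      refine ContinuousOn.mul (by fun_prop) (hf.comp (by fun_prop) fun y hy => ?_)
      exact mul_pos (inv_pos.2 hβ) hy
    · filter_upwards [eventually_gt_atTop 0, eventually_ge_atTop (2 * c)] with β hβ hβ2
      filter_upwards [ae_restrict_mem measurableSet_Ioi] with y hy
      have hy' : 0 < y := hy
      rw [norm_mul, norm_of_nonneg (exp_pos _).le, norm_eq_abs]
      calc exp (-y) * |f (β⁻¹ * y)| ≤ exp (-y) * (C * exp (c * (β⁻¹ * y))) := by
            gcongr; exact hb _ (mul_pos (inv_pos.2 hβ) hy)
        _ = C * exp (-y + c * (β⁻¹ * y)) := by rw [exp_add]; ring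
        _ ≤ C * exp (-(1 / 2) * y) := by
            have : c * β⁻¹ ≤ 1 / 2 := by
              rw [← div_eq_mul_inv, div_le_iff₀ hβ]; linarith
            have := mul_le_mul_of_nonneg_right this hy'.le
            gcongr
            linarith
    · filter_upwards [ae_restrict_mem measurableSet_Ioi] with y hy
      refine Tendsto.const_mul _ (h0.comp ?_)
      refine tendsto_nhdsWithin_iff.2 ⟨?_, ?_⟩
      · simpa using tendsto_inv_atTop_zero.mul_const y
      · filter_upwards [eventually_gt_atTop 0] with β hβ
        exact mul_pos (inv_pos.2 hβ) hy
  rw [integral_mul_const, integral_exp_neg_Ioi_zero, one_mul] at hlim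
  refine hlim.congr' ?_
  filter_upwards [eventually_gt_atTop 0] with β hβ
  have := integral_comp_mul_left_Ioi (fun y => exp (-y) * f (β⁻¹ * y)) 0 hβ
  rw [mul_zero] at this
  rw [smul_eq_mul, ← div_eq_inv_mul, eq_div_iff hβ.ne', mul_comm] at this
  rw [← this]
  congr 1
  refine setIntegral_congr_fun measurableSet_Ioi fun x _ => ?_
  simp only [neg_mul]
  rw [inv_mul_cancel_left₀ hβ.ne']

lemma laplace_deriv {F F' : ℝ → ℝ} {C c F0 β : ℝ} (hF : ∀ x, 0 < x → HasDerivAt F (F' x) x)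
    (hF'c : ContinuousOn F' (Ioi 0)) (h0 : Tendsto F (𝓝[>] 0) (𝓝 F0))
    (hb : ∀ x, 0 < x → |F x| ≤ C * exp (c * x)) (hb' : ∀ x, 0 < x → |F' x| ≤ C * exp (c * x))
    (hβ : c < β) :
    ∫ x in Ioi 0, exp (-β * x) * F' x = β * (∫ x in Ioi 0, exp (-β * x) * F x) - F0 := by
  have hFc : ContinuousOn F (Ioi 0) := fun x hx => (hF x hx).continuousAt.continuousWithinAt
  have i1 := integrableOn_exp_mul_of_bound hFc hb hβ
  have i2 := integrableOn_exp_mul_of_bound hF'c hb' hβ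
  have hexp : ∀ x, HasDerivAt (fun x => exp (-β * x)) (exp (-β * x) * (-β)) x := fun x => by
    simpa using ((hasDerivAt_id x).const_mul (-β)).exp
  have hz : Tendsto (fun x => exp (-β * x)) (𝓝[>] 0) (𝓝 1) := by
    have : Tendsto (fun x => exp (-β * x)) (𝓝 0) (𝓝 (exp (-β * 0))) :=
      (hexp 0).continuousAt
    rw [mul_zero, exp_zero] at this
    exact this.mono_left nhdsWithin_le_nhds
  have hinf : Tendsto (fun x => exp (-β * x) * F x) atTop (𝓝 0) := by
    have h1 : Tendsto (fun x => C * exp (-(β - c) * x)) atTop (𝓝 0) := by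
      have : Tendsto (fun x => -(β - c) * x) atTop atBot :=
        tendsto_id.const_mul_atTop_of_neg (by linarith)
      simpa using (tendsto_exp_atBot.comp this).const_mul C
    refine squeeze_zero_norm' ?_ h1
    filter_upwards [eventually_gt_atTop 0] with x hx
    rw [norm_mul, norm_of_nonneg (exp_pos _).le, norm_eq_abs]
    calc exp (-β * x) * |F x| ≤ exp (-β * x) * (C * exp (c * x)) := by
          gcongr; exact hb x hx
      _ = C * exp (-(β - c) * x) := by
          rw [mul_left_comm, ← exp_add]; ring_nf
  have key := integral_Ioi_mul_deriv_eq_deriv_mul (a := 0) (fun x _ => hexp x)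
    (fun x hx => hF x hx) i2 ?_ (hz.mul h0) hinf
  · rw [key]
    have : ∀ x, exp (-β * x) * (-β) * F x = -β * (exp (-β * x) * F x) := fun x => by ring
    simp_rw [this]
    rw [integral_const_mul]
    simp
    ring
  · refine (i1.const_mul (-β)).congr (ae_of_all _ fun x => ?_)
    simp only [Pi.mul_apply]
    ring

section
open Polynomial

lemma eval_iterate_derivative_eq_taylor (q : ℝ[X]) (k : ℕ) (t : ℝ) :
    (derivative^[k] q).eval t = k.factorial * (taylor t q).coeff k := by
  rw [taylor_coeff, ← factorial_smul_hasseDeriv]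
  simp

lemma eval_iterate_derivative_pow_mul_sq_nonneg (m k : ℕ) {t : ℝ} (ht : 0 ≤ t) :
    0 ≤ (derivative^[k] (X ^ m * (X - C t) ^ 2 : ℝ[X])).eval t := by
  lift t to NNReal using ht
  rw [eval_iterate_derivative_eq_taylor]
  have : taylor (t : ℝ) (X ^ m * (X - C (t : ℝ)) ^ 2 : ℝ[X]) =
      ((X + C t) ^ m * X ^ 2 : NNReal[X]).map NNReal.toRealHom := by
    rw [Polynomial.map_mul, Polynomial.map_pow, Polynomial.map_pow, Polynomial.map_add,
      Polynomial.map_C, Polynomial.map_X, taylor_mul, taylor_pow, taylor_pow, taylor_X, map_sub,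
      taylor_X, taylor_C, add_sub_cancel_right]
    rfl
  rw [this, coeff_map]
  exact mul_nonneg (Nat.cast_nonneg _) (NNReal.coe_nonneg _)

/-- The first three derivatives of a completely monotone function satisfy a Cauchy–Schwarz type
inequality. -/
lemma sq_le_mul_of_alternating_derivatives {a : ℕ → ℝ → ℝ} (h0 : ∀ k x, 0 < x → 0 ≤ a k x)
    (hd : ∀ k x, 0 < x → HasDerivAt (a k) (-(a (k + 1) x)) x) {x : ℝ} (hx : 0 < x) :
    a 1 x ^ 2 ≤ a 0 x * a 2 x := by
  have key : ∀ (m : ℕ) (t : ℝ), 0 ≤ t →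
      0 ≤ (m + 2) * (m + 1) * a 0 x - 2 * t * (m + 1) * a 1 x + t ^ 2 * a 2 x := by
    intro m t ht
    set q : ℝ[X] := X ^ m * (X - C t) ^ 2 with hq
    set F : ℝ → ℝ := fun y =>
      ∑ k ∈ Finset.range (m + 3), (derivative^[k] q).eval (y - x) * a (m + 2 - k) y with hF
    have hdeg : derivative^[m + 3] q = 0 := by
      apply iterate_derivative_eq_zero
      rw [hq]
      compute_degree
      all_goals omega
    have hFd : ∀ y, 0 < y → HasDerivAt F (-(q.eval (y - x) * a (m + 3) y)) y := by
      intro y hy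
      have h1 : HasDerivAt F (∑ k ∈ Finset.range (m + 3),
          ((derivative^[k + 1] q).eval (y - x) * a (m + 3 - (k + 1)) y -
            (derivative^[k] q).eval (y - x) * a (m + 3 - k) y)) y := by
        have := HasDerivAt.fun_sum (u := Finset.range (m + 3))
          (A := fun k y => (derivative^[k] q).eval (y - x) * a (m + 2 - k) y) (x := y)
          (A' := fun k => (derivative^[k + 1] q).eval (y - x) * a (m + 3 - (k + 1)) y -
            (derivative^[k] q).eval (y - x) * a (m + 3 - k) y) ?_
        · exact this
        · intro k hk
          have hk' : k < m + 3 := Finset.mem_range.1 hk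
          have e1 : m + 3 - (k + 1) = m + 2 - k := by omega
          have e2 : m + 3 - k = m + 2 - k + 1 := by omega
          have hp : HasDerivAt (fun y => (derivative^[k] q).eval (y - x))
              ((derivative^[k + 1] q).eval (y - x)) y := by
            rw [Function.iterate_succ_apply']
            exact ((derivative^[k] q).hasDerivAt (y - x)).comp_sub_const y x
          refine (hp.mul (hd (m + 2 - k) y hy)).congr_deriv ?_
          rw [e1, e2]
          ring
      rw [Finset.sum_range_sub (fun k => (derivative^[k] q).eval (y - x) * a (m + 3 - k) y),
        hdeg] at h1
      simpa using h1
    have hanti : AntitoneOn F (Icc x (x + t)) := by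
      refine antitoneOn_of_deriv_nonpos (convex_Icc _ _)
        (fun y hy => (hFd y (hx.trans_le hy.1)).continuousAt.continuousWithinAt)
        (fun y hy => ?_) (fun y hy => ?_)
      · rw [interior_Icc] at hy
        exact (hFd y (hx.trans hy.1)).differentiableAt.differentiableWithinAt
      · rw [interior_Icc] at hy
        rw [(hFd y (hx.trans hy.1)).deriv, neg_nonpos]
        refine mul_nonneg ?_ (h0 _ _ (hx.trans hy.1))
        have : 0 ≤ y - x := by linarith [hy.1]
        rw [hq, eval_mul, eval_pow, eval_pow, eval_X]
        positivity
    have hend : 0 ≤ F (x + t) := by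
      refine Finset.sum_nonneg fun k _ => mul_nonneg ?_ (h0 _ _ (by linarith))
      rw [add_sub_cancel_left]
      exact eval_iterate_derivative_pow_mul_sq_nonneg m k ht
    have hFx : 0 ≤ F x :=
      hend.trans (hanti (left_mem_Icc.2 (by linarith)) (right_mem_Icc.2 (by linarith))
        (by linarith))
    have hval : F x = m.factorial *
        ((m + 2) * (m + 1) * a 0 x - 2 * t * (m + 1) * a 1 x + t ^ 2 * a 2 x) := by
      have hc : ∀ k, (derivative^[k] q).eval (x - x) = k.factorial * q.coeff k := by
        intro k
        rw [sub_self, eval_iterate_derivative_eq_taylor, taylor_zero]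
      have hcoef : ∀ k, q.coeff (k + m) = ((X - C t) ^ 2 : ℝ[X]).coeff k := fun k => by
        rw [hq, coeff_X_pow_mul]
      have hsq : ((X - C t) ^ 2 : ℝ[X]) = X ^ 2 + C (-2 * t) * X + C (t ^ 2) := by
        simp only [C_mul, C_pow, C_neg]
        have : (C 2 : ℝ[X]) = 2 := rfl
        rw [this]
        ring
      have c0 : q.coeff m = t ^ 2 := by
        have := hcoef 0
        rw [zero_add] at this
        rw [this, hsq]; simp [-map_pow]
      have c1 : q.coeff (m + 1) = -2 * t := by
        rw [add_comm, hcoef, hsq]; simp [coeff_X_pow, coeff_C, -map_pow]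
      have c2 : q.coeff (m + 2) = 1 := by
        rw [add_comm, hcoef, hsq]; simp [-map_pow]
      simp only [hF, hc]
      rw [Finset.sum_range_succ, Finset.sum_range_succ, Finset.sum_range_succ,
        Finset.sum_eq_zero, c0, c1, c2]
      · rw [show m + 2 - m = 2 by omega, show m + 2 - (m + 1) = 1 by omega, Nat.sub_self,
          Nat.factorial_succ (m + 1), Nat.factorial_succ m]
        push_cast
        ring
      · intro k hk
        rw [hq, coeff_X_pow_mul', if_neg (by simpa using hk)]
        simp
    rw [hval] at hFx
    exact nonneg_of_mul_nonneg_right hFx (by positivity)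
  have hquad : ∀ s : ℝ, 0 ≤ a 2 x * (s * s) + (-2 * a 1 x) * s + a 0 x := by
    intro s
    rcases le_or_gt 0 s with hs | hs
    · have hlim : Tendsto (fun m : ℕ => (1 + 1 / ((m : ℝ) + 1)) * a 0 x - 2 * s * a 1 x +
          s ^ 2 * a 2 x) atTop (𝓝 ((1 + 0) * a 0 x - 2 * s * a 1 x + s ^ 2 * a 2 x)) :=
        (((tendsto_one_div_add_atTop_nhds_zero_nat.const_add 1).mul_const _).sub_const _).add_const
          _
      have := ge_of_tendsto' (b := 0) hlim fun m => ?_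
      · linarith
      · have hm : (0 : ℝ) < m + 1 := by positivity
        have h := key m ((m + 1) * s) (by positivity)
        have e : (m + 2) * (m + 1) * a 0 x - 2 * ((m + 1) * s) * (m + 1) * a 1 x +
            ((m + 1) * s) ^ 2 * a 2 x = ((m : ℝ) + 1) ^ 2 *
            ((1 + 1 / ((m : ℝ) + 1)) * a 0 x - 2 * s * a 1 x + s ^ 2 * a 2 x) := by
          field_simp
          ring
        rw [e] at h
        exact nonneg_of_mul_nonneg_right h (by positivity)
    · have := h0 0 x hx
      have := h0 1 x hx
      have := h0 2 x hx
      nlinarith [mul_nonneg (h0 1 x hx) (neg_nonneg.2 hs.le),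
        mul_nonneg (h0 2 x hx) (mul_self_nonneg s)]
  have := discrim_le_zero hquad
  rw [discrim] at this
  nlinarith

end

lemma mul_le_mul_of_alternating_derivatives {a : ℕ → ℝ → ℝ} (h0 : ∀ k x, 0 < x → 0 ≤ a k x)
    (hpos : ∀ x, 0 < x → 0 < a 0 x)
    (hd : ∀ k x, 0 < x → HasDerivAt (a k) (-(a (k + 1) x)) x) {x y u : ℝ} (hy : 0 < y)
    (hyx : y ≤ x) (hu : 0 ≤ u) : a 0 x * a 0 (y + u) ≤ a 0 (x + u) * a 0 y := by
  have hanti : AntitoneOn (fun x => a 1 x / a 0 x) (Ioi 0) := by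
    have hder : ∀ z, 0 < z → HasDerivAt (fun x => a 1 x / a 0 x)
        ((-(a 2 z) * a 0 z - a 1 z * -(a 1 z)) / a 0 z ^ 2) z := fun z hz =>
      (hd 1 z hz).div (hd 0 z hz) (hpos z hz).ne'
    refine antitoneOn_of_deriv_nonpos (convex_Ioi _)
      (fun z hz => (hder z hz).continuousAt.continuousWithinAt) (fun z hz => ?_) (fun z hz => ?_)
    · rw [interior_Ioi] at hz
      exact (hder z hz).differentiableAt.differentiableWithinAt
    · rw [interior_Ioi] at hz
      rw [(hder z hz).deriv]
      refine div_nonpos_of_nonpos_of_nonneg ?_ (sq_nonneg _)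
      nlinarith [sq_le_mul_of_alternating_derivatives h0 hd hz]
  have hmono : MonotoneOn (fun v => a 0 (x + v) / a 0 (y + v)) (Ici 0) := by
    have hder : ∀ v, 0 ≤ v → HasDerivAt (fun v => a 0 (x + v) / a 0 (y + v))
        ((-(a 1 (x + v)) * a 0 (y + v) - a 0 (x + v) * -(a 1 (y + v))) / a 0 (y + v) ^ 2) v := by
      intro v hv
      exact ((hd 0 (x + v) (by linarith)).comp_const_add x v).div
        ((hd 0 (y + v) (by linarith)).comp_const_add y v) (hpos _ (by linarith)).ne'
    refine monotoneOn_of_deriv_nonneg (convex_Ici _)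
      (fun z hz => (hder z hz).continuousAt.continuousWithinAt) (fun z hz => ?_) (fun z hz => ?_)
    · exact (hder z (interior_subset hz)).differentiableAt.differentiableWithinAt
    · have hz' : 0 ≤ z := interior_subset hz
      rw [(hder z hz').deriv]
      refine div_nonneg ?_ (sq_nonneg _)
      have h1 := hanti (show y + z ∈ Ioi 0 by simp only [mem_Ioi]; linarith)
        (show x + z ∈ Ioi 0 by simp only [mem_Ioi]; linarith) (by linarith)
      simp only at h1
      rw [div_le_div_iff₀ (hpos _ (by linarith)) (hpos _ (by linarith))] at h1
      linarith
  have h1 := hmono self_mem_Ici hu hu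
  simp only [add_zero] at h1
  rwa [div_le_div_iff₀ (hpos _ hy) (hpos _ (by linarith))] at h1

lemma add_mul_add_le_of_completely_monotone {T p : ℝ → ℝ} {r : ℝ} (hr : 0 < r)
    (hT : ∀ x, 0 < x → 0 ≤ T x) (hTp : ∀ x, 0 < x → T x = ∫ t in Ioi x, p t)
    (hp : ContDiffOn ℝ (⊤ : ℕ∞) p (Ioi 0))
    (hcm : ∀ n : ℕ, ∀ x, 0 < x → 0 ≤ (-1 : ℝ) ^ n * iteratedDerivWithin n p (Ioi 0) x)
    {x y u : ℝ} (hy : 0 < y) (hyx : y ≤ x) (hu : 0 ≤ u) :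
    (T x + r) * (T (y + u) + r) ≤ (T (x + u) + r) * (T y + r) := by
  by_cases hint : ∀ x, 0 < x → IntegrableOn p (Ioi x)
  · have hpc : ContinuousOn p (Ioi 0) := hp.continuousOn
    have hd0 : ∀ x, 0 < x → HasDerivAt (fun x => T x + r) (-(p x)) x := by
      intro x hx
      have hd : HasDerivAt (fun z => ∫ t in x..z, p t) (p x) x := by
        refine intervalIntegral.integral_hasDerivAt_right (by simp) ?_
          (hpc.continuousAt (Ioi_mem_nhds hx))
        exact hpc.stronglyMeasurableAtFilter isOpen_Ioi x hx
      have h2 : HasDerivAt (fun z => T x - ∫ t in x..z, p t) (0 - p x) x :=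
        (hasDerivAt_const x (T x)).sub hd
      rw [zero_sub] at h2
      refine (h2.congr_of_eventuallyEq ?_).add_const r
      filter_upwards [Ioi_mem_nhds hx] with z hz
      rw [hTp x hx, hTp z hz, ← intervalIntegral.integral_Ioi_sub_Ioi' (hint x hx) (hint z hz)]
      ring
    have hpos : ∀ x, 0 < x → 0 < T x + r := fun x hx => by linarith [hT x hx]
    let a : ℕ → ℝ → ℝ := fun k => Nat.casesOn k (fun x => T x + r)
      (fun n x => (-1 : ℝ) ^ n * iteratedDerivWithin n p (Ioi 0) x)
    refine mul_le_mul_of_alternating_derivatives (a := a) ?_ hpos ?_ hy hyx hu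
    · rintro (_ | k) x hx
      · exact (hpos x hx).le
      · exact hcm k x hx
    · rintro (_ | k) x hx
      · simpa [a] using hd0 x hx
      · have h1 : HasDerivAt (iteratedDerivWithin k p (Ioi 0))
            (iteratedDerivWithin (k + 1) p (Ioi 0) x) x := by
          rw [iteratedDerivWithin_succ]
          have := (hp.differentiableOn_iteratedDerivWithin (m := k)
            (by exact_mod_cast ENat.natCast_lt_top k) (uniqueDiffOn_Ioi 0)) x hx
          exact this.hasDerivWithinAt.hasDerivAt (Ioi_mem_nhds hx)
        refine (h1.const_mul ((-1 : ℝ) ^ k)).congr_deriv ?_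
        simp only [a, pow_succ]
        ring
  · push Not at hint
    obtain ⟨z, hz, hzi⟩ := hint
    have hT0 : ∀ x, 0 < x → T x = 0 := by
      intro x hx
      rw [hTp x hx]
      refine integral_undef fun hi => hzi ?_
      rcases le_total x z with h | h
      · exact IntegrableOn.mono_set hi (Ioi_subset_Ioi h)
      · rw [← Ioc_union_Ioi_eq_Ioi h]
        refine IntegrableOn.union ?_ hi
        exact ((hp.continuousOn.mono fun t ht => hz.trans_le ht.1).integrableOn_Icc).mono_set
          Ioc_subset_Icc_self
    rw [hT0 x (by linarith), hT0 y hy, hT0 (x + u) (by linarith), hT0 (y + u) (by linarith)]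

lemma ConvexOn.add_le_add_of_le {l : ℝ → ℝ} (hl : ConvexOn ℝ (Ioi 0) l) {x y u : ℝ} (hy : 0 < y)
    (hyx : y ≤ x) (hu : 0 ≤ u) : l x + l (y + u) ≤ l (x + u) + l y := by
  rcases (add_nonneg (sub_nonneg.2 hyx) hu).eq_or_lt with h | h
  · have hxy : x = y := by linarith
    rw [hxy, add_comm]
  · set s := (x - y) / (x - y + u) with hs
    have hs0 : 0 ≤ s := div_nonneg (by linarith) h.le
    have hs1 : 0 ≤ 1 - s := by
      rw [hs, sub_nonneg, div_le_one h]; linarith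
    have e : s * (x - y + u) = x - y := div_mul_cancel₀ _ h.ne'
    have h1 := hl.2 (show y ∈ Ioi 0 from hy) (show x + u ∈ Ioi 0 by simp only [mem_Ioi]; linarith)
      hs1 hs0 (by ring)
    have h2 := hl.2 (show y ∈ Ioi 0 from hy) (show x + u ∈ Ioi 0 by simp only [mem_Ioi]; linarith)
      hs0 hs1 (by ring)
    simp only [smul_eq_mul] at h1 h2
    have e1 : (1 - s) * y + s * (x + u) = x := by linear_combination e
    have e2 : s * y + (1 - s) * (x + u) = y + u := by linear_combination -e
    rw [e1] at h1
    rw [e2] at h2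
    linarith

lemma add_mul_add_le_of_log_convex {T : ℝ → ℝ} {r : ℝ} (hr : 0 ≤ r)
    (hT : ∀ x, 0 < x → 0 < T x) (hanti : AntitoneOn T (Ioi 0))
    (hl : ConvexOn ℝ (Ioi 0) fun x => log (T x))
    {x y u : ℝ} (hy : 0 < y) (hyx : y ≤ x) (hu : 0 ≤ u) :
    (T x + r) * (T (y + u) + r) ≤ (T (x + u) + r) * (T y + r) := by
  have hx : 0 < x := by linarith
  have hxu : 0 < x + u := by linarith
  have hyu : 0 < y + u := by linarith
  have h1 := hl.add_le_add_of_le hy hyx hu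
  rw [← log_mul (hT _ hx).ne' (hT _ hyu).ne', ← log_mul (hT _ hxu).ne' (hT _ hy).ne',
    log_le_log_iff (mul_pos (hT _ hx) (hT _ hyu)) (mul_pos (hT _ hxu) (hT _ hy))] at h1
  have hA : T x ≤ T y := hanti hy hx hyx
  have hB : T (x + u) ≤ T x := hanti hx hxu (by linarith)
  have h2 : T x + T (y + u) ≤ T (x + u) + T y := by
    have : 0 ≤ T x * (T (x + u) + T y - T x - T (y + u)) := by
      nlinarith [mul_nonneg (sub_nonneg.2 hA) (sub_nonneg.2 hB)]
    linarith [nonneg_of_mul_nonneg_right this (hT x hx)]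
  nlinarith [mul_le_mul_of_nonneg_left h2 hr]

/-- If `log T` is convex with the convention `log 0 = 0` and `T` has a continuous version, then
either `T` does not vanish or it is identically zero. -/
lemma pos_or_eq_zero_of_log_convex {T G : ℝ → ℝ} (hT : ∀ x, 0 < x → 0 ≤ T x)
    (hanti : AntitoneOn T (Ioi 0)) (hl : ConvexOn ℝ (Ioi 0) fun x => log (T x))
    (hG : ContinuousOn G (Ioi 0)) (hTG : ∀ᵐ x ∂volume.restrict (Ioi 0), T x = G x) :
    (∀ x, 0 < x → 0 < T x) ∨ ∀ x, 0 < x → T x = 0 := by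
  by_contra! hcon
  obtain ⟨⟨b, hb, hTb⟩, a, ha, hTa⟩ := hcon
  have hTb0 : T b = 0 := le_antisymm hTb (hT b hb)
  have hTa0 : 0 < T a := (hT a ha).lt_of_ne' hTa
  have hab : a < b := by
    by_contra! h
    linarith [hanti hb ha h]
  have hzero : ∀ x, b ≤ x → T x = 0 := fun x hx =>
    le_antisymm ((hanti hb (hb.trans_le hx) hx).trans hTb) (hT x (hb.trans_le hx))
  have hone : ∀ x, 0 < x → T x = 0 ∨ 1 ≤ T x := by
    intro x hx
    rcases le_or_gt b x with h | h
    · exact Or.inl (hzero x h)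
    · refine or_iff_not_imp_left.2 fun hne => ?_
      have hTx : 0 < T x := (hT x hx).lt_of_ne' hne
      have hd : 0 < b + 1 - x := by linarith
      have h1 := hl.2 (show x ∈ Ioi 0 from hx) (show b + 1 ∈ Ioi 0 by simp only [mem_Ioi]; linarith)
        (show 0 ≤ 1 / (b + 1 - x) by positivity)
        (show 0 ≤ (b - x) / (b + 1 - x) from div_nonneg (by linarith) hd.le) (by field_simp; ring)
      simp only [smul_eq_mul] at h1
      rw [show 1 / (b + 1 - x) * x + (b - x) / (b + 1 - x) * (b + 1) = b by field_simp; ring,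
        hTb0, hzero (b + 1) (by linarith), log_zero, mul_zero, add_zero] at h1
      have h2 : 0 ≤ log (T x) := nonneg_of_mul_nonneg_right h1 (by positivity)
      by_contra! hlt
      linarith [log_neg hTx hlt]
  have hpt : ∀ U : Set ℝ, IsOpen U → U.Nonempty → U ⊆ Ioi 0 → ∃ z ∈ U, T z = G z := by
    intro U hU hne hU0
    have h1 : ∃ᵐ z ∂volume.restrict U, z ∈ U := by
      have : (ae (volume.restrict U)).NeBot := by
        refine ae_neBot.2 fun h => ?_
        rw [Measure.restrict_eq_zero] at h
        exact (hU.measure_pos volume hne).ne' h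
      exact (ae_restrict_mem hU.measurableSet).frequently
    obtain ⟨z, hz, hz'⟩ := (h1.and_eventually
      (ae_mono (Measure.restrict_mono_set volume hU0) hTG)).exists
    exact ⟨z, hz, hz'⟩
  obtain ⟨z₁, hz₁, hG₁⟩ := hpt (Ioo 0 a) isOpen_Ioo ⟨a / 2, by constructor <;> linarith⟩
    (fun z hz => hz.1)
  obtain ⟨z₂, hz₂, hG₂⟩ := hpt (Ioo b (b + 1)) isOpen_Ioo ⟨b + 1 / 2, by constructor <;> linarith⟩
    (fun z hz => hb.trans hz.1)
  have hT₁ : 1 ≤ T z₁ := by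
    rcases hone z₁ hz₁.1 with h | h
    · linarith [hanti hz₁.1 ha hz₁.2.le]
    · exact h
  have hT₂ : T z₂ = 0 := hzero _ hz₂.1.le
  have hz12 : z₁ ≤ z₂ := by linarith [hz₁.2, hz₂.1]
  obtain ⟨z, hz, hGz⟩ : (1 / 2 : ℝ) ∈ G '' Icc z₁ z₂ :=
    intermediate_value_Icc' hz12 (hG.mono fun t ht => hz₁.1.trans_le ht.1)
      ⟨by rw [← hG₂, hT₂]; norm_num, by rw [← hG₁]; linarith⟩
  have hz0 : 0 < z := hz₁.1.trans_le hz.1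
  have hev : ∀ᶠ t in 𝓝 z, 0 < t ∧ 1 / 4 < G t ∧ G t < 3 / 4 := by
    have h3 := hG.continuousAt (Ioi_mem_nhds hz0)
    refine Eventually.and (Ioi_mem_nhds hz0) (h3.eventually (Ioo_mem_nhds ?_ ?_)) <;>
      rw [hGz] <;> norm_num
  obtain ⟨U, hU, hUo, hzU⟩ := mem_nhds_iff.1 hev
  obtain ⟨t, ht, htG⟩ := hpt U hUo ⟨z, hzU⟩ (fun t ht => (hU ht).1)
  obtain ⟨h4, h5, h6⟩ := hU ht
  rcases hone t h4 with h | h <;> linarith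

/-- The integrand in the Lévy–Khintchine formula for the Laplace exponent. -/
noncomputable def levyIntegrand (β z : ℝ) : ℝ :=
  Real.exp (β * z) - 1 - Set.indicator (Set.Ioi (-1 : ℝ)) (fun t => β * t) z

/-- The tail of a measure on the negative half-line. -/
noncomputable def negTail (ν : Measure ℝ) (t : ℝ) : ℝ := (ν (Set.Iio (-t))).toReal

lemma abs_exp_sub_one_sub_le_sq_half {y : ℝ} (hy : y ≤ 0) : |exp y - 1 - y| ≤ y ^ 2 / 2 := by
  rw [abs_of_nonneg (by linarith [add_one_le_exp y])]
  have hmono : AntitoneOn (fun y : ℝ => y ^ 2 / 2 - (exp y - 1 - y)) (Iic 0) := by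
    have hd : ∀ y : ℝ, HasDerivAt (fun y : ℝ => y ^ 2 / 2 - (exp y - 1 - y))
        (y - (exp y - 1)) y := fun y => by
      have := (((hasDerivAt_id y).pow 2).div_const 2).sub
        (((hasDerivAt_exp y).sub_const 1).sub (hasDerivAt_id y))
      exact this.congr_deriv (by simp)
    refine antitoneOn_of_deriv_nonpos (convex_Iic 0)
      (fun y _ => (hd y).continuousAt.continuousWithinAt)
      (fun y _ => (hd y).differentiableAt.differentiableWithinAt) fun y _ => ?_
    rw [(hd y).deriv]
    linarith [add_one_le_exp y]
  have := hmono hy self_mem_Iic hy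
  simp at this
  linarith

lemma measurable_levyIntegrand (β : ℝ) : Measurable (levyIntegrand β) := by
  unfold levyIntegrand
  exact (by fun_prop : Measurable fun z : ℝ => exp (β * z) - 1).sub
    ((by fun_prop : Measurable fun t : ℝ => β * t).indicator measurableSet_Ioi)

lemma abs_levyIntegrand_le {β : ℝ} (hβ : 0 ≤ β) {z : ℝ} (hz : z < 0) :
    |levyIntegrand β z| ≤ (1 + β ^ 2) * min 1 (z ^ 2) := by
  unfold levyIntegrand
  have hbz : β * z ≤ 0 := mul_nonpos_of_nonneg_of_nonpos hβ hz.le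
  rcases lt_or_ge (-1) z with h | h
  · rw [indicator_of_mem (show z ∈ Ioi (-1) from h), min_eq_right (by nlinarith)]
    refine (abs_exp_sub_one_sub_le_sq_half hbz).trans ?_
    nlinarith [sq_nonneg z, sq_nonneg (β * z)]
  · rw [indicator_of_notMem (show z ∉ Ioi (-1) by simpa using h), min_eq_left (by nlinarith),
      sub_zero,
      abs_sub_comm, abs_of_nonneg (by linarith [exp_le_one_iff.2 hbz])]
    nlinarith [exp_pos (β * z), sq_nonneg β]

section
variable {ν : Measure ℝ}

lemma ae_neg_of_Ici (hν : ν (Ici 0) = 0) : ∀ᵐ z ∂ν, z < 0 := by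
  refine measure_mono_null (fun z hz => ?_) hν
  simpa using hz

lemma integrable_min_one_sq (hνint : ∫⁻ x, ENNReal.ofReal (min 1 (x ^ 2)) ∂ν ≠ ⊤) :
    Integrable (fun x : ℝ => min 1 (x ^ 2)) ν := by
  refine ⟨by fun_prop, ?_⟩
  rw [hasFiniteIntegral_iff_ofReal (ae_of_all _ fun x => le_min zero_le_one (sq_nonneg x))]
  exact hνint.lt_top

lemma integrable_levyIntegrand (hν : ν (Ici 0) = 0)
    (hνint : ∫⁻ x, ENNReal.ofReal (min 1 (x ^ 2)) ∂ν ≠ ⊤) {β : ℝ} (hβ : 0 ≤ β) :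
    Integrable (levyIntegrand β) ν := by
  refine ((integrable_min_one_sq hνint).const_mul (1 + β ^ 2)).mono'
    (measurable_levyIntegrand β).aestronglyMeasurable ?_
  filter_upwards [ae_neg_of_Ici hν] with z hz
  exact abs_levyIntegrand_le hβ hz

lemma measure_Iio_neg_ne_top (hνint : ∫⁻ x, ENNReal.ofReal (min 1 (x ^ 2)) ∂ν ≠ ⊤) {t : ℝ}
    (ht : 0 < t) : ν (Iio (-t)) ≠ ⊤ := by
  have h := (integrable_min_one_sq hνint).measure_ge_lt_top (ε := min 1 (t ^ 2))
    (by positivity)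
  refine (lt_of_le_of_lt (measure_mono fun z hz => ?_) h).ne
  have : z < -t := hz
  simp only [mem_ofPred_eq]
  exact min_le_min_left 1 (by nlinarith)

lemma ofReal_negTail (hνint : ∫⁻ x, ENNReal.ofReal (min 1 (x ^ 2)) ∂ν ≠ ⊤) {t : ℝ}
    (ht : 0 < t) : ENNReal.ofReal (negTail ν t) = ν (Iio (-t)) :=
  ENNReal.ofReal_toReal (measure_Iio_neg_ne_top hνint ht)

lemma negTail_nonneg (t : ℝ) : 0 ≤ negTail ν t := ENNReal.toReal_nonneg

lemma antitoneOn_negTail (hνint : ∫⁻ x, ENNReal.ofReal (min 1 (x ^ 2)) ∂ν ≠ ⊤) :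
    AntitoneOn (negTail ν) (Ioi 0) := fun s hs t _ hst =>
  ENNReal.toReal_mono (measure_Iio_neg_ne_top hνint hs)
    (measure_mono (Iio_subset_Iio (by linarith)))

lemma tendsto_integral_levyIntegrand_div_sq (hν : ν (Ici 0) = 0)
    (hνint : ∫⁻ x, ENNReal.ofReal (min 1 (x ^ 2)) ∂ν ≠ ⊤) :
    Tendsto (fun β => (∫ z, levyIntegrand β z ∂ν) / β ^ 2) atTop (𝓝 0) := by
  have h : Tendsto (fun β => ∫ z, levyIntegrand β z / β ^ 2 ∂ν) atTop (𝓝 (∫ _, (0 : ℝ) ∂ν)) := by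
    refine tendsto_integral_filter_of_dominated_convergence (fun z => 2 * min 1 (z ^ 2)) ?_ ?_
      ((integrable_min_one_sq hνint).const_mul 2) ?_
    · exact Eventually.of_forall fun β =>
        ((measurable_levyIntegrand β).div_const _).aestronglyMeasurable
    · filter_upwards [eventually_ge_atTop 1] with β hβ
      filter_upwards [ae_neg_of_Ici hν] with z hz
      rw [norm_div, norm_of_nonneg (sq_nonneg β), norm_eq_abs, div_le_iff₀ (by positivity)]
      refine (abs_levyIntegrand_le (by linarith) hz).trans ?_
      have : 0 ≤ min 1 (z ^ 2) := le_min zero_le_one (sq_nonneg z)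
      nlinarith [mul_nonneg this (show 0 ≤ β ^ 2 - 1 by nlinarith)]
    · filter_upwards [ae_neg_of_Ici hν] with z hz
      have h2 : Tendsto (fun β : ℝ => (1 + |z| * β) / β ^ 2) atTop (𝓝 0) := by
        have h3 : Tendsto (fun β : ℝ => (1 + |z| * β) * (β⁻¹ * β⁻¹)) atTop (𝓝 0) := by
          have h4 : Tendsto (fun β : ℝ => β⁻¹ * β⁻¹ + |z| * β⁻¹) atTop (𝓝 (0 * 0 + |z| * 0)) :=
            (tendsto_inv_atTop_zero.mul tendsto_inv_atTop_zero).add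
              (tendsto_inv_atTop_zero.const_mul _)
          rw [mul_zero, mul_zero, add_zero] at h4
          refine h4.congr' ?_
          filter_upwards [eventually_gt_atTop 0] with β hβ
          field_simp
        refine h3.congr fun β => ?_
        rw [div_eq_mul_inv, sq, mul_inv]
      refine squeeze_zero_norm' ?_ h2
      filter_upwards [eventually_ge_atTop 0] with β hβ
      rw [norm_div, norm_of_nonneg (sq_nonneg β), norm_eq_abs]
      gcongr
      unfold levyIntegrand
      have hbz : β * z ≤ 0 := mul_nonpos_of_nonneg_of_nonpos hβ hz.le
      have h5 : |exp (β * z) - 1| ≤ 1 := by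
        rw [abs_sub_comm, abs_of_nonneg (by linarith [exp_le_one_iff.2 hbz])]
        linarith [exp_pos (β * z)]
      have h6 : |Set.indicator (Set.Ioi (-1 : ℝ)) (fun t => β * t) z| ≤ |z| * β := by
        refine (norm_indicator_le_norm_self (fun t => β * t) z).trans ?_
        rw [norm_mul, norm_of_nonneg hβ, mul_comm, norm_eq_abs]
      exact (abs_sub _ _).trans (add_le_add h5 h6)
  simpa [integral_div] using h

lemma levyIntegrand_div_sub_div {p β z : ℝ} (hp : 0 < p) (hβ : 0 < β) :
    levyIntegrand β z / β - levyIntegrand p z / p =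
      ∫ t in (0 : ℝ)..(-z), (exp (-p * t) - exp (-β * t)) := by
  have hd : ∀ t : ℝ, HasDerivAt (fun t => exp (-β * t) / β - exp (-p * t) / p)
      (exp (-p * t) - exp (-β * t)) t := by
    intro t
    have h : ∀ b : ℝ, 0 < b → HasDerivAt (fun t => exp (-b * t) / b) (-exp (-b * t)) t := by
      intro b hb
      have := (((hasDerivAt_id t).const_mul (-b)).exp).div_const b
      refine this.congr_deriv ?_
      simp only [id]
      field_simp
    exact ((h β hβ).sub (h p hp)).congr_deriv (by ring)
  rw [intervalIntegral.integral_eq_sub_of_hasDerivAt (fun t _ => hd t)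
    ((by fun_prop : Continuous fun t => exp (-p * t) - exp (-β * t)).intervalIntegrable _ _)]
  unfold levyIntegrand
  by_cases h : z ∈ Ioi (-1)
  · simp only [indicator_of_mem h]
    field_simp
    simp
    ring
  · simp only [indicator_of_notMem h]
    field_simp
    simp
    ring

lemma exp_sub_exp_nonneg {p β t : ℝ} (hpβ : p ≤ β) (ht : 0 ≤ t) :
    0 ≤ exp (-p * t) - exp (-β * t) := by
  rw [sub_nonneg]
  gcongr

lemma lintegral_negTail_mul (hν : ν (Ici 0) = 0)
    (hνint : ∫⁻ x, ENNReal.ofReal (min 1 (x ^ 2)) ∂ν ≠ ⊤) {p β : ℝ} (hp : 0 < p) (hpβ : p ≤ β) :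
    ∫⁻ t in Ioi 0, ENNReal.ofReal (negTail ν t * (exp (-p * t) - exp (-β * t))) =
      ENNReal.ofReal (∫ z, (levyIntegrand β z / β - levyIntegrand p z / p) ∂ν) := by
  have hβ := hp.trans_le hpβ
  rw [ofReal_integral_eq_lintegral_ofReal]
  · simp_rw [levyIntegrand_div_sub_div hp hβ]
    rw [lintegral_comp_eq_lintegral_meas_lt_mul ν (f := fun z : ℝ => -z)
      (g := fun t => exp (-p * t) - exp (-β * t))]
    · refine setLIntegral_congr_fun measurableSet_Ioi fun t ht => ?_
      have : {a : ℝ | t < -a} = Iio (-t) := by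
        ext a; simp only [mem_ofPred_eq, mem_Iio]; exact lt_neg
      rw [this, ENNReal.ofReal_mul (negTail_nonneg t), ofReal_negTail hνint ht]
    · filter_upwards [ae_neg_of_Ici hν] with z hz
      simpa using hz.le
    · exact measurable_neg.aemeasurable
    · intro t ht
      exact (by fun_prop : Continuous fun t => exp (-p * t) - exp (-β * t)).intervalIntegrable _ _
    · filter_upwards [ae_restrict_mem measurableSet_Ioi] with t ht
      exact exp_sub_exp_nonneg hpβ (le_of_lt ht)
  · exact ((integrable_levyIntegrand hν hνint hβ.le).div_const _).sub
      ((integrable_levyIntegrand hν hνint hp.le).div_const _)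
  · filter_upwards [ae_neg_of_Ici hν] with z hz
    rw [levyIntegrand_div_sub_div hp hβ]
    exact intervalIntegral.integral_nonneg (by linarith)
      fun t ht => exp_sub_exp_nonneg hpβ ht.1

lemma aemeasurable_negTail (hνint : ∫⁻ x, ENNReal.ofReal (min 1 (x ^ 2)) ∂ν ≠ ⊤) :
    AEMeasurable (negTail ν) (volume.restrict (Ioi 0)) :=
  aemeasurable_restrict_of_antitoneOn measurableSet_Ioi (antitoneOn_negTail hνint)

lemma integrableOn_negTail_mul (hν : ν (Ici 0) = 0)
    (hνint : ∫⁻ x, ENNReal.ofReal (min 1 (x ^ 2)) ∂ν ≠ ⊤) {p β : ℝ} (hp : 0 < p) (hpβ : p ≤ β) :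
    IntegrableOn (fun t => negTail ν t * (exp (-p * t) - exp (-β * t))) (Ioi 0) := by
  refine ⟨((aemeasurable_negTail hνint).mul (by fun_prop)).aestronglyMeasurable, ?_⟩
  rw [hasFiniteIntegral_iff_ofReal, lintegral_negTail_mul hν hνint hp hpβ]
  · exact ENNReal.ofReal_lt_top
  · filter_upwards [ae_restrict_mem measurableSet_Ioi] with t ht
    exact mul_nonneg (negTail_nonneg t) (exp_sub_exp_nonneg hpβ (le_of_lt ht))

lemma integral_levyIntegrand_div_sub_div (hν : ν (Ici 0) = 0)
    (hνint : ∫⁻ x, ENNReal.ofReal (min 1 (x ^ 2)) ∂ν ≠ ⊤) {p β : ℝ} (hp : 0 < p) (hpβ : p ≤ β) :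
    (∫ z, levyIntegrand β z ∂ν) / β - (∫ z, levyIntegrand p z ∂ν) / p =
      ∫ t in Ioi 0, negTail ν t * (exp (-p * t) - exp (-β * t)) := by
  have hβ := hp.trans_le hpβ
  have hnn : 0 ≤ ∫ t in Ioi 0, negTail ν t * (exp (-p * t) - exp (-β * t)) :=
    setIntegral_nonneg measurableSet_Ioi fun t ht =>
      mul_nonneg (negTail_nonneg t) (exp_sub_exp_nonneg hpβ (le_of_lt ht))
  have h := lintegral_negTail_mul hν hνint hp hpβ
  rw [← ofReal_integral_eq_lintegral_ofReal (integrableOn_negTail_mul hν hνint hp hpβ)] at h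
  · rw [ENNReal.ofReal_eq_ofReal_iff hnn] at h
    · rw [h, integral_sub ((integrable_levyIntegrand hν hνint hβ.le).div_const _)
        ((integrable_levyIntegrand hν hνint hp.le).div_const _), integral_div, integral_div]
    · refine integral_nonneg_of_ae ?_
      filter_upwards [ae_neg_of_Ici hν] with z hz
      rw [levyIntegrand_div_sub_div hp hβ]
      exact intervalIntegral.integral_nonneg (by linarith)
        fun t ht => exp_sub_exp_nonneg hpβ ht.1
  · filter_upwards [ae_restrict_mem measurableSet_Ioi] with t ht
    exact mul_nonneg (negTail_nonneg t) (exp_sub_exp_nonneg hpβ (le_of_lt ht))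

end

/-- The exponentially tilted tail integral `∫₀^∞ e^{-pu} ν((-∞, -(x+u))) du`. -/
noncomputable def tiltedTail (ν : Measure ℝ) (p x : ℝ) : ℝ :=
  exp (p * x) * ∫ s in Ioi x, exp (-p * s) * negTail ν s

section
variable {ν : Measure ℝ}

lemma integrableOn_exp_mul_negTail (hνint : ∫⁻ x, ENNReal.ofReal (min 1 (x ^ 2)) ∂ν ≠ ⊤)
    {p x : ℝ} (hp : 0 < p) (hx : 0 < x) :
    IntegrableOn (fun s => exp (-p * s) * negTail ν s) (Ioi x) := by
  refine ((exp_neg_integrableOn_Ioi x hp).mul_const (negTail ν x)).mono' ?_ ?_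
  · exact (AEMeasurable.mul (by fun_prop) ((aemeasurable_negTail hνint).mono_set
      (Ioi_subset_Ioi hx.le))).aestronglyMeasurable
  · filter_upwards [ae_restrict_mem measurableSet_Ioi] with s hs
    rw [norm_of_nonneg (mul_nonneg (exp_pos _).le (negTail_nonneg s))]
    have := antitoneOn_negTail hνint hx (hx.trans hs) (le_of_lt hs)
    gcongr

lemma tiltedTail_nonneg (p x : ℝ) : 0 ≤ tiltedTail ν p x :=
  mul_nonneg (exp_pos _).le
    (setIntegral_nonneg measurableSet_Ioi fun s _ => mul_nonneg (exp_pos _).le (negTail_nonneg s))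

lemma aemeasurable_tiltedTail (hνint : ∫⁻ x, ENNReal.ofReal (min 1 (x ^ 2)) ∂ν ≠ ⊤) {p : ℝ}
    (hp : 0 < p) : AEMeasurable (tiltedTail ν p) (volume.restrict (Ioi 0)) := by
  refine AEMeasurable.mul (by fun_prop) ?_
  refine aemeasurable_restrict_of_antitoneOn measurableSet_Ioi fun x hx y _ hxy => ?_
  refine setIntegral_mono_set (integrableOn_exp_mul_negTail hνint hp hx) ?_
    (Ioi_subset_Ioi hxy).eventuallyLE
  exact ae_of_all _ fun s => mul_nonneg (exp_pos _).le (negTail_nonneg s)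

lemma lintegral_exp_mul_tiltedTail (hνint : ∫⁻ x, ENNReal.ofReal (min 1 (x ^ 2)) ∂ν ≠ ⊤)
    {p β : ℝ} (hp : 0 < p) (hpβ : p < β) :
    ∫⁻ x in Ioi 0, ENNReal.ofReal (exp (-β * x) * tiltedTail ν p x) =
      ∫⁻ t in Ioi 0, ENNReal.ofReal
        (negTail ν t * (exp (-p * t) - exp (-β * t)) / (β - p)) := by
  have hβp : 0 < β - p := sub_pos.2 hpβ
  have hdm : AEMeasurable (fun s => ENNReal.ofReal (exp (-p * s) * negTail ν s))
      (volume.restrict (Ioi 0)) :=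
    (AEMeasurable.mul (by fun_prop) (aemeasurable_negTail hνint)).ennreal_ofReal
  set m : Measure ℝ := (volume.restrict (Ioi 0)).withDensity
    fun s => ENNReal.ofReal (exp (-p * s) * negTail ν s) with hm
  have hmae : ∀ᵐ s ∂m, 0 ≤ s := by
    refine (withDensity_absolutelyContinuous _ _).ae_le ?_
    filter_upwards [ae_restrict_mem measurableSet_Ioi] with s hs using le_of_lt hs
  have key := lintegral_comp_eq_lintegral_meas_lt_mul m (f := fun s : ℝ => s)
    (g := fun x => exp (-(β - p) * x)) hmae measurable_id.aemeasurable
    (fun t _ => (by fun_prop : Continuous fun x => exp (-(β - p) * x)).intervalIntegrable _ _)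
    (ae_of_all _ fun x => (exp_pos _).le)
  have hR : ∫⁻ x in Ioi 0, ENNReal.ofReal (exp (-β * x) * tiltedTail ν p x) =
      ∫⁻ t in Ioi 0, m {a | t < a} * ENNReal.ofReal (exp (-(β - p) * t)) := by
    refine setLIntegral_congr_fun measurableSet_Ioi fun x hx => ?_
    have h1 : m {a | x < a} = ENNReal.ofReal (∫ s in Ioi x, exp (-p * s) * negTail ν s) := by
      change m (Ioi x) = _
      rw [hm, withDensity_apply _ measurableSet_Ioi, Measure.restrict_restrict measurableSet_Ioi,
        inter_eq_left.2 (Ioi_subset_Ioi (le_of_lt hx)),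
        ofReal_integral_eq_lintegral_ofReal (integrableOn_exp_mul_negTail hνint hp hx)]
      exact ae_of_all _ fun s => mul_nonneg (exp_pos _).le (negTail_nonneg s)
    rw [h1, ← ENNReal.ofReal_mul
      (setIntegral_nonneg measurableSet_Ioi fun s _ =>
        mul_nonneg (exp_pos _).le (negTail_nonneg s)), tiltedTail, ← mul_assoc, ← exp_add,
      mul_comm]
    ring_nf
  rw [hR, ← key, hm, lintegral_withDensity_eq_lintegral_mul_non_measurable₀ _ hdm
    (ae_of_all _ fun x => ENNReal.ofReal_lt_top)]
  refine setLIntegral_congr_fun measurableSet_Ioi fun t ht => ?_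
  have hint : ∫ x in (0 : ℝ)..t, exp (-(β - p) * x) = (1 - exp (-(β - p) * t)) / (β - p) := by
    rw [intervalIntegral.integral_comp_mul_left (fun x => exp x) (by linarith : -(β - p) ≠ 0),
      integral_exp]
    simp only [mul_zero, exp_zero, smul_eq_mul]
    field_simp
    ring
  simp only [Pi.mul_apply]
  rw [hint, ← ENNReal.ofReal_mul (mul_nonneg (exp_pos _).le (negTail_nonneg t))]
  congr 1
  have : exp (-β * t) = exp (-p * t) * exp (-(β - p) * t) := by rw [← exp_add]; ring_nf
  rw [this]
  ring

lemma integrableOn_exp_mul_tiltedTail (hν : ν (Ici 0) = 0)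
    (hνint : ∫⁻ x, ENNReal.ofReal (min 1 (x ^ 2)) ∂ν ≠ ⊤) {p β : ℝ} (hp : 0 < p) (hpβ : p < β) :
    IntegrableOn (fun x => exp (-β * x) * tiltedTail ν p x) (Ioi 0) := by
  refine ⟨(AEMeasurable.mul (by fun_prop) (aemeasurable_tiltedTail hνint hp)).aestronglyMeasurable,
    ?_⟩
  rw [hasFiniteIntegral_iff_ofReal (ae_of_all _ fun x =>
    mul_nonneg (exp_pos _).le (tiltedTail_nonneg p x)), lintegral_exp_mul_tiltedTail hνint hp hpβ]
  exact ((integrableOn_negTail_mul hν hνint hp hpβ.le).div_const _).lintegral_lt_top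

lemma integral_exp_mul_tiltedTail (hν : ν (Ici 0) = 0)
    (hνint : ∫⁻ x, ENNReal.ofReal (min 1 (x ^ 2)) ∂ν ≠ ⊤) {p β : ℝ} (hp : 0 < p) (hpβ : p < β) :
    ∫ x in Ioi 0, exp (-β * x) * tiltedTail ν p x =
      ((∫ z, levyIntegrand β z ∂ν) / β - (∫ z, levyIntegrand p z ∂ν) / p) / (β - p) := by
  rw [integral_levyIntegrand_div_sub_div hν hνint hp hpβ.le, ← integral_div,
    integral_eq_lintegral_of_nonneg_ae
      (ae_of_all _ fun x => mul_nonneg (exp_pos _).le (tiltedTail_nonneg p x))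
      (integrableOn_exp_mul_tiltedTail hν hνint hp hpβ).aestronglyMeasurable,
    lintegral_exp_mul_tiltedTail hνint hp hpβ, integral_eq_lintegral_of_nonneg_ae]
  · filter_upwards [ae_restrict_mem measurableSet_Ioi] with t ht
    exact div_nonneg (mul_nonneg (negTail_nonneg t) (exp_sub_exp_nonneg hpβ.le (le_of_lt ht)))
      (sub_pos.2 hpβ).le
  · exact ((integrableOn_negTail_mul hν hνint hp hpβ.le).div_const _).aestronglyMeasurable

lemma tiltedTail_eq (p x : ℝ) :
    tiltedTail ν p x = ∫ u in Ioi 0, exp (-p * u) * negTail ν (x + u) := by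
  have h := (measurePreserving_add_left volume x).setIntegral_preimage_emb
    (measurableEmbedding_addLeft x) (fun s => exp (-p * s) * negTail ν s) (Ioi x)
  rw [preimage_const_add_Ioi, sub_self] at h
  rw [tiltedTail, ← h, ← integral_const_mul]
  congr 1 with u
  rw [← mul_assoc, ← exp_add]
  ring_nf

lemma integrableOn_exp_mul_negTail_add (hνint : ∫⁻ x, ENNReal.ofReal (min 1 (x ^ 2)) ∂ν ≠ ⊤)
    {p x : ℝ} (hp : 0 < p) (hx : 0 < x) :
    IntegrableOn (fun u => exp (-p * u) * negTail ν (x + u)) (Ioi 0) := by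
  refine ((exp_neg_integrableOn_Ioi 0 hp).mul_const (negTail ν x)).mono' ?_ ?_
  · refine AEMeasurable.aestronglyMeasurable (AEMeasurable.mul (by fun_prop) ?_)
    refine aemeasurable_restrict_of_antitoneOn measurableSet_Ioi fun u hu v hv huv => ?_
    exact antitoneOn_negTail hνint (add_pos hx hu) (add_pos hx hv) (by linarith)
  · filter_upwards [ae_restrict_mem measurableSet_Ioi] with s hs
    have hs' : 0 < s := hs
    rw [norm_of_nonneg (mul_nonneg (exp_pos _).le (negTail_nonneg _))]
    have := antitoneOn_negTail hνint hx (add_pos hx hs') (by linarith)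
    gcongr

lemma mul_tiltedTail_add_le (hνint : ∫⁻ x, ENNReal.ofReal (min 1 (x ^ 2)) ∂ν ≠ ⊤) {p r x y : ℝ}
    (hp : 0 < p) (hy : 0 < y) (hyx : y ≤ x)
    (hprod : ∀ u, 0 ≤ u → (negTail ν x + r) * (negTail ν (y + u) + r) ≤
      (negTail ν (x + u) + r) * (negTail ν y + r)) :
    (negTail ν x + r) * (p * tiltedTail ν p y + r) ≤
      (p * tiltedTail ν p x + r) * (negTail ν y + r) := by
  have hrep : ∀ z, 0 < z → p * tiltedTail ν p z + r =
      ∫ u in Ioi 0, p * (exp (-p * u) * (negTail ν (z + u) + r)) := by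
    intro z hz
    simp_rw [mul_add]
    rw [integral_add ((integrableOn_exp_mul_negTail_add hνint hp hz).const_mul p)
      (((exp_neg_integrableOn_Ioi 0 hp).mul_const r).const_mul p), integral_const_mul,
      integral_const_mul, integral_mul_const, ← tiltedTail_eq,
      integral_exp_mul_Ioi (by linarith : -p < 0)]
    simp
    field_simp
  have hi : ∀ z, 0 < z →
      IntegrableOn (fun u => p * (exp (-p * u) * (negTail ν (z + u) + r))) (Ioi 0) := by
    intro z hz
    simp_rw [mul_add]
    exact ((integrableOn_exp_mul_negTail_add hνint hp hz).const_mul p).add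
      (((exp_neg_integrableOn_Ioi 0 hp).mul_const r).const_mul p)
  rw [hrep y hy, hrep x (hy.trans_le hyx), ← integral_const_mul, ← integral_mul_const]
  refine setIntegral_mono_on ((hi y hy).const_mul _) ((hi x (hy.trans_le hyx)).mul_const _)
    measurableSet_Ioi fun u hu => ?_
  have := mul_le_mul_of_nonneg_left (hprod u (le_of_lt hu)) (mul_nonneg hp.le (exp_pos (-p * u)).le)
  linarith

end

lemma exists_forall_abs_le_exp {g : ℝ → ℝ} {K L s : ℝ} (hs : 0 ≤ s) (hg : ContinuousOn g (Ioi 0))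
    (h0 : Tendsto g (𝓝[>] 0) (𝓝 L)) (hinf : ∀ᶠ x in atTop, |g x| ≤ K * exp (s * x)) :
    ∃ C, ∀ x, 0 < x → |g x| ≤ C * exp (s * x) := by
  obtain ⟨N, hN⟩ := eventually_atTop.1 hinf
  have h1 : ∀ᶠ x in 𝓝[>] (0 : ℝ), |g x| < |L| + 1 :=
    h0.abs.eventually (Iio_mem_nhds (lt_add_one _))
  obtain ⟨d, hd, hd'⟩ := mem_nhdsGT_iff_exists_Ioo_subset.1 h1
  obtain ⟨B, hB⟩ := (isCompact_Icc (a := d) (b := N)).exists_bound_of_continuousOn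
    (hg.mono fun x hx => lt_of_lt_of_le hd hx.1)
  refine ⟨|K| + |L| + 1 + |B|, fun x hx => ?_⟩
  have he : 1 ≤ exp (s * x) := one_le_exp (mul_nonneg hs hx.le)
  have hle : ∀ b, |g x| ≤ b → b ≤ |K| + |L| + 1 + |B| →
      |g x| ≤ (|K| + |L| + 1 + |B|) * exp (s * x) := fun b h2 h3 =>
    (h2.trans h3).trans (le_mul_of_one_le_right (by positivity) he)
  rcases lt_or_ge x d with h | h
  · exact hle _ (le_of_lt (hd' ⟨hx, h⟩)) (by linarith [abs_nonneg K, abs_nonneg B])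
  · rcases le_or_gt x N with h' | h'
    · exact hle _ (hB x ⟨h, h'⟩) (by linarith [abs_nonneg K, abs_nonneg L, le_abs_self B])
    · refine (hN x h'.le).trans ?_
      gcongr
      linarith [le_abs_self K, abs_nonneg B, abs_nonneg L]

section
variable {W w : ℝ → ℝ} {s c w0 : ℝ}

lemma deriv_nonneg_of_monotoneOn_Ici (hmono : MonotoneOn W (Ici 0))
    (hd : ∀ x, 0 < x → HasDerivAt W (w x) x) {x : ℝ} (hx : 0 < x) : 0 ≤ w x := by
  have h := (hd x hx).hasDerivWithinAt (s := Ici x)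
  rw [hasDerivWithinAt_iff_tendsto_slope] at h
  have : (𝓝[Ici x \ {x}] x).NeBot := by rw [Ici_sdiff_left]; infer_instance
  refine ge_of_tendsto h ?_
  filter_upwards [self_mem_nhdsWithin] with y hy
  have hxy : x ≤ y := hy.1
  rw [slope_def_field]
  exact div_nonneg (sub_nonneg.2 (hmono hx.le (hx.le.trans hxy) hxy)) (sub_nonneg.2 hxy)

lemma exists_exp_bounds (hs : 0 ≤ s) (hc : 0 < c) (hW0 : ∀ x, 0 ≤ W x)
    (hcont : ContinuousOn W (Ici 0)) (hmono : MonotoneOn W (Ici 0))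
    (hd : ∀ x, 0 < x → HasDerivAt W (w x) x) (hw : ContinuousOn w (Ioi 0))
    (hlim1 : Tendsto (fun x => exp (-s * x) * W x) atTop (𝓝 (1 / c)))
    (hlim2 : Tendsto (fun x => w x / W x) atTop (𝓝 s))
    (hw0 : Tendsto w (𝓝[>] 0) (𝓝 w0)) :
    ∃ C, (∀ x, 0 < x → |W x| ≤ C * exp (s * x)) ∧ ∀ x, 0 < x → |w x| ≤ C * exp (s * x) := by
  have hz : Tendsto W (𝓝[>] 0) (𝓝 (W 0)) :=
    (hcont 0 self_mem_Ici).mono Ioi_subset_Ici_self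
  have hWinf : ∀ᶠ x in atTop, |W x| ≤ (1 / c + 1) * exp (s * x) := by
    filter_upwards [hlim1.eventually (Iio_mem_nhds (lt_add_one _))] with x hx
    rw [abs_of_nonneg (hW0 x)]
    have : W x = exp (-s * x) * W x * exp (s * x) := by
      rw [mul_right_comm, ← exp_add]; simp
    rw [this]
    have := le_of_lt hx
    gcongr
  obtain ⟨C₁, hC₁⟩ := exists_forall_abs_le_exp hs (hcont.mono Ioi_subset_Ici_self) hz hWinf
  have hwinf : ∀ᶠ x in atTop, |w x| ≤ ((s + 1) * (1 / c + 1)) * exp (s * x) := by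
    filter_upwards [hWinf, hlim2.eventually (Iio_mem_nhds (lt_add_one s)),
      hlim1.eventually (Ioi_mem_nhds (one_div_pos.2 hc)), eventually_gt_atTop 0] with x h1 h2 h3 h4
    have hWx : 0 < W x := pos_of_mul_pos_right h3 (exp_pos _).le
    rw [abs_of_nonneg (deriv_nonneg_of_monotoneOn_Ici hmono hd h4), mul_assoc]
    rw [abs_of_nonneg (hW0 x)] at h1
    have h2' : w x ≤ (s + 1) * W x := ((div_lt_iff₀ hWx).1 h2).le
    exact h2'.trans (mul_le_mul_of_nonneg_left h1 (by linarith))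
  obtain ⟨C₂, hC₂⟩ := exists_forall_abs_le_exp hs hw hw0 hwinf
  refine ⟨max C₁ C₂, fun x hx => (hC₁ x hx).trans ?_, fun x hx => (hC₂ x hx).trans ?_⟩
  · gcongr; exact le_max_left _ _
  · gcongr; exact le_max_right _ _

end

section
variable {W J : ℝ → ℝ} {C s p : ℝ}

lemma shifted_laplace_eq (hcont : ContinuousOn W (Ici 0))
    (hb : ∀ x, 0 < x → |W x| ≤ C * exp (s * x)) (hsp : s < p)
    (hJ : ∀ x, J x = ∫ u in Ioi 0, exp (-p * u) * W (u + x)) {x : ℝ} (hx : 0 ≤ x) :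
    J x = exp (p * x) * (J 0 - ∫ v in (0 : ℝ)..x, exp (-p * v) * W v) := by
  have hi := integrableOn_exp_mul_of_bound (hcont.mono Ioi_subset_Ici_self) hb hsp
  have h := (measurePreserving_add_right volume x).setIntegral_preimage_emb
    (measurableEmbedding_addRight x) (fun v => exp (-p * v) * W v) (Ioi x)
  rw [preimage_add_const_Ioi, sub_self] at h
  rw [hJ, hJ]
  simp only [add_zero]
  rw [← intervalIntegral.integral_Ioi_sub_Ioi hi hx, sub_sub_cancel, ← h, ← integral_const_mul]
  congr 1 with u
  rw [← mul_assoc, ← exp_add]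
  ring_nf

lemma hasDerivAt_shifted_laplace (hcont : ContinuousOn W (Ici 0))
    (hb : ∀ x, 0 < x → |W x| ≤ C * exp (s * x)) (hsp : s < p)
    (hJ : ∀ x, J x = ∫ u in Ioi 0, exp (-p * u) * W (u + x)) {x : ℝ} (hx : 0 < x) :
    HasDerivAt J (p * J x - W x) x := by
  have hco : ContinuousOn (fun v => exp (-p * v) * W v) (Ici 0) :=
    ContinuousOn.mul (by fun_prop) hcont
  have hd : HasDerivAt (fun x => ∫ v in (0 : ℝ)..x, exp (-p * v) * W v) (exp (-p * x) * W x) x := by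
    refine intervalIntegral.integral_hasDerivAt_right ?_ ?_
      (hco.continuousAt (Ici_mem_nhds hx))
    · refine (hco.mono fun v hv => ?_).intervalIntegrable
      rw [uIcc_of_le hx.le] at hv
      exact hv.1
    · exact (hco.mono Ioi_subset_Ici_self).stronglyMeasurableAtFilter isOpen_Ioi x hx
  have he : HasDerivAt (fun x => exp (p * x)) (exp (p * x) * p) x := by
    simpa using ((hasDerivAt_id x).const_mul p).exp
  have h := he.mul (hd.const_sub (J 0))
  refine (h.congr_of_eventuallyEq ?_).congr_deriv ?_
  · filter_upwards [Ioi_mem_nhds hx] with z hz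
    exact shifted_laplace_eq hcont hb hsp hJ (le_of_lt hz)
  · rw [shifted_laplace_eq hcont hb hsp hJ hx.le]
    have : exp (p * x) * exp (-p * x) = 1 := by rw [← exp_add]; simp
    linear_combination -(W x) * this

lemma tendsto_shifted_laplace (hcont : ContinuousOn W (Ici 0))
    (hb : ∀ x, 0 < x → |W x| ≤ C * exp (s * x)) (hsp : s < p)
    (hJ : ∀ x, J x = ∫ u in Ioi 0, exp (-p * u) * W (u + x)) :
    Tendsto J (𝓝[>] 0) (𝓝 (J 0)) := by
  have hco : ContinuousOn (fun v => exp (-p * v) * W v) (Ici 0) :=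
    ContinuousOn.mul (by fun_prop) hcont
  have h1 : ContinuousOn (fun x => ∫ v in (0 : ℝ)..x, exp (-p * v) * W v) (Icc 0 1) :=
    intervalIntegral.continuousOn_primitive_interval
      ((hco.mono Icc_subset_Ici_self).integrableOn_Icc.mono_set (by rw [uIcc_of_le zero_le_one]))
      |>.mono (by rw [uIcc_of_le zero_le_one])
  have h2 : Tendsto (fun x => ∫ v in (0 : ℝ)..x, exp (-p * v) * W v) (𝓝[>] 0) (𝓝 0) := by
    have := h1 0 (left_mem_Icc.2 zero_le_one)
    rw [ContinuousWithinAt, intervalIntegral.integral_same] at this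
    refine this.mono_left ?_
    rw [nhdsWithin_Icc_eq_nhdsGE zero_lt_one]
    exact nhdsWithin_mono _ Ioi_subset_Ici_self
  have h3 : Tendsto (fun x : ℝ => exp (p * x)) (𝓝[>] 0) (𝓝 1) := by
    have : Continuous fun x : ℝ => exp (p * x) := by fun_prop
    have := (this.tendsto 0).mono_left (nhdsWithin_le_nhds (s := Ioi 0))
    simpa using this
  have h4 := h3.mul (h2.const_sub (J 0))
  rw [sub_zero, one_mul] at h4
  refine h4.congr' ?_
  filter_upwards [self_mem_nhdsWithin] with x hx
  exact (shifted_laplace_eq hcont hb hsp hJ (le_of_lt hx)).symm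

lemma abs_shifted_laplace_le (hb : ∀ x, 0 < x → |W x| ≤ C * exp (s * x)) (hsp : s < p)
    (hJ : ∀ x, J x = ∫ u in Ioi 0, exp (-p * u) * W (u + x)) {x : ℝ} (hx : 0 < x) :
    |J x| ≤ C / (p - s) * exp (s * x) := by
  have hi : IntegrableOn (fun u => C * exp (s * x) * exp (-(p - s) * u)) (Ioi 0) :=
    (exp_neg_integrableOn_Ioi 0 (sub_pos.2 hsp)).const_mul _
  rw [hJ, ← norm_eq_abs]
  refine (norm_integral_le_of_norm_le hi ?_).trans_eq ?_
  · filter_upwards [ae_restrict_mem measurableSet_Ioi] with u hu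
    rw [norm_mul, norm_of_nonneg (exp_pos _).le, norm_eq_abs]
    refine (mul_le_mul_of_nonneg_left (hb _ (add_pos hu hx)) (exp_pos _).le).trans_eq ?_
    rw [mul_left_comm, ← exp_add, mul_assoc, ← exp_add]
    ring_nf
  · rw [integral_const_mul, integral_exp_mul_Ioi (by linarith : -(p - s) < 0)]
    have : p - s ≠ 0 := (sub_pos.2 hsp).ne'
    have h2 : -(p - s) ≠ 0 := neg_ne_zero.2 this
    simp only [mul_zero, exp_zero]
    field_simp

end

section

variable {ν : Measure ℝ}

lemma integral_exp_sub_exp {β γ x : ℝ} (hβ : 0 < β) (hγ : 0 < γ) :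
    ∫ t in (0 : ℝ)..x, (exp (-β * t) - exp (-γ * t)) =
      (1 - exp (-β * x)) / β - (1 - exp (-γ * x)) / γ := by
  have h : ∀ a : ℝ, 0 < a → ∫ t in (0 : ℝ)..x, exp (-a * t) = (1 - exp (-a * x)) / a := by
    intro a ha
    rw [intervalIntegral.integral_comp_mul_left _ (neg_ne_zero.2 ha.ne'), integral_exp]
    simp only [mul_zero, exp_zero, smul_eq_mul]
    field_simp
    ring
  rw [intervalIntegral.integral_sub (by apply Continuous.intervalIntegrable; fun_prop)
    (by apply Continuous.intervalIntegrable; fun_prop), h β hβ, h γ hγ]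

lemma negTail_mul_le (hν : ν (Ici 0) = 0)
    (hνint : ∫⁻ x, ENNReal.ofReal (min 1 (x ^ 2)) ∂ν ≠ ⊤) {β γ x : ℝ} (hβ : 0 < β) (hβγ : β ≤ γ)
    (hx : 0 < x) :
    negTail ν x * ((1 - exp (-β * x)) / β - (1 - exp (-γ * x)) / γ) ≤
      (∫ z, levyIntegrand γ z ∂ν) / γ - (∫ z, levyIntegrand β z ∂ν) / β := by
  rw [integral_levyIntegrand_div_sub_div hν hνint hβ hβγ,
    ← integral_exp_sub_exp hβ (hβ.trans_le hβγ), ← intervalIntegral.integral_const_mul,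
    intervalIntegral.integral_of_le hx.le]
  have hi := integrableOn_negTail_mul hν hνint hβ hβγ
  refine le_trans (setIntegral_mono_on ?_ (hi.mono_set Ioc_subset_Ioi_self) measurableSet_Ioc
    fun t ht => ?_) (setIntegral_mono_set hi ?_ Ioc_subset_Ioi_self.eventuallyLE)
  · exact (Continuous.integrableOn_Icc (by fun_prop)).mono_set Ioc_subset_Icc_self
  · exact mul_le_mul_of_nonneg_right (antitoneOn_negTail hνint ht.1 hx ht.2)
      (exp_sub_exp_nonneg hβγ ht.1.le)
  · filter_upwards [ae_restrict_mem measurableSet_Ioi] with t ht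
    exact mul_nonneg (negTail_nonneg t) (exp_sub_exp_nonneg hβγ (le_of_lt ht))

/-- The tail of a Lévy measure is bounded by the rate at which the exponent approaches its
asymptotic slope. -/
lemma negTail_le_of_tendsto (hν : ν (Ici 0) = 0)
    (hνint : ∫⁻ x, ENNReal.ofReal (min 1 (x ^ 2)) ∂ν ≠ ⊤) {l k : ℝ}
    (hl : Tendsto (fun β => (∫ z, levyIntegrand β z ∂ν) / β) atTop (𝓝 l))
    (hk : Tendsto (fun β => β * (l - (∫ z, levyIntegrand β z ∂ν) / β)) atTop (𝓝 k))
    {x : ℝ} (hx : 0 < x) : negTail ν x ≤ k := by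
  have hexp : Tendsto (fun γ : ℝ => exp (-γ * x)) atTop (𝓝 0) := by
    refine tendsto_exp_atBot.comp ?_
    exact (tendsto_neg_atTop_atBot).atBot_mul_const hx
  have h1 : ∀ β, 0 < β → negTail ν x * (1 - exp (-β * x)) ≤
      β * (l - (∫ z, levyIntegrand β z ∂ν) / β) := by
    intro β hβ
    have hlim : Tendsto (fun γ : ℝ => negTail ν x * ((1 - exp (-β * x)) / β -
        (1 - exp (-γ * x)) / γ)) atTop (𝓝 (negTail ν x * ((1 - exp (-β * x)) / β - 0))) :=
      ((hexp.const_sub 1).div_atTop tendsto_id).const_sub _ |>.const_mul _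
    have := le_of_tendsto_of_tendsto hlim (hl.sub_const ((∫ z, levyIntegrand β z ∂ν) / β)) (by
      filter_upwards [eventually_ge_atTop β] with γ hγ
      exact negTail_mul_le hν hνint hβ hγ hx)
    rw [sub_zero, ← mul_div_assoc, div_le_iff₀ hβ] at this
    linarith
  have h2 : Tendsto (fun β : ℝ => negTail ν x * (1 - exp (-β * x))) atTop
      (𝓝 (negTail ν x * (1 - 0))) := (hexp.const_sub 1).const_mul _
  rw [sub_zero, mul_one] at h2
  refine le_of_tendsto_of_tendsto h2 hk ?_
  filter_upwards [eventually_gt_atTop 0] with β hβ using h1 β hβ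

lemma integrableOn_exp_mul_negTail_of_le
    (hνint : ∫⁻ x, ENNReal.ofReal (min 1 (x ^ 2)) ∂ν ≠ ⊤) {k : ℝ}
    (hk : ∀ x, 0 < x → negTail ν x ≤ k) {β : ℝ} (hβ : 0 < β) :
    IntegrableOn (fun t => exp (-β * t) * negTail ν t) (Ioi 0) := by
  refine Integrable.mono' ((exp_neg_integrableOn_Ioi 0 hβ).const_mul k)
    ((by fun_prop : AEStronglyMeasurable (fun t => exp (-β * t)) _).mul
      (aemeasurable_negTail hνint).aestronglyMeasurable) ?_
  filter_upwards [ae_restrict_mem measurableSet_Ioi] with t ht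
  rw [norm_mul, norm_of_nonneg (exp_pos _).le, norm_of_nonneg (negTail_nonneg t), mul_comm]
  exact mul_le_mul_of_nonneg_right (hk t ht) (exp_pos _).le

/-- For a finite Lévy measure, the exponent is expressed through the Laplace transform of the
tail. -/
lemma sub_integral_levyIntegrand_div (hν : ν (Ici 0) = 0)
    (hνint : ∫⁻ x, ENNReal.ofReal (min 1 (x ^ 2)) ∂ν ≠ ⊤) {l k : ℝ}
    (hl : Tendsto (fun β => (∫ z, levyIntegrand β z ∂ν) / β) atTop (𝓝 l))
    (hk : ∀ x, 0 < x → negTail ν x ≤ k) {β : ℝ} (hβ : 0 < β) :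
    l - (∫ z, levyIntegrand β z ∂ν) / β = ∫ t in Ioi 0, exp (-β * t) * negTail ν t := by
  have hz : Tendsto (fun γ => ∫ t in Ioi 0, exp (-γ * t) * negTail ν t) atTop (𝓝 0) := by
    have h0 : Tendsto (fun γ : ℝ => k / γ) atTop (𝓝 0) := tendsto_const_nhds.div_atTop tendsto_id
    refine squeeze_zero' ?_ ?_ h0
    · exact Eventually.of_forall fun γ => setIntegral_nonneg measurableSet_Ioi fun t _ =>
        mul_nonneg (exp_pos _).le (negTail_nonneg t)
    · filter_upwards [eventually_gt_atTop 0] with γ hγ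
      have : k / γ = ∫ t in Ioi (0 : ℝ), exp (-γ * t) * k := by
        rw [integral_mul_const, integral_exp_mul_Ioi (by linarith)]
        simp
        ring
      rw [this]
      refine setIntegral_mono_on (integrableOn_exp_mul_negTail_of_le hνint hk hγ)
        ((exp_neg_integrableOn_Ioi 0 hγ).mul_const k) measurableSet_Ioi fun t ht => ?_
      exact mul_le_mul_of_nonneg_left (hk t ht) (exp_pos _).le
  have h1 : Tendsto (fun γ => (∫ t in Ioi 0, exp (-β * t) * negTail ν t) -
      ∫ t in Ioi 0, exp (-γ * t) * negTail ν t) atTop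
      (𝓝 ((∫ t in Ioi 0, exp (-β * t) * negTail ν t) - 0)) := hz.const_sub _
  rw [sub_zero] at h1
  refine tendsto_nhds_unique (hl.sub_const _) (h1.congr' ?_)
  filter_upwards [eventually_ge_atTop β] with γ hγ
  rw [integral_levyIntegrand_div_sub_div hν hνint hβ hγ,
    ← integral_sub (integrableOn_exp_mul_negTail_of_le hνint hk hβ)
    (integrableOn_exp_mul_negTail_of_le hνint hk (hβ.trans_le hγ))]
  congr 1 with t
  ring

lemma sub_le_tiltedTail (hνint : ∫⁻ x, ENNReal.ofReal (min 1 (x ^ 2)) ∂ν ≠ ⊤) {k : ℝ}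
    (hk : ∀ x, 0 < x → negTail ν x ≤ k) {p y : ℝ} (hp : 0 < p) (hy : 0 < y) :
    (∫ t in Ioi 0, exp (-p * t) * negTail ν t) - k * y ≤ tiltedTail ν p y := by
  have hi := integrableOn_exp_mul_negTail_of_le hνint hk hp
  have hsplit : ∫ t in Ioi 0, exp (-p * t) * negTail ν t =
      (∫ t in Ioc 0 y, exp (-p * t) * negTail ν t) + ∫ t in Ioi y, exp (-p * t) * negTail ν t := by
    rw [← setIntegral_union (Ioc_disjoint_Ioi le_rfl) measurableSet_Ioi
      (hi.mono_set Ioc_subset_Ioi_self) (hi.mono_set (Ioi_subset_Ioi hy.le)),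
      Ioc_union_Ioi_eq_Ioi hy.le]
  have h1 : ∫ t in Ioc 0 y, exp (-p * t) * negTail ν t ≤ k * y := by
    calc ∫ t in Ioc 0 y, exp (-p * t) * negTail ν t ≤ ∫ t in Ioc 0 y, k := by
          refine setIntegral_mono_on (hi.mono_set Ioc_subset_Ioi_self) (by simp)
            measurableSet_Ioc fun t ht => ?_
          calc exp (-p * t) * negTail ν t ≤ 1 * negTail ν t :=
                mul_le_mul_of_nonneg_right (exp_le_one_iff.2 (by nlinarith [ht.1]))
                  (negTail_nonneg t)
            _ ≤ k := by rw [one_mul]; exact hk t ht.1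
      _ = k * y := by simp [hy.le, mul_comm]
  have h2 : ∫ t in Ioi y, exp (-p * t) * negTail ν t ≤ tiltedTail ν p y := by
    unfold tiltedTail
    refine le_mul_of_one_le_left (setIntegral_nonneg measurableSet_Ioi fun t _ =>
      mul_nonneg (exp_pos _).le (negTail_nonneg t)) (one_le_exp (by positivity))
  linarith

lemma negTail_add_mul_le (hνint : ∫⁻ x, ENNReal.ofReal (min 1 (x ^ 2)) ∂ν ≠ ⊤) {p r k x : ℝ}
    (hp : 0 < p) (hr : 0 < r) (hk : ∀ x, 0 < x → negTail ν x ≤ k) (hx : 0 < x)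
    (hprod : ∀ y u, 0 < y → y ≤ x → 0 ≤ u →
      (negTail ν x + r) * (negTail ν (y + u) + r) ≤
        (negTail ν (x + u) + r) * (negTail ν y + r)) :
    (negTail ν x + r) * (p * (∫ t in Ioi 0, exp (-p * t) * negTail ν t) + r) ≤
      (p * tiltedTail ν p x + r) * (k + r) := by
  set A := ∫ t in Ioi 0, exp (-p * t) * negTail ν t
  have hlim : Tendsto (fun y : ℝ => (negTail ν x + r) * (p * (A - k * y) + r)) (𝓝[>] 0)
      (𝓝 ((negTail ν x + r) * (p * (A - k * 0) + r))) :=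
    (Continuous.tendsto (by fun_prop) 0).mono_left nhdsWithin_le_nhds
  rw [mul_zero, sub_zero] at hlim
  refine le_of_tendsto hlim ?_
  filter_upwards [Ioc_mem_nhdsGT hx] with y hy
  have hT := negTail_nonneg (ν := ν) x
  have ht := tiltedTail_nonneg (ν := ν) p x
  calc (negTail ν x + r) * (p * (A - k * y) + r)
      ≤ (negTail ν x + r) * (p * tiltedTail ν p y + r) := by
        gcongr
        exact sub_le_tiltedTail hνint hk hp hy.1
    _ ≤ (p * tiltedTail ν p x + r) * (negTail ν y + r) :=
        mul_tiltedTail_add_le hνint hp hy.1 hy.2 fun u hu => hprod y u hy.1 hy.2 hu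
    _ ≤ (p * tiltedTail ν p x + r) * (k + r) := by
        gcongr
        exact hk y hy.1

end

lemma densityMeasure_eq (k : ℝ → ℝ) :
    densityMeasure k = volume.withDensity ((Ioi 0).indicator fun x => ENNReal.ofReal (k x)) := by
  rw [densityMeasure, withDensity_indicator measurableSet_Ioi]

/-- The convolution of `f` and `w` on the half-line. -/
noncomputable def halfLineConvolution (f w : ℝ → ℝ) (x : ℝ) : ℝ :=
  ∫ y in Ioi 0, f y * (Ioi 0).indicator w (x - y)

lemma norm_mul_indicator_le {f w : ℝ → ℝ} {B C s b x y : ℝ} (hs : 0 ≤ s)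
    (hf : ∀ y, 0 < y → |f y| ≤ B) (hw : ∀ x, 0 < x → |w x| ≤ C * exp (s * x)) (hx : x ≤ b)
    (hy : 0 < y) :
    ‖f y * (Ioi 0).indicator w (x - y)‖ ≤
      (Ioc 0 b).indicator (fun _ => B * (C * exp (s * b))) y := by
  have hC : 0 ≤ C := by
    have := (abs_nonneg _).trans (hw 1 one_pos)
    exact nonneg_of_mul_nonneg_left this (exp_pos _)
  by_cases h : 0 < x - y
  · rw [indicator_of_mem (show x - y ∈ Ioi 0 from h),
      indicator_of_mem (show y ∈ Ioc 0 b from ⟨hy, by linarith⟩),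
      norm_mul]
    refine mul_le_mul (hf y hy) ((hw _ h).trans ?_) (norm_nonneg _) ((abs_nonneg _).trans (hf y hy))
    gcongr
    linarith
  · rw [indicator_of_notMem (show x - y ∉ Ioi 0 from h), mul_zero, norm_zero]
    refine indicator_nonneg (fun _ _ => ?_) y
    have := (abs_nonneg _).trans (hf y hy)
    positivity

lemma measurable_indicator_Ioi {w : ℝ → ℝ} (hw : ContinuousOn w (Ioi 0)) :
    Measurable ((Ioi 0).indicator w) := by
  classical
  rw [← piecewise_eq_indicator]
  exact hw.measurable_piecewise continuousOn_const measurableSet_Ioi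

lemma continuousOn_halfLineConvolution {f w : ℝ → ℝ} {B C s : ℝ} (hs : 0 ≤ s)
    (hfm : AEMeasurable f (volume.restrict (Ioi 0)))
    (hf : ∀ y, 0 < y → |f y| ≤ B) (hwc : ContinuousOn w (Ioi 0))
    (hw : ∀ x, 0 < x → |w x| ≤ C * exp (s * x)) :
    ContinuousOn (halfLineConvolution f w) (Ioi 0) := by
  intro x hx
  refine ContinuousAt.continuousWithinAt ?_
  refine continuousAt_of_dominated
    (bound := (Ioc 0 (x + 1)).indicator fun _ => B * (C * exp (s * (x + 1)))) ?_ ?_ ?_ ?_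
  · refine Eventually.of_forall fun z => (hfm.mul ?_).aestronglyMeasurable
    exact ((measurable_indicator_Ioi hwc).comp (measurable_const.sub measurable_id)).aemeasurable
  · filter_upwards [Iio_mem_nhds (lt_add_one x)] with z hz
    filter_upwards [ae_restrict_mem measurableSet_Ioi] with y hy
    exact norm_mul_indicator_le hs hf hw (le_of_lt hz) hy
  · exact ((integrable_indicator_iff measurableSet_Ioc).2
      (integrableOn_const measure_Ioc_lt_top.ne)).restrict
  · have : ∀ᵐ y ∂volume.restrict (Ioi (0 : ℝ)), y ≠ x :=
      ae_restrict_of_ae (Measure.ae_ne volume x)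
    filter_upwards [this] with y hy
    refine ContinuousAt.mul continuousAt_const ?_
    refine ContinuousAt.comp (g := (Ioi 0).indicator w) (f := fun z => z - y) ?_ (by fun_prop)
    rcases lt_or_gt_of_ne (sub_ne_zero.2 hy.symm) with h | h
    · refine ContinuousAt.congr (f := fun _ => (0 : ℝ)) continuousAt_const ?_
      filter_upwards [Iio_mem_nhds h] with z hz
      rw [indicator_of_notMem]
      exact not_lt.2 (le_of_lt (mem_Iio.1 hz))
    · refine (hwc.continuousAt (Ioi_mem_nhds h)).congr ?_
      filter_upwards [Ioi_mem_nhds h] with z hz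
      rw [indicator_of_mem hz]

lemma lconvolution_indicator_eq {f w : ℝ → ℝ} {B C s : ℝ} (hs : 0 ≤ s)
    (hfm : AEMeasurable f (volume.restrict (Ioi 0))) (hf0 : ∀ y, 0 < y → 0 ≤ f y)
    (hf : ∀ y, 0 < y → |f y| ≤ B) (hwc : ContinuousOn w (Ioi 0)) (hw0 : ∀ y, 0 < y → 0 ≤ w y)
    (hw : ∀ x, 0 < x → |w x| ≤ C * exp (s * x)) (x : ℝ) :
    (((Ioi 0).indicator fun x => ENNReal.ofReal (f x)) ⋆ₗ[volume]
      ((Ioi 0).indicator fun x => ENNReal.ofReal (w x))) x =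
      ENNReal.ofReal (halfLineConvolution f w x) := by
  have hm : AEStronglyMeasurable (fun y => f y * (Ioi 0).indicator w (x - y))
      (volume.restrict (Ioi 0)) := by
    refine (hfm.mul ?_).aestronglyMeasurable
    exact ((measurable_indicator_Ioi hwc).comp (measurable_const.sub measurable_id)).aemeasurable
  have hw0' : ∀ z, 0 ≤ (Ioi 0).indicator w z := fun z => indicator_nonneg (fun z hz => hw0 z hz) z
  unfold halfLineConvolution
  rw [ofReal_integral_eq_lintegral_ofReal, lconvolution_def,
    ← lintegral_indicator measurableSet_Ioi]
  · congr 1 with y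
    by_cases hy : y ∈ Ioi 0
    · rw [indicator_of_mem hy, indicator_of_mem hy, ENNReal.ofReal_mul (hf0 y hy), neg_add_eq_sub]
      congr 1
      by_cases hz : x - y ∈ Ioi 0
      · rw [indicator_of_mem hz, indicator_of_mem hz]
      · rw [indicator_of_notMem hz, indicator_of_notMem hz, ENNReal.ofReal_zero]
    · rw [indicator_of_notMem hy, indicator_of_notMem hy, zero_mul]
  · refine Integrable.mono' (g := (Ioc 0 x).indicator fun _ => B * (C * exp (s * x))) ?_ hm ?_
    · exact ((integrable_indicator_iff measurableSet_Ioc).2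
      (integrableOn_const measure_Ioc_lt_top.ne)).restrict
    · filter_upwards [ae_restrict_mem measurableSet_Ioi] with y hy
      exact norm_mul_indicator_le hs hf hw le_rfl hy
  · filter_upwards [ae_restrict_mem measurableSet_Ioi] with y hy
    exact mul_nonneg (hf0 y hy) (hw0' _)

lemma withDensity_add_of_aemeasurable {m : Measure ℝ} {f : ℝ → ENNReal} (hf : AEMeasurable f m)
    (g : ℝ → ENNReal) : m.withDensity (f + g) = m.withDensity f + m.withDensity g := by
  ext t ht
  rw [Measure.add_apply, withDensity_apply _ ht, withDensity_apply _ ht, withDensity_apply _ ht,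
    ← lintegral_add_left' hf.restrict]
  rfl

/-- A bounded function solving a renewal equation with continuous data agrees almost everywhere
with a continuous function. -/
lemma exists_continuousOn_ae_eq {f w : ℝ → ℝ} {B C s p a : ℝ} (hs : 0 ≤ s) (ha : 0 < a)
    (hfm : AEMeasurable f (volume.restrict (Ioi 0))) (hf0 : ∀ y, 0 < y → 0 ≤ f y)
    (hf : ∀ y, 0 < y → |f y| ≤ B) (hwc : ContinuousOn w (Ioi 0)) (hw0 : ∀ y, 0 < y → 0 ≤ w y)
    (hw : ∀ x, 0 < x → |w x| ≤ C * exp (s * x)) {α b : ℝ → ℝ}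
    (hα0 : ∀ β, p < β → 0 ≤ α β) (hb0 : ∀ β, p < β → 0 ≤ b β)
    (hα : ∀ β, p < β → laplaceMeasure (densityMeasure w) β = ENNReal.ofReal (α β))
    (hb : ∀ β, p < β → laplaceMeasure (densityMeasure f) β = ENNReal.ofReal (b β))
    (heq : ∀ β, p < β → α β = a ^ 2 * b β + a * (b β * α β)) :
    ∃ G : ℝ → ℝ, ContinuousOn G (Ioi 0) ∧ ∀ᵐ x ∂volume.restrict (Ioi 0), f x = G x := by
  refine ⟨fun x => (w x - a * halfLineConvolution f w x) / a ^ 2,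
    ((hwc.sub ((continuousOn_halfLineConvolution hs hfm hf hwc hw).const_smul a)).div_const _), ?_⟩
  have hmeas : densityMeasure w = (ENNReal.ofReal (a ^ 2)) • densityMeasure f +
      (ENNReal.ofReal a) • (densityMeasure f).conv (densityMeasure w) := by
    refine measure_ext_of_laplace (p := p) (fun β hβ => ?_) fun β hβ => ?_
    · change laplaceMeasure _ β = laplaceMeasure _ β
      have hsmul : ∀ (c : ENNReal) (m : Measure ℝ), laplaceMeasure (c • m) β =
        c * laplaceMeasure m β := fun c m => lintegral_smul_measure _ _
      have := hα0 β hβ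
      have := hb0 β hβ
      rw [laplaceMeasure_add, hsmul, hsmul, laplaceMeasure_conv, hα β hβ, hb β hβ,
        ← ENNReal.ofReal_mul (by positivity), ← ENNReal.ofReal_mul (by positivity),
        ← ENNReal.ofReal_mul (by positivity), ← ENNReal.ofReal_add (by positivity) (by positivity),
        ← heq β hβ]
    · change laplaceMeasure _ β ≠ ⊤
      rw [hα β hβ]
      exact ENNReal.ofReal_ne_top
  have hFm : AEMeasurable ((Ioi 0).indicator fun x => ENNReal.ofReal (f x)) volume :=
    (aemeasurable_indicator_iff measurableSet_Ioi).2 hfm.ennreal_ofReal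
  have hwm : AEMeasurable ((Ioi 0).indicator fun x => ENNReal.ofReal (w x)) volume :=
    (aemeasurable_indicator_iff measurableSet_Ioi).2
      (hwc.aemeasurable measurableSet_Ioi).ennreal_ofReal
  have hcm : AEMeasurable (((Ioi 0).indicator fun x => ENNReal.ofReal (f x)) ⋆ₗ[volume]
      ((Ioi 0).indicator fun x => ENNReal.ofReal (w x))) volume := aemeasurable_lconvolution hFm hwm
  rw [densityMeasure_eq w, densityMeasure_eq f, conv_withDensity_eq_mlconvolution₀ hFm hwm,
    ← withDensity_smul' _ _ ENNReal.ofReal_ne_top, ← withDensity_smul' _ _ ENNReal.ofReal_ne_top,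
    ← withDensity_add_of_aemeasurable (hFm.const_smul _), withDensity_eq_iff_of_sigmaFinite hwm
      ((hFm.const_smul _).add (hcm.const_smul _))] at hmeas
  filter_upwards [ae_restrict_of_ae hmeas, ae_restrict_mem measurableSet_Ioi] with x hx hx0
  rw [Pi.add_apply, Pi.smul_apply, Pi.smul_apply,
    lconvolution_indicator_eq hs hfm hf0 hf hwc hw0 hw,
    indicator_of_mem hx0, indicator_of_mem hx0, smul_eq_mul, smul_eq_mul] at hx
  have hH : 0 ≤ halfLineConvolution f w x := by
    refine setIntegral_nonneg measurableSet_Ioi fun y hy => mul_nonneg (hf0 y hy) ?_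
    exact indicator_nonneg (fun z hz => hw0 z hz) _
  have := hf0 x hx0
  rw [← ENNReal.ofReal_mul (by positivity), ← ENNReal.ofReal_mul (by positivity),
    ← ENNReal.ofReal_add (by positivity) (by positivity),
    ENNReal.ofReal_eq_ofReal_iff (hw0 x hx0) (by positivity)] at hx
  rw [hx]
  field_simp
  ring

/-- The data of a spectrally negative Lévy exponent `ψ` with drift `μ`, Gaussian coefficient `a`
and jump measure `ν`, together with its `r`-scale function `W`, of derivative `w`. -/
structure IsScaleFunction (ν : Measure ℝ) (μ a : ℝ) (ψ : ℝ → ℝ) (r s C w0 : ℝ) (W w : ℝ → ℝ) :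
    Prop where
  measure_Ici : ν (Ici 0) = 0
  lintegral_ne_top : ∫⁻ x, ENNReal.ofReal (min 1 (x ^ 2)) ∂ν ≠ ⊤
  coeff_nonneg : 0 ≤ a
  rate_pos : 0 < r
  root_nonneg : 0 ≤ s
  exponent : ∀ β, 0 ≤ β → ψ β = μ * β + a * β ^ 2 + ∫ z, levyIntegrand β z ∂ν
  lt_exponent : ∀ β, s < β → r < ψ β
  continuousOn : ContinuousOn W (Ici 0)
  hasDerivAt : ∀ x, 0 < x → HasDerivAt W (w x) x
  deriv_continuousOn : ContinuousOn w (Ioi 0)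
  deriv_nonneg : ∀ x, 0 < x → 0 ≤ w x
  deriv_tendsto : Tendsto w (𝓝[>] 0) (𝓝 w0)
  bound : ∀ x, 0 < x → |W x| ≤ C * exp (s * x)
  deriv_bound : ∀ x, 0 < x → |w x| ≤ C * exp (s * x)
  laplace : ∀ β, s < β → ∫ x in Ioi 0, exp (-β * x) * W x = 1 / (ψ β - r)

namespace IsScaleFunction

variable {ν : Measure ℝ} {μ a : ℝ} {ψ : ℝ → ℝ} {r s C w0 : ℝ} {W w : ℝ → ℝ}

lemma tendsto_zero (S : IsScaleFunction ν μ a ψ r s C w0 W w) : Tendsto W (𝓝[>] 0) (𝓝 (W 0)) :=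
  (S.continuousOn 0 self_mem_Ici).mono_left (nhdsWithin_mono _ Ioi_subset_Ici_self)

lemma laplace_deriv (S : IsScaleFunction ν μ a ψ r s C w0 W w) {β : ℝ} (hβ : s < β) :
    ∫ x in Ioi 0, exp (-β * x) * w x = β / (ψ β - r) - W 0 := by
  rw [_root_.laplace_deriv S.hasDerivAt S.deriv_continuousOn S.tendsto_zero S.bound S.deriv_bound
    hβ, S.laplace β hβ, mul_one_div]

lemma integrableOn_deriv (S : IsScaleFunction ν μ a ψ r s C w0 W w) {β : ℝ} (hβ : s < β) :
    IntegrableOn (fun x => exp (-β * x) * w x) (Ioi 0) :=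
  integrableOn_exp_mul_of_bound S.deriv_continuousOn S.deriv_bound hβ

lemma laplace_deriv_nonneg (S : IsScaleFunction ν μ a ψ r s C w0 W w) {β : ℝ} (hβ : s < β) :
    0 ≤ β / (ψ β - r) - W 0 := by
  rw [← S.laplace_deriv hβ]
  exact setIntegral_nonneg measurableSet_Ioi fun x hx =>
    mul_nonneg (exp_pos _).le (S.deriv_nonneg x hx)

lemma laplaceMeasure_deriv (S : IsScaleFunction ν μ a ψ r s C w0 W w) {β : ℝ} (hβ : s < β) :
    laplaceMeasure (densityMeasure w) β = ENNReal.ofReal (β / (ψ β - r) - W 0) := by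
  rw [← S.laplace_deriv hβ]
  exact laplaceMeasure_densityMeasure_of_nonneg
    (S.deriv_continuousOn.aemeasurable measurableSet_Ioi)
    S.deriv_nonneg (S.integrableOn_deriv hβ)

lemma tendsto_mul_laplace_deriv (S : IsScaleFunction ν μ a ψ r s C w0 W w) :
    Tendsto (fun β => β * (β / (ψ β - r) - W 0)) atTop (𝓝 w0) := by
  refine (tendsto_mul_laplace S.deriv_continuousOn S.deriv_bound S.deriv_tendsto).congr' ?_
  filter_upwards [eventually_gt_atTop s] with β hβ
  rw [S.laplace_deriv hβ]

lemma tendsto_exponent_div_sq (S : IsScaleFunction ν μ a ψ r s C w0 W w) :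
    Tendsto (fun β => (ψ β - r) / β ^ 2) atTop (𝓝 a) := by
  have h1 : Tendsto (fun β : ℝ => μ / β) atTop (𝓝 0) := tendsto_const_nhds.div_atTop tendsto_id
  have h2 : Tendsto (fun β : ℝ => r / β ^ 2) atTop (𝓝 0) :=
    tendsto_const_nhds.div_atTop (tendsto_pow_atTop two_ne_zero)
  have h := ((h1.add_const a).add
    (tendsto_integral_levyIntegrand_div_sq S.measure_Ici S.lintegral_ne_top)).sub h2
  simp only [zero_add, add_zero, sub_zero] at h
  refine h.congr' ?_
  filter_upwards [eventually_gt_atTop 0] with β hβ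
  rw [S.exponent β hβ.le]
  field_simp

/-- The function `v = p J - W`, where `J` is the shifted Laplace transform of `W` at `p`. -/
lemma laplace_shifted (S : IsScaleFunction ν μ a ψ r s C w0 W w) {p : ℝ} {J : ℝ → ℝ} (hsp : s < p)
    (hJ : ∀ x, J x = ∫ u in Ioi 0, exp (-p * u) * W (u + x)) {β : ℝ} (hβ : p < β) :
    IntegrableOn (fun x => exp (-β * x) * (p * J x - W x)) (Ioi 0) ∧
    ∫ x in Ioi 0, exp (-β * x) * (p * J x - W x) =
      β * ((J 0 - 1 / (ψ β - r)) / (β - p)) - J 0 := by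
  have hd := fun x hx => hasDerivAt_shifted_laplace S.continuousOn S.bound hsp hJ (x := x) hx
  have hJc : ContinuousOn J (Ioi 0) := fun x hx => (hd x hx).continuousAt.continuousWithinAt
  have hWc : ContinuousOn W (Ioi 0) := S.continuousOn.mono Ioi_subset_Ici_self
  have hvc : ContinuousOn (fun x => p * J x - W x) (Ioi 0) := by fun_prop
  have hJb := fun x hx => abs_shifted_laplace_le S.bound hsp hJ (x := x) hx
  have hp : 0 < p := S.root_nonneg.trans_lt hsp
  have hC : 0 ≤ C := by
    have := (abs_nonneg _).trans (S.bound 1 one_pos)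
    exact nonneg_of_mul_nonneg_left this (exp_pos _)
  have hD : 0 ≤ C / (p - s) := div_nonneg hC (sub_pos.2 hsp).le
  set D := C / (p - s) with hDdef
  have hb : ∀ x, 0 < x → |J x| ≤ (p * D + D + C) * exp (s * x) := fun x hx => by
    refine (hJb x hx).trans (mul_le_mul_of_nonneg_right ?_ (exp_pos _).le)
    have := mul_nonneg hp.le hD
    linarith
  have hb' : ∀ x, 0 < x → |p * J x - W x| ≤ (p * D + D + C) * exp (s * x) := fun x hx => by
    have h1 := abs_sub (p * J x) (W x)
    rw [abs_mul, abs_of_pos hp] at h1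
    have h2 := mul_le_mul_of_nonneg_left (hJb x hx) hp.le
    have h3 := S.bound x hx
    have h4 := mul_nonneg hD (exp_pos (s * x)).le
    nlinarith
  have hsβ := hsp.trans hβ
  have hi := integrableOn_exp_mul_of_bound hvc hb' hsβ
  refine ⟨hi, ?_⟩
  have e1 := _root_.laplace_deriv hd hvc (tendsto_shifted_laplace S.continuousOn S.bound hsp hJ)
    hb hb' hsβ
  have e2 : ∫ x in Ioi 0, exp (-β * x) * (p * J x - W x) =
      p * (∫ x in Ioi 0, exp (-β * x) * J x) - 1 / (ψ β - r) := by
    rw [← S.laplace β hsβ, ← integral_const_mul, ← integral_sub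
      ((integrableOn_exp_mul_of_bound hJc hb hsβ).const_mul p)
      (integrableOn_exp_mul_of_bound hWc S.bound hsβ)]
    congr 1 with x
    ring
  have e3 : ∫ x in Ioi 0, exp (-β * x) * J x = (J 0 - 1 / (ψ β - r)) / (β - p) := by
    rw [eq_div_iff (sub_pos.2 hβ).ne']
    linarith
  rw [e1, e3]

/-- The density of the measure by which the derivative of the scale function is convolved. -/
noncomputable def kernel (ν : Measure ℝ) (r q p x : ℝ) : ℝ :=
  (p - 1) / q * (p * tiltedTail ν p x + r)

lemma kernel_nonneg (S : IsScaleFunction ν μ a ψ r s C w0 W w) {p q x : ℝ} (hp : 1 ≤ p)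
    (hq : 0 < q) : 0 ≤ kernel ν r q p x := by
  have := tiltedTail_nonneg (ν := ν) p x
  have := S.rate_pos
  have := sub_nonneg.2 hp
  unfold kernel
  positivity

lemma aemeasurable_kernel (S : IsScaleFunction ν μ a ψ r s C w0 W w) {p q : ℝ} (hp : 0 < p) :
    AEMeasurable (kernel ν r q p) (volume.restrict (Ioi 0)) :=
  (((aemeasurable_tiltedTail S.lintegral_ne_top hp).const_mul p).add_const r).const_mul _

lemma laplace_kernel (S : IsScaleFunction ν μ a ψ r s C w0 W w) {p q : ℝ} (hp : 0 < p)
    {β : ℝ} (hβ : p < β) :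
    IntegrableOn (fun x => exp (-β * x) * kernel ν r q p x) (Ioi 0) ∧
    ∫ x in Ioi 0, exp (-β * x) * kernel ν r q p x = (p - 1) / q *
      (p * (((∫ z, levyIntegrand β z ∂ν) / β - (∫ z, levyIntegrand p z ∂ν) / p) / (β - p)) +
        r / β) := by
  have hβ0 := hp.trans hβ
  have h1 := (integrableOn_exp_mul_tiltedTail S.measure_Ici S.lintegral_ne_top hp hβ).const_mul
    ((p - 1) / q * p)
  have h2 : IntegrableOn (fun x => (p - 1) / q * r * exp (-β * x)) (Ioi 0) :=
    (exp_neg_integrableOn_Ioi 0 hβ0).const_mul _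
  have e : (fun x => exp (-β * x) * kernel ν r q p x) = fun x =>
      (p - 1) / q * p * (exp (-β * x) * tiltedTail ν p x) + (p - 1) / q * r * exp (-β * x) := by
    ext x
    unfold kernel
    ring
  rw [e]
  refine ⟨h1.add h2, ?_⟩
  rw [integral_add h1 h2, integral_const_mul, integral_const_mul,
    integral_exp_mul_tiltedTail S.measure_Ici S.lintegral_ne_top hp hβ,
    integral_exp_mul_Ioi (by linarith)]
  simp only [mul_zero, exp_zero]
  field_simp

/-- The Laplace transform of `(p - 1) (p J - W) - w`. -/
lemma laplace_difference (S : IsScaleFunction ν μ a ψ r s C w0 W w) {p q : ℝ} {J : ℝ → ℝ}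
    (hq : 0 < q) (hsp : s < p) (hψp : ψ p = r + q)
    (hJ : ∀ x, J x = ∫ u in Ioi 0, exp (-p * u) * W (u + x)) {β : ℝ} (hβ : p < β) :
    IntegrableOn (fun x => exp (-β * x) * ((p - 1) * (p * J x - W x) - w x)) (Ioi 0) ∧
    ∫ x in Ioi 0, exp (-β * x) * ((p - 1) * (p * J x - W x) - w x) =
      β / (ψ β - r) * (p * (p - 1) * a / q + ∫ x in Ioi 0, exp (-β * x) * kernel ν r q p x) -
        (β / (ψ β - r) - W 0) := by
  have hp : 0 < p := S.root_nonneg.trans_lt hsp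
  have hβ0 := hp.trans hβ
  have hsβ := hsp.trans hβ
  obtain ⟨i1, e1⟩ := S.laplace_shifted hsp hJ hβ
  have i2 := S.integrableOn_deriv hsβ
  have e : (fun x => exp (-β * x) * ((p - 1) * (p * J x - W x) - w x)) = fun x =>
      (p - 1) * (exp (-β * x) * (p * J x - W x)) - exp (-β * x) * w x := by
    ext x
    ring
  have hJ0 : J 0 = 1 / q := by
    rw [hJ 0]
    simp only [add_zero]
    rw [S.laplace p hsp, hψp, add_sub_cancel_left]
  rw [e]
  refine ⟨(i1.const_mul _).sub i2, ?_⟩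
  rw [integral_sub (i1.const_mul _) i2, integral_const_mul, e1, S.laplace_deriv hsβ,
    (S.laplace_kernel hp hβ).2, hJ0]
  have hβψ := S.exponent β hβ0.le
  have hpψ := S.exponent p hp.le
  rw [hψp] at hpψ
  have hne : ψ β - r ≠ 0 := (sub_pos.2 (S.lt_exponent β hsβ)).ne'
  have hne2 : β - p ≠ 0 := (sub_pos.2 hβ).ne'
  rw [show ∫ z, levyIntegrand β z ∂ν = ψ β - μ * β - a * β ^ 2 by linarith,
    show ∫ z, levyIntegrand p z ∂ν = r + q - μ * p - a * p ^ 2 by linarith]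
  field_simp
  ring

lemma continuousOn_difference (S : IsScaleFunction ν μ a ψ r s C w0 W w) {p : ℝ} {J : ℝ → ℝ}
    (hsp : s < p) (hJ : ∀ x, J x = ∫ u in Ioi 0, exp (-p * u) * W (u + x)) :
    ContinuousOn (fun x => (p - 1) * (p * J x - W x) - w x) (Ioi 0) := by
  have hJc : ContinuousOn J (Ioi 0) := fun x hx =>
    (hasDerivAt_shifted_laplace S.continuousOn S.bound hsp hJ hx).continuousAt.continuousWithinAt
  have hWc : ContinuousOn W (Ioi 0) := S.continuousOn.mono Ioi_subset_Ici_self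
  have hwc := S.deriv_continuousOn
  fun_prop

lemma coeff_mul_eq_one (S : IsScaleFunction ν μ a ψ r s C w0 W w) (h0 : W 0 = 0) : a * w0 = 1 := by
  refine tendsto_nhds_unique (S.tendsto_exponent_div_sq.mul S.tendsto_mul_laplace_deriv)
    (tendsto_const_nhds.congr' ?_)
  filter_upwards [eventually_gt_atTop 0, eventually_gt_atTop s] with β hβ hsβ
  have hne : ψ β - r ≠ 0 := (sub_pos.2 (S.lt_exponent β hsβ)).ne'
  rw [h0]
  field_simp
  ring

lemma nonneg_of_zero_eq_zero (S : IsScaleFunction ν μ a ψ r s C w0 W w) {p q : ℝ} {J : ℝ → ℝ}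
    (hq : 0 < q) (hsp : s < p) (hψp : ψ p = r + q)
    (hJ : ∀ x, J x = ∫ u in Ioi 0, exp (-p * u) * W (u + x)) (h0 : W 0 = 0)
    (hcond : 0 ≤ (p - 1) * (p - q * W 0) - q * w0) {x : ℝ} (hx : 0 < x) :
    0 ≤ (p - 1) * (p * J x - W x) - w x := by
  have hp : 0 < p := S.root_nonneg.trans_lt hsp
  have haw := S.coeff_mul_eq_one h0
  have ha : 0 < a := S.coeff_nonneg.lt_of_ne' fun h => by simp [h] at haw
  have hw0 : 0 < w0 := pos_of_mul_pos_right (haw ▸ one_pos) ha.le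
  rw [h0, mul_zero, sub_zero] at hcond
  have hp1 : 1 ≤ p := by
    have := mul_pos hq hw0
    by_contra! h
    nlinarith
  have hκ : 0 ≤ p * (p - 1) * a / q - 1 := by
    rw [sub_nonneg, le_div_iff₀ hq]
    nlinarith
  have hM : ∀ β, 0 ≤ ∫ x in Ioi 0, exp (-β * x) * kernel ν r q p x := fun β =>
    setIntegral_nonneg measurableSet_Ioi fun x _ =>
      mul_nonneg (exp_pos _).le (S.kernel_nonneg hp1 hq)
  refine nonneg_of_laplace_eq_mul (S.continuousOn_difference hsp hJ) (p := p)
    (fun β hβ => (S.laplace_difference hq hsp hψp hJ hβ).1) (m₁ := densityMeasure w)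
    (m₂ := ENNReal.ofReal (p * (p - 1) * a / q - 1) • Measure.dirac 0 +
      densityMeasure (kernel ν r q p))
    (a := fun β => β / (ψ β - r) - W 0)
    (b := fun β => p * (p - 1) * a / q - 1 + ∫ x in Ioi 0, exp (-β * x) * kernel ν r q p x)
    (fun β hβ => S.laplace_deriv_nonneg (hsp.trans hβ)) (fun β _ => add_nonneg hκ (hM β))
    (fun β hβ => S.laplaceMeasure_deriv (hsp.trans hβ)) (fun β hβ => ?_) (fun β hβ => ?_) hx
  · rw [laplaceMeasure_add, laplaceMeasure_smul_dirac, laplaceMeasure_densityMeasure_of_nonneg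
      (S.aemeasurable_kernel hp) (fun x _ => S.kernel_nonneg hp1 hq) (S.laplace_kernel hp hβ).1,
      ENNReal.ofReal_add hκ (hM β)]
  · rw [(S.laplace_difference hq hsp hψp hJ hβ).2, h0]
    ring

lemma tendsto_div_exponent (S : IsScaleFunction ν μ a ψ r s C w0 W w) :
    Tendsto (fun β => β / (ψ β - r)) atTop (𝓝 (W 0)) := by
  have h := (S.tendsto_mul_laplace_deriv.div_atTop tendsto_id).add_const (W 0)
  rw [zero_add] at h
  refine h.congr' ?_
  filter_upwards [eventually_gt_atTop 0] with β hβ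
  simp only [id]
  field_simp
  ring

lemma tendsto_exponent_div (S : IsScaleFunction ν μ a ψ r s C w0 W w) (h0 : 0 < W 0) :
    Tendsto (fun β => (ψ β - r) / β) atTop (𝓝 (1 / W 0)) := by
  rw [one_div]
  refine (S.tendsto_div_exponent.inv₀ h0.ne').congr fun β => ?_
  rw [inv_div]

lemma coeff_eq_zero (S : IsScaleFunction ν μ a ψ r s C w0 W w) (h0 : 0 < W 0) : a = 0 := by
  refine tendsto_nhds_unique S.tendsto_exponent_div_sq
    (((S.tendsto_exponent_div h0).div_atTop tendsto_id).congr fun β => ?_)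
  simp only [id]
  rw [div_div, sq]

lemma tendsto_levy_div (S : IsScaleFunction ν μ a ψ r s C w0 W w) (h0 : 0 < W 0) :
    Tendsto (fun β => (∫ z, levyIntegrand β z ∂ν) / β) atTop (𝓝 (1 / W 0 - μ)) := by
  have h1 : Tendsto (fun β : ℝ => r / β) atTop (𝓝 0) := tendsto_const_nhds.div_atTop tendsto_id
  have h := ((S.tendsto_exponent_div h0).add h1).sub_const μ
  rw [add_zero] at h
  refine h.congr' ?_
  filter_upwards [eventually_gt_atTop 0] with β hβ
  rw [S.exponent β hβ.le, S.coeff_eq_zero h0]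
  field_simp
  ring

lemma negTail_le (S : IsScaleFunction ν μ a ψ r s C w0 W w) (h0 : 0 < W 0) {x : ℝ} (hx : 0 < x) :
    negTail ν x ≤ w0 / W 0 ^ 2 - r := by
  refine negTail_le_of_tendsto S.measure_Ici S.lintegral_ne_top (S.tendsto_levy_div h0) ?_ hx
  have h := (S.tendsto_mul_laplace_deriv.mul
    ((S.tendsto_exponent_div h0).mul_const (1 / W 0))).sub_const r
  rw [show w0 * (1 / W 0 * (1 / W 0)) = w0 / W 0 ^ 2 by field_simp] at h
  refine h.congr' ?_
  filter_upwards [eventually_gt_atTop 0, eventually_gt_atTop s] with β hβ hsβ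
  have hne : ψ β - r ≠ 0 := (sub_pos.2 (S.lt_exponent β hsβ)).ne'
  have hψ := S.exponent β hβ.le
  rw [S.coeff_eq_zero h0] at hψ
  rw [show ∫ z, levyIntegrand β z ∂ν = ψ β - μ * β by linarith]
  field_simp
  ring

lemma laplace_negTail_add (S : IsScaleFunction ν μ a ψ r s C w0 W w) (h0 : 0 < W 0) {β : ℝ}
    (hβ : s < β) : IntegrableOn (fun x => exp (-β * x) * (negTail ν x + r)) (Ioi 0) ∧
    ∫ x in Ioi 0, exp (-β * x) * (negTail ν x + r) = 1 / W 0 - (ψ β - r) / β := by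
  have hβ0 := S.root_nonneg.trans_lt hβ
  have h1 := integrableOn_exp_mul_negTail_of_le S.lintegral_ne_top
    (fun x hx => S.negTail_le h0 hx) hβ0
  have h2 : IntegrableOn (fun x => r * exp (-β * x)) (Ioi 0) :=
    (exp_neg_integrableOn_Ioi 0 hβ0).const_mul _
  have e : (fun x => exp (-β * x) * (negTail ν x + r)) = fun x =>
      exp (-β * x) * negTail ν x + r * exp (-β * x) := by
    ext x
    ring
  rw [e]
  refine ⟨h1.add h2, ?_⟩
  rw [integral_add h1 h2, integral_const_mul, integral_exp_mul_Ioi (by linarith),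
    ← sub_integral_levyIntegrand_div S.measure_Ici S.lintegral_ne_top (S.tendsto_levy_div h0)
      (fun x hx => S.negTail_le h0 hx) hβ0]
  have hψ := S.exponent β hβ0.le
  rw [S.coeff_eq_zero h0] at hψ
  rw [show ∫ z, levyIntegrand β z ∂ν = ψ β - μ * β by linarith]
  simp only [mul_zero, exp_zero]
  field_simp
  ring

lemma laplace_negTail_add_nonneg (S : IsScaleFunction ν μ a ψ r s C w0 W w) (h0 : 0 < W 0) {β : ℝ}
    (hβ : s < β) : 0 ≤ 1 / W 0 - (ψ β - r) / β := by
  rw [← (S.laplace_negTail_add h0 hβ).2]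
  exact setIntegral_nonneg measurableSet_Ioi fun x _ =>
    mul_nonneg (exp_pos _).le (add_nonneg (negTail_nonneg x) S.rate_pos.le)

lemma exists_continuousOn_ae_eq_negTail (S : IsScaleFunction ν μ a ψ r s C w0 W w)
    (h0 : 0 < W 0) :
    ∃ G : ℝ → ℝ, ContinuousOn G (Ioi 0) ∧ ∀ᵐ x ∂volume.restrict (Ioi 0), negTail ν x = G x := by
  have hfm : AEMeasurable (fun x => negTail ν x + r) (volume.restrict (Ioi 0)) :=
    (aemeasurable_negTail S.lintegral_ne_top).add_const r
  have hf0 : ∀ x, 0 < x → 0 ≤ negTail ν x + r := fun x _ =>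
    add_nonneg (negTail_nonneg x) S.rate_pos.le
  obtain ⟨G, hG, hae⟩ := exists_continuousOn_ae_eq (B := w0 / W 0 ^ 2) (p := s) (a := W 0)
    S.root_nonneg h0 hfm hf0 (fun x hx => by
      rw [abs_of_nonneg (hf0 x hx)]
      linarith [S.negTail_le h0 hx]) S.deriv_continuousOn S.deriv_nonneg S.deriv_bound
    (α := fun β => β / (ψ β - r) - W 0) (b := fun β => 1 / W 0 - (ψ β - r) / β)
    (fun β hβ => S.laplace_deriv_nonneg hβ) (fun β hβ => S.laplace_negTail_add_nonneg h0 hβ)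
    (fun β hβ => S.laplaceMeasure_deriv hβ)
    (fun β hβ => by
      rw [← (S.laplace_negTail_add h0 hβ).2]
      exact laplaceMeasure_densityMeasure_of_nonneg hfm hf0 (S.laplace_negTail_add h0 hβ).1)
    (fun β hβ => by
      have hne : ψ β - r ≠ 0 := (sub_pos.2 (S.lt_exponent β hβ)).ne'
      have hβ0 : 0 < β := S.root_nonneg.trans_lt hβ
      field_simp
      ring)
  refine ⟨fun x => G x - r, hG.sub continuousOn_const, ?_⟩
  filter_upwards [hae] with x hx
  linarith

lemma negTail_add_mul_add_le (S : IsScaleFunction ν μ a ψ r s C w0 W w) (h0 : 0 < W 0)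
    (htail : (∃ p : ℝ → ℝ,
        (∀ x : ℝ, 0 < x → negTail ν x = ∫ t in Ioi x, p t) ∧
        ContDiffOn ℝ (⊤ : ℕ∞) p (Ioi 0) ∧
        ∀ n : ℕ, ∀ x : ℝ, 0 < x → 0 ≤ (-1 : ℝ) ^ n * iteratedDerivWithin n p (Ioi 0) x) ∨
      ConvexOn ℝ (Ioi 0) (fun x => log (negTail ν x)))
    {x y u : ℝ} (hy : 0 < y) (hyx : y ≤ x) (hu : 0 ≤ u) :
    (negTail ν x + r) * (negTail ν (y + u) + r) ≤
      (negTail ν (x + u) + r) * (negTail ν y + r) := by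
  have hT : ∀ x, 0 < x → 0 ≤ negTail ν x := fun x _ => negTail_nonneg x
  have hanti := antitoneOn_negTail S.lintegral_ne_top
  rcases htail with ⟨p, hTp, hp, hcm⟩ | hl
  · exact add_mul_add_le_of_completely_monotone S.rate_pos hT hTp hp hcm hy hyx hu
  · obtain ⟨G, hG, hTG⟩ := S.exists_continuousOn_ae_eq_negTail h0
    rcases pos_or_eq_zero_of_log_convex hT hanti hl hG hTG with h | h
    · exact add_mul_add_le_of_log_convex S.rate_pos.le h hanti hl hy hyx hu
    · rw [h x (by linarith), h y hy, h (x + u) (by linarith), h (y + u) (by linarith)]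

lemma nonneg_of_zero_pos (S : IsScaleFunction ν μ a ψ r s C w0 W w) {p q : ℝ} {J : ℝ → ℝ}
    (hq : 0 < q) (hsp : s < p) (hψp : ψ p = r + q)
    (hJ : ∀ x, J x = ∫ u in Ioi 0, exp (-p * u) * W (u + x)) (h0 : 0 < W 0)
    (htail : (∃ p : ℝ → ℝ,
        (∀ x : ℝ, 0 < x → negTail ν x = ∫ t in Ioi x, p t) ∧
        ContDiffOn ℝ (⊤ : ℕ∞) p (Ioi 0) ∧
        ∀ n : ℕ, ∀ x : ℝ, 0 < x → 0 ≤ (-1 : ℝ) ^ n * iteratedDerivWithin n p (Ioi 0) x) ∨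
      ConvexOn ℝ (Ioi 0) (fun x => log (negTail ν x)))
    (hcond : 0 ≤ (p - 1) * (p - q * W 0) - q * w0) {x : ℝ} (hx : 0 < x) :
    0 ≤ (p - 1) * (p * J x - W x) - w x := by
  have hp : 0 < p := S.root_nonneg.trans_lt hsp
  have hr := S.rate_pos
  set k := w0 / W 0 ^ 2 - r with hk
  have hTk : ∀ x, 0 < x → negTail ν x ≤ k := fun x hx => S.negTail_le h0 hx
  have hw0 : w0 = (k + r) * W 0 ^ 2 := by
    rw [hk]
    field_simp
    ring
  have hkr : 0 < k + r := by linarith [hTk 1 one_pos, negTail_nonneg (ν := ν) 1]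
  set A := ∫ t in Ioi 0, exp (-p * t) * negTail ν t with hA
  have hA0 : 0 ≤ A := setIntegral_nonneg measurableSet_Ioi fun t _ =>
    mul_nonneg (exp_pos _).le (negTail_nonneg t)
  have hpA : p - q * W 0 = W 0 * (p * A + r) := by
    have hψ := S.exponent p hp.le
    rw [S.coeff_eq_zero h0, hψp] at hψ
    rw [hA, ← sub_integral_levyIntegrand_div S.measure_Ici S.lintegral_ne_top
      (S.tendsto_levy_div h0) hTk hp,
      show ∫ z, levyIntegrand p z ∂ν = r + q - μ * p by linarith]
    field_simp
    ring
  have hpAr : 0 < p * A + r := by positivity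
  rw [hpA, hw0] at hcond
  have hcond2 : q * ((k + r) * W 0) ≤ (p - 1) * (p * A + r) := by
    by_contra! h
    nlinarith
  have hp1 : 1 < p := by
    have : 0 < q * ((k + r) * W 0) := by positivity
    by_contra! h
    nlinarith
  have hg : ∀ x, 0 < x → 0 ≤ kernel ν r q p x - W 0 * (negTail ν x + r) := by
    intro x hx
    have h1 := negTail_add_mul_le S.lintegral_ne_top hp hr hTk hx fun y u hy hyx hu =>
      S.negTail_add_mul_add_le h0 htail hy hyx hu
    rw [← hA] at h1
    have hT := negTail_nonneg (ν := ν) x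
    rw [sub_nonneg, kernel, div_mul_eq_mul_div, le_div_iff₀ hq]
    refine le_of_mul_le_mul_right ?_ hkr
    calc W 0 * (negTail ν x + r) * q * (k + r)
      _ = (negTail ν x + r) * (q * ((k + r) * W 0)) := by ring
      _ ≤ (negTail ν x + r) * ((p - 1) * (p * A + r)) := by gcongr
      _ = (p - 1) * ((negTail ν x + r) * (p * A + r)) := by ring
      _ ≤ (p - 1) * ((p * tiltedTail ν p x + r) * (k + r)) :=
        mul_le_mul_of_nonneg_left h1 (by linarith)
      _ = (p - 1) * (p * tiltedTail ν p x + r) * (k + r) := by ring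
  have hgm : AEMeasurable (fun x => kernel ν r q p x - W 0 * (negTail ν x + r))
      (volume.restrict (Ioi 0)) := (S.aemeasurable_kernel hp).sub
    (((aemeasurable_negTail S.lintegral_ne_top).add_const r).const_mul _)
  have hgi : ∀ β, p < β →
      IntegrableOn (fun x => exp (-β * x) * (kernel ν r q p x - W 0 * (negTail ν x + r))) (Ioi 0) ∧
      ∫ x in Ioi 0, exp (-β * x) * (kernel ν r q p x - W 0 * (negTail ν x + r)) =
        (∫ x in Ioi 0, exp (-β * x) * kernel ν r q p x) -
          W 0 * (1 / W 0 - (ψ β - r) / β) := by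
    intro β hβ
    obtain ⟨i1, e1⟩ := S.laplace_kernel (q := q) hp hβ
    obtain ⟨i2, e2⟩ := S.laplace_negTail_add h0 (hsp.trans hβ)
    have e : (fun x => exp (-β * x) * (kernel ν r q p x - W 0 * (negTail ν x + r))) = fun x =>
        exp (-β * x) * kernel ν r q p x - W 0 * (exp (-β * x) * (negTail ν x + r)) := by
      ext x
      ring
    rw [e]
    refine ⟨i1.sub (i2.const_mul _), ?_⟩
    rw [integral_sub i1 (i2.const_mul _), integral_const_mul, e2]
  refine nonneg_of_laplace_eq_mul (S.continuousOn_difference hsp hJ) (p := p)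
    (fun β hβ => (S.laplace_difference hq hsp hψp hJ hβ).1)
    (m₁ := ENNReal.ofReal (W 0) • Measure.dirac 0 + densityMeasure w)
    (m₂ := densityMeasure fun x => kernel ν r q p x - W 0 * (negTail ν x + r))
    (a := fun β => W 0 + (β / (ψ β - r) - W 0))
    (b := fun β => ∫ x in Ioi 0, exp (-β * x) * (kernel ν r q p x - W 0 * (negTail ν x + r)))
    (fun β hβ => add_nonneg h0.le (S.laplace_deriv_nonneg (hsp.trans hβ)))
    (fun β _ => setIntegral_nonneg measurableSet_Ioi fun x hx =>
      mul_nonneg (exp_pos _).le (hg x hx)) (fun β hβ => ?_)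
    (fun β hβ => laplaceMeasure_densityMeasure_of_nonneg hgm hg (hgi β hβ).1)
    (fun β hβ => ?_) hx
  · rw [laplaceMeasure_add, laplaceMeasure_smul_dirac, S.laplaceMeasure_deriv (hsp.trans hβ),
      ENNReal.ofReal_add h0.le (S.laplace_deriv_nonneg (hsp.trans hβ))]
  · rw [(S.laplace_difference hq hsp hψp hJ hβ).2, (hgi β hβ).2, S.coeff_eq_zero h0]
    have hne : ψ β - r ≠ 0 := (sub_pos.2 (S.lt_exponent β (hsp.trans hβ))).ne'
    have hβ0 : 0 < β := hp.trans hβ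
    field_simp
    ring

end IsScaleFunction

/-- Lemma 2.7 (`lem:explicit`): if `W^{(r)}` is `C²` on `(0,∞)` and the tail of
the jump measure has a completely monotone density or is log-convex, then
`(I^{(r,q)})″ ≥ (I^{(r,q)})′` on `(0,∞)` iff
`(Φ(r+q) − 1)(Φ(r+q) − qW^{(r)}(0)) − q(W^{(r)})′(0+) ≥ 0`. -/
theorem stmt4
    (μ σ : ℝ) (ν : MeasureTheory.Measure ℝ)
    (hν : ν (Set.Ici 0) = 0)
    (hνint : ∫⁻ x, ENNReal.ofReal (min 1 (x ^ 2)) ∂ν ≠ ⊤)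
    (ψ : ℝ → ℝ)
    (hψ : ∀ β : ℝ, 0 ≤ β →
      ψ β = μ * β + σ ^ 2 / 2 * β ^ 2 +
        ∫ z, (Real.exp (β * z) - 1 -
          Set.indicator (Set.Ioi (-1 : ℝ)) (fun t => β * t) z) ∂ν)
    (Φ : ℝ → ℝ)
    (hΦ : ∀ s : ℝ, 0 ≤ s → 0 ≤ Φ s ∧ ψ (Φ s) = s ∧ ∀ β : ℝ, Φ s < β → s < ψ β)
    (W : ℝ → ℝ → ℝ)
    (hWnn : ∀ s : ℝ, 0 ≤ s → ∀ x : ℝ, 0 ≤ W s x)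
    (hWzero : ∀ s : ℝ, 0 ≤ s → ∀ x : ℝ, x < 0 → W s x = 0)
    (hWcont : ∀ s : ℝ, 0 ≤ s → ContinuousOn (W s) (Set.Ici 0))
    (hWmono : ∀ s : ℝ, 0 ≤ s → MonotoneOn (W s) (Set.Ici 0))
    (hWlap : ∀ s : ℝ, 0 ≤ s → ∀ β : ℝ, Φ s < β →
      ∫ x in Set.Ioi (0 : ℝ), Real.exp (-β * x) * W s x = 1 / (ψ β - s))
    (r q : ℝ) (hr : 0 < r) (hq : 0 < q)
    (I : ℝ → ℝ)
    (hI : ∀ x : ℝ, I x = ∫ u in Set.Ioi (0 : ℝ), Real.exp (-Φ (r + q) * u) * W r (u + x))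
    (W' : ℝ → ℝ)
    (hW' : ∀ x : ℝ, 0 < x → HasDerivAt (W r) (W' x) x)
    (hW'c : ContinuousOn W' (Set.Ioi 0))
    (c : ℝ) (hc : 0 < c) (hψ' : HasDerivAt ψ c (Φ r))
    (hlim1 : Filter.Tendsto (fun x => Real.exp (-Φ r * x) * W r x) Filter.atTop (nhds (1 / c)))
    (hlim2 : Filter.Tendsto (fun x => W' x / W r x) Filter.atTop (nhds (Φ r)))
    (W'' : ℝ → ℝ)
    (hW'' : ∀ x : ℝ, 0 < x → HasDerivAt W' (W'' x) x)
    (hW''c : ContinuousOn W'' (Set.Ioi 0))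
    (htail :
      (∃ p : ℝ → ℝ,
        (∀ x : ℝ, 0 < x → (ν (Set.Iio (-x))).toReal = ∫ t in Set.Ioi x, p t) ∧
        ContDiffOn ℝ (⊤ : ℕ∞) p (Set.Ioi 0) ∧
        ∀ n : ℕ, ∀ x : ℝ, 0 < x →
          0 ≤ (-1 : ℝ) ^ n * iteratedDerivWithin n p (Set.Ioi 0) x) ∨
      ConvexOn ℝ (Set.Ioi 0) (fun x => Real.log ((ν (Set.Iio (-x))).toReal)))
    (W'0 : ℝ) (hW'0 : Filter.Tendsto W' (nhdsWithin 0 (Set.Ioi 0)) (nhds W'0))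
    (I' I'' : ℝ → ℝ)
    (hI' : ∀ x : ℝ, 0 < x → HasDerivAt I (I' x) x)
    (hI'' : ∀ x : ℝ, 0 < x → HasDerivAt I' (I'' x) x) :
    (∀ x : ℝ, 0 < x → I' x ≤ I'' x) ↔
      0 ≤ (Φ (r + q) - 1) * (Φ (r + q) - q * W r 0) - q * W'0 := by
  set p := Φ (r + q) with hp
  obtain ⟨hφ0, hφr, hφ⟩ := hΦ r hr.le
  obtain ⟨hp0, hpr, hpgt⟩ := hΦ (r + q) (by positivity)
  rw [← hp] at hp0 hpr hpgt
  have hφp : Φ r < p := by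
    rcases lt_trichotomy (Φ r) p with h | h | h
    · exact h
    · rw [h, hpr] at hφr
      linarith
    · have := hpgt _ h
      linarith
  have hw0 : ∀ x, 0 < x → 0 ≤ W' x := fun x hx =>
    deriv_nonneg_of_monotoneOn_Ici (hWmono r hr.le) hW' hx
  obtain ⟨C, hC, hC'⟩ := exists_exp_bounds hφ0 hc (hWnn r hr.le) (hWcont r hr.le) (hWmono r hr.le)
    hW' hW'c hlim1 hlim2 hW'0
  have S : IsScaleFunction ν μ (σ ^ 2 / 2) ψ r (Φ r) C W'0 (W r) W' :=
    { measure_Ici := hν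
      lintegral_ne_top := hνint
      coeff_nonneg := by positivity
      rate_pos := hr
      root_nonneg := hφ0
      exponent := hψ
      lt_exponent := hφ
      continuousOn := hWcont r hr.le
      hasDerivAt := hW'
      deriv_continuousOn := hW'c
      deriv_nonneg := hw0
      deriv_tendsto := hW'0
      bound := hC
      deriv_bound := hC'
      laplace := hWlap r hr.le }
  have hId : ∀ x, 0 < x → I' x = p * I x - W r x := fun x hx =>
    (hI' x hx).unique (hasDerivAt_shifted_laplace (hWcont r hr.le) hC hφp hI hx)
  have hdiff : ∀ x, 0 < x → I'' x - I' x = (p - 1) * (p * I x - W r x) - W' x := by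
    intro x hx
    have h : HasDerivAt I' (p * I' x - W' x) x := by
      refine (((hI' x hx).const_mul p).sub (hW' x hx)).congr_of_eventuallyEq ?_
      filter_upwards [Ioi_mem_nhds hx] with y hy using hId y hy
    rw [(hI'' x hx).unique h, hId x hx]
    ring
  have hI0 : I 0 = 1 / q := by
    rw [hI 0]
    simp only [add_zero]
    rw [hWlap r hr.le p hφp, hpr, add_sub_cancel_left]
  constructor
  · intro h
    have hlim : Tendsto (fun x => q * ((p - 1) * (p * I x - W r x) - W' x)) (𝓝[>] 0)
        (𝓝 (q * ((p - 1) * (p * I 0 - W r 0) - W'0))) :=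
      ((((((tendsto_shifted_laplace (hWcont r hr.le) hC hφp hI).const_mul p).sub
        S.tendsto_zero).const_mul (p - 1)).sub hW'0).const_mul q)
    have hnn := ge_of_tendsto hlim (b := 0) (by
      filter_upwards [self_mem_nhdsWithin] with x hx
      rw [← hdiff x hx]
      exact mul_nonneg hq.le (sub_nonneg.2 (h x hx)))
    rw [hI0] at hnn
    refine hnn.trans_eq ?_
    field_simp
  · intro h x hx
    rw [← sub_nonneg, hdiff x hx]
    rcases (hWnn r hr.le 0).eq_or_lt with h0 | h0
    · exact S.nonneg_of_zero_eq_zero hq hφp hpr hI h0.symm h hx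
    · exact S.nonneg_of_zero_pos hq hφp hpr hI h0 htail h hx
end

section
/- Define H(u) = ( (I^{(r,q)})″(u) − (I^{(r,q)})′(u) ) / I^{(r,q)}(u) for u > 0. Then H(u) = (Φ(r+q) − 1)·Λ̄(u) − (W^{(r)})′(u)/I^{(r,q)}(u), where Λ̄(u) = (I^{(r,q)})′(u)/I^{(r,q)}(u), and lim_{u→∞} H(u) = Φ(r)·(Φ(r) − 1). In particular, if r > ψ(1), so that Φ(r) > 1, then H(u) > 0 for all sufficiently large u. -/
open MeasureTheory Real Set Filter Topology

/-- An exponentially weighted tail integral as an integral over `(x, ∞)`. -/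
theorem integral_exp_mul_comp_add_right (f : ℝ → ℝ) (a x : ℝ) :
    ∫ u in Ioi (0 : ℝ), exp (-a * u) * f (u + x) =
      exp (a * x) * ∫ v in Ioi x, exp (-a * v) * f v := by
  have h := (measurePreserving_add_right volume x).setIntegral_preimage_emb
    (measurableEmbedding_addRight x) (fun v => exp (-a * v) * f v) (Ioi x)
  rw [← h, ← integral_const_mul]
  have hpre : (fun y : ℝ => y + x) ⁻¹' Ioi x = Ioi 0 := by ext; simp
  rw [hpre]
  congr 1 with u
  rw [← mul_assoc, ← exp_add]
  ring_nf

theorem integrableOn_exp_neg_mul {f : ℝ → ℝ} {a p L : ℝ} (hf : ContinuousOn f (Ici 0))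
    (hpa : p < a) (hL : Tendsto (fun x => exp (-p * x) * f x) atTop (𝓝 L)) :
    IntegrableOn (fun v => exp (-a * v) * f v) (Ioi 0) := by
  refine integrable_of_isBigO_exp_neg (b := a - p) (by linarith) (by fun_prop) ?_
  have h := (Asymptotics.isBigO_refl (fun x : ℝ => exp (-(a - p) * x)) atTop).mul
    (hL.isBigO_one ℝ)
  simp only [mul_one] at h
  refine h.congr_left fun x => ?_
  rw [← mul_assoc, ← exp_add]
  ring_nf

theorem hasDerivAt_integral_exp_neg_mul {f : ℝ → ℝ} {a x : ℝ} (hf : ContinuousOn f (Ici 0))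
    (hint : IntegrableOn (fun v => exp (-a * v) * f v) (Ioi 0)) (hx : 0 < x) :
    HasDerivAt (fun x => ∫ u in Ioi (0 : ℝ), exp (-a * u) * f (u + x))
      (a * (∫ u in Ioi (0 : ℝ), exp (-a * u) * f (u + x)) - f x) x := by
  have hcont : ContinuousOn (fun v => exp (-a * v) * f v) (Ici 0) := by fun_prop
  have hprim : HasDerivAt (fun y => ∫ v in (0 : ℝ)..y, exp (-a * v) * f v)
      (exp (-a * x) * f x) x := by
    refine intervalIntegral.integral_hasDerivAt_right ?_ ?_ (hcont.continuousAt (Ici_mem_nhds hx))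
    · refine (hcont.mono ?_).intervalIntegrable
      rw [uIcc_of_le hx.le]
      exact Icc_subset_Ici_self
    · exact (hcont.mono Ioi_subset_Ici_self).stronglyMeasurableAtFilter isOpen_Ioi x hx
  have htail : HasDerivAt (fun y => ∫ v in Ioi y, exp (-a * v) * f v)
      (-(exp (-a * x) * f x)) x := by
    refine (hprim.const_sub (∫ v in Ioi (0 : ℝ), exp (-a * v) * f v)).congr_of_eventuallyEq ?_
    filter_upwards [Ioi_mem_nhds hx] with y hy
    rw [← intervalIntegral.integral_Ioi_sub_Ioi hint (le_of_lt hy), sub_sub_cancel]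
  have hexp : HasDerivAt (fun y => exp (a * y)) (exp (a * x) * a) x := by
    simpa using ((hasDerivAt_id x).const_mul a).exp
  simp only [integral_exp_mul_comp_add_right]
  convert! hexp.mul htail using 1
  have : exp (a * x) * exp (-a * x) = 1 := by
    rw [← exp_add]
    simp
  linear_combination f x * this

theorem tendsto_exp_neg_mul_integral {f : ℝ → ℝ} {a p L : ℝ} (hf : ContinuousOn f (Ici 0))
    (hpa : p < a) (hL : Tendsto (fun x => exp (-p * x) * f x) atTop (𝓝 L)) :
    Tendsto (fun x => exp (-p * x) * ∫ u in Ioi (0 : ℝ), exp (-a * u) * f (u + x))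
      atTop (𝓝 (L / (a - p))) := by
  have hap : 0 < a - p := sub_pos.2 hpa
  have hrw : ∀ x : ℝ, exp (-p * x) * ∫ u in Ioi (0 : ℝ), exp (-a * u) * f (u + x) =
      ∫ u in Ioi (0 : ℝ), exp (-(a - p) * u) * (exp (-p * (u + x)) * f (u + x)) := by
    intro x
    rw [← integral_const_mul]
    congr 1 with u
    rw [← mul_assoc, ← mul_assoc, ← exp_add, ← exp_add]
    ring_nf
  have hval : ∫ u in Ioi (0 : ℝ), exp (-(a - p) * u) * L = L / (a - p) := by
    rw [integral_mul_const, integral_exp_mul_Ioi (neg_lt_zero.2 hap)]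
    simp only [mul_zero, exp_zero]
    field_simp
  simp only [hrw]
  rw [← hval]
  refine tendsto_integral_filter_of_dominated_convergence
    (fun u => exp (-(a - p) * u) * (|L| + 1)) ?_ ?_
    ((exp_neg_integrableOn_Ioi 0 hap).mul_const _) ?_
  · filter_upwards [eventually_ge_atTop 0] with x hx
    refine ContinuousOn.aestronglyMeasurable ?_ measurableSet_Ioi
    have : ContinuousOn (fun u => f (u + x)) (Ioi 0) :=
      hf.comp (by fun_prop) fun u hu => add_nonneg (le_of_lt hu) hx
    exact ContinuousOn.mul (by fun_prop) (ContinuousOn.mul (by fun_prop) this)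
  · obtain ⟨M, hM⟩ := eventually_atTop.1 (hL.abs.eventually_lt_const (lt_add_one |L|))
    filter_upwards [eventually_ge_atTop M] with x hx
    filter_upwards [ae_restrict_mem measurableSet_Ioi] with u hu
    rw [norm_mul, norm_of_nonneg (exp_pos _).le]
    exact mul_le_mul_of_nonneg_left (hM _ (by have : 0 < u := hu; linarith)).le (exp_pos _).le
  · refine Eventually.of_forall fun u => ?_
    exact (hL.comp (tendsto_atTop_add_const_left _ u tendsto_id)).const_mul _

/-- The function `H(u) = (I″(u) − I′(u))/I(u)` satisfies
`H(u) = (Φ(r+q) − 1)Λ̄(u) − (W^{(r)})′(u)/I(u)` with `Λ̄(u) = I′(u)/I(u)`,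
and `H(u) → Φ(r)(Φ(r) − 1)` as `u → ∞`; in particular, if `r > ψ(1)` (so that
`Φ(r) > 1`), then `H > 0` eventually. -/
theorem stmt5
    (μ σ : ℝ) (ν : MeasureTheory.Measure ℝ)
    (hν : ν (Set.Ici 0) = 0)
    (hνint : ∫⁻ x, ENNReal.ofReal (min 1 (x ^ 2)) ∂ν ≠ ⊤)
    (ψ : ℝ → ℝ)
    (hψ : ∀ β : ℝ, 0 ≤ β →
      ψ β = μ * β + σ ^ 2 / 2 * β ^ 2 +
        ∫ z, (Real.exp (β * z) - 1 -
          Set.indicator (Set.Ioi (-1 : ℝ)) (fun t => β * t) z) ∂ν)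
    (Φ : ℝ → ℝ)
    (hΦ : ∀ s : ℝ, 0 ≤ s → 0 ≤ Φ s ∧ ψ (Φ s) = s ∧ ∀ β : ℝ, Φ s < β → s < ψ β)
    (W : ℝ → ℝ → ℝ)
    (hWnn : ∀ s : ℝ, 0 ≤ s → ∀ x : ℝ, 0 ≤ W s x)
    (hWzero : ∀ s : ℝ, 0 ≤ s → ∀ x : ℝ, x < 0 → W s x = 0)
    (hWcont : ∀ s : ℝ, 0 ≤ s → ContinuousOn (W s) (Set.Ici 0))
    (hWmono : ∀ s : ℝ, 0 ≤ s → MonotoneOn (W s) (Set.Ici 0))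
    (hWlap : ∀ s : ℝ, 0 ≤ s → ∀ β : ℝ, Φ s < β →
      ∫ x in Set.Ioi (0 : ℝ), Real.exp (-β * x) * W s x = 1 / (ψ β - s))
    (r q : ℝ) (hr : 0 < r) (hq : 0 < q)
    (I : ℝ → ℝ)
    (hI : ∀ x : ℝ, I x = ∫ u in Set.Ioi (0 : ℝ), Real.exp (-Φ (r + q) * u) * W r (u + x))
    (W' : ℝ → ℝ)
    (hW' : ∀ x : ℝ, 0 < x → HasDerivAt (W r) (W' x) x)
    (hW'c : ContinuousOn W' (Set.Ioi 0))
    (c : ℝ) (hc : 0 < c) (hψ' : HasDerivAt ψ c (Φ r))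
    (hlim1 : Filter.Tendsto (fun x => Real.exp (-Φ r * x) * W r x) Filter.atTop (nhds (1 / c)))
    (hlim2 : Filter.Tendsto (fun x => W' x / W r x) Filter.atTop (nhds (Φ r)))
    (I' I'' : ℝ → ℝ)
    (hI' : ∀ x : ℝ, 0 < x → HasDerivAt I (I' x) x)
    (hI'' : ∀ x : ℝ, 0 < x → HasDerivAt I' (I'' x) x)
    (H : ℝ → ℝ)
    (hH : ∀ u : ℝ, 0 < u → H u = (I'' u - I' u) / I u) :
    (∀ u : ℝ, 0 < u →
      H u = (Φ (r + q) - 1) * (I' u / I u) - W' u / I u) ∧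
    Filter.Tendsto H Filter.atTop (nhds (Φ r * (Φ r - 1))) ∧
    (ψ 1 < r → 1 < Φ r ∧ ∀ᶠ u in Filter.atTop, 0 < H u) := by
  have hpa : Φ r < Φ (r + q) := by
    obtain ⟨-, hΦr, -⟩ := hΦ r hr.le
    obtain ⟨-, hΦrq, hgt⟩ := hΦ (r + q) (by linarith)
    by_contra! hle
    rcases hle.lt_or_eq with hlt | heq
    · linarith [hgt _ hlt]
    · rw [heq] at hΦrq
      linarith
  have hcont := hWcont r hr.le
  have hIfun : I = fun x => ∫ u in Ioi (0 : ℝ), exp (-Φ (r + q) * u) * W r (u + x) := funext hI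
  have hI'eq : ∀ x : ℝ, 0 < x → I' x = Φ (r + q) * I x - W r x := by
    intro x hx
    refine (hI' x hx).unique ?_
    rw [hIfun]
    exact hasDerivAt_integral_exp_neg_mul hcont (integrableOn_exp_neg_mul hcont hpa hlim1) hx
  have hI''eq : ∀ x : ℝ, 0 < x → I'' x = Φ (r + q) * I' x - W' x := by
    intro x hx
    refine (hI'' x hx).unique ?_
    refine (((hI' x hx).const_mul _).sub (hW' x hx)).congr_of_eventuallyEq ?_
    filter_upwards [Ioi_mem_nhds hx] with y hy using hI'eq y hy
  have hformula : ∀ u : ℝ, 0 < u →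
      H u = (Φ (r + q) - 1) * (I' u / I u) - W' u / I u := by
    intro u hu
    rw [hH u hu, hI''eq u hu]
    ring
  have hap : Φ (r + q) - Φ r ≠ 0 := (sub_pos.2 hpa).ne'
  have hexpI : Tendsto (fun x => exp (-Φ r * x) * I x) atTop
      (𝓝 (1 / c / (Φ (r + q) - Φ r))) := by
    rw [hIfun]
    exact tendsto_exp_neg_mul_integral hcont hpa hlim1
  have hIpos : ∀ᶠ x in atTop, I x ≠ 0 := by
    filter_upwards [hexpI.eventually_ne (by positivity)] with x hx using right_ne_zero_of_mul hx
  have hWpos : ∀ᶠ x in atTop, W r x ≠ 0 := by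
    filter_upwards [hlim1.eventually_ne (by positivity)] with x hx using right_ne_zero_of_mul hx
  have hratio : Tendsto (fun x => W r x / I x) atTop (𝓝 (Φ (r + q) - Φ r)) := by
    have h := hlim1.div hexpI (by positivity)
    rw [div_div_cancel₀ (by positivity)] at h
    exact h.congr fun x => mul_div_mul_left _ _ (exp_pos _).ne'
  have hlim : Tendsto H atTop (𝓝 (Φ r * (Φ r - 1))) := by
    have h := ((hratio.const_sub (Φ (r + q))).const_mul (Φ (r + q) - 1)).sub (hlim2.mul hratio)
    have hval : (Φ (r + q) - 1) * (Φ (r + q) - (Φ (r + q) - Φ r)) -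
        Φ r * (Φ (r + q) - Φ r) = Φ r * (Φ r - 1) := by ring
    rw [hval] at h
    refine h.congr' ?_
    filter_upwards [hIpos, hWpos, eventually_gt_atTop 0] with x hIx hWx hx
    rw [hformula x hx, hI'eq x hx]
    field_simp
  refine ⟨hformula, hlim, fun hψ1 => ?_⟩
  have h1 : 1 < Φ r := by
    obtain ⟨-, hΦr, hgt⟩ := hΦ r hr.le
    by_contra! hle
    rcases hle.lt_or_eq with hlt | heq
    · linarith [hgt _ hlt]
    · rw [heq] at hΦr
      linarith
  exact ⟨h1, hlim.eventually_const_lt (mul_pos (by linarith) (by linarith))⟩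
end

section
/- Suppose σ > 0, that W^{(r)} is continuously differentiable on (0,∞) with W^{(r)}(0) = 0 and lim_{x→0+} (W^{(r)})′(x) = 2/σ². Then: (a) if ψ(1) > 0 and q > max( ψ(r/ψ(1)) − r, 0 ), there exists x > 0 with (I^{(r,q)})″(x) < (I^{(r,q)})′(x); (b) conversely, if (I^{(r,q)})″(x) ≥ (I^{(r,q)})′(x) for all x > 0, then either ψ(1) ≤ 0, or ψ(1) > 0 and q ≤ ψ(r/ψ(1)) − r. -/
open MeasureTheory Real Set Filter Topology

theorem exp_le_one_add_add_sq_of_nonpos {y : ℝ} (hy : y ≤ 0) :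
    Real.exp y ≤ 1 + y + y ^ 2 := by
  rcases le_or_gt (-1) y with h | h
  · have := Real.abs_exp_sub_one_sub_id_le (x := y) (abs_le.mpr ⟨h, by linarith⟩)
    have := (abs_le.mp this).2
    linarith
  · have : Real.exp y ≤ 1 := Real.exp_le_one_iff.mpr hy
    nlinarith

theorem integrable_levy_exponent_integrand {ν : Measure ℝ} (hν : ν (Set.Ici 0) = 0)
    (hνint : ∫⁻ x, ENNReal.ofReal (min 1 (x ^ 2)) ∂ν ≠ ⊤) {β : ℝ} (hβ : 0 ≤ β) :
    Integrable (fun z => Real.exp (β * z) - 1 -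
      Set.indicator (Set.Ioi (-1 : ℝ)) (fun t => β * t) z) ν := by
  have hmin : Integrable (fun x : ℝ => min 1 (x ^ 2)) ν := by
    refine ⟨by fun_prop, ?_⟩
    rw [hasFiniteIntegral_iff_ofReal (Eventually.of_forall fun x => by positivity)]
    exact hνint.lt_top
  refine (hmin.const_mul (1 + β ^ 2)).mono' ?_ ?_
  · refine Measurable.aestronglyMeasurable ?_
    exact (by fun_prop : Measurable fun z : ℝ => Real.exp (β * z) - 1).sub
      ((by fun_prop : Measurable fun t : ℝ => β * t).indicator measurableSet_Ioi)
  · have hneg : ∀ᵐ z ∂ν, z < 0 := by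
      rw [ae_iff]
      simpa [not_lt, Set.Ici] using hν
    filter_upwards [hneg] with z hz
    have hβz : β * z ≤ 0 := mul_nonpos_of_nonneg_of_nonpos hβ hz.le
    have h1 : Real.exp (β * z) ≤ 1 := Real.exp_le_one_iff.mpr hβz
    have h0 := Real.exp_pos (β * z)
    rw [Real.norm_eq_abs, abs_le]
    by_cases hz1 : -1 < z
    · have hmem : z ∈ Set.Ioi (-1 : ℝ) := hz1
      have hm : min 1 (z ^ 2) = z ^ 2 := min_eq_right (by nlinarith)
      have h2 := exp_le_one_add_add_sq_of_nonpos hβz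
      have h3 := Real.add_one_le_exp (β * z)
      rw [Set.indicator_of_mem hmem, hm]
      constructor <;> nlinarith [sq_nonneg z, mul_nonneg (sq_nonneg β) (sq_nonneg z)]
    · have hmem : z ∉ Set.Ioi (-1 : ℝ) := hz1
      have hm : min 1 (z ^ 2) = 1 := min_eq_left (by nlinarith)
      rw [Set.indicator_of_notMem hmem, hm]
      constructor <;> nlinarith [sq_nonneg β]

theorem mul_integral_levy_exponent_le {ν : Measure ℝ} (hν : ν (Set.Ici 0) = 0)
    (hνint : ∫⁻ x, ENNReal.ofReal (min 1 (x ^ 2)) ∂ν ≠ ⊤) {θ : ℝ} (hθ : 1 ≤ θ) :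
    θ * ∫ z, (Real.exp (1 * z) - 1 -
        Set.indicator (Set.Ioi (-1 : ℝ)) (fun t => 1 * t) z) ∂ν ≤
      ∫ z, (Real.exp (θ * z) - 1 -
        Set.indicator (Set.Ioi (-1 : ℝ)) (fun t => θ * t) z) ∂ν := by
  rw [← integral_const_mul]
  refine integral_mono
    ((integrable_levy_exponent_integrand hν hνint zero_le_one).const_mul θ)
    (integrable_levy_exponent_integrand hν hνint (zero_le_one.trans hθ)) fun z => ?_
  have hb := one_add_mul_self_le_rpow_one_add (s := Real.exp z - 1)
    (by linarith [Real.exp_pos z]) hθ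
  rw [add_sub_cancel, ← Real.exp_mul, mul_comm z θ] at hb
  by_cases hz : z ∈ Set.Ioi (-1 : ℝ)
  · simp only [Set.indicator_of_mem hz, one_mul]
    linarith
  · simp only [Set.indicator_of_notMem hz, one_mul]
    linarith

theorem integral_Ioi_exp_mul_shift {w : ℝ → ℝ} {θ c : ℝ}
    (hint : IntegrableOn (fun v => Real.exp (-θ * v) * w v) (Set.Ioi 0))
    (hc : ∫ v in Set.Ioi (0 : ℝ), Real.exp (-θ * v) * w v = c) {x : ℝ} (hx : 0 ≤ x) :
    ∫ u in Set.Ioi (0 : ℝ), Real.exp (-θ * u) * w (u + x) =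
      Real.exp (θ * x) * (c - ∫ v in (0 : ℝ)..x, Real.exp (-θ * v) * w v) := by
  have hsub : ∫ u in Set.Ioi (0 : ℝ), Real.exp (-θ * u) * w (u + x) =
      Real.exp (θ * x) * ∫ v in Set.Ioi x, Real.exp (-θ * v) * w v := by
    have h := (measurePreserving_add_right volume x).setIntegral_preimage_emb
      (measurableEmbedding_addRight x) (fun v => Real.exp (-θ * v) * w v) (Set.Ioi x)
    rw [Set.preimage_add_const_Ioi, sub_self] at h
    rw [← h, ← integral_const_mul]
    refine integral_congr_ae (Eventually.of_forall fun u => ?_)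
    simp only
    rw [← mul_assoc, ← Real.exp_add]
    congr 2
    ring
  rw [hsub, ← hc, ← intervalIntegral.integral_Ioi_sub_Ioi hint hx, sub_sub_cancel]

/-- Lemma 2.8 (`lem:Hsign2q`): when `σ > 0` (so `W^{(r)}(0) = 0` and
`(W^{(r)})′(0+) = 2/σ²`), (a) if `ψ(1) > 0` and `q > max(ψ(r/ψ(1)) − r, 0)`
then `(I^{(r,q)})″ < (I^{(r,q)})′` somewhere on `(0,∞)`; (b) conversely, if
`(I^{(r,q)})″ ≥ (I^{(r,q)})′` on `(0,∞)`, then either `ψ(1) ≤ 0`, or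
`ψ(1) > 0` and `q ≤ ψ(r/ψ(1)) − r`. -/
theorem stmt6
    (μ σ : ℝ) (ν : MeasureTheory.Measure ℝ)
    (hν : ν (Set.Ici 0) = 0)
    (hνint : ∫⁻ x, ENNReal.ofReal (min 1 (x ^ 2)) ∂ν ≠ ⊤)
    (ψ : ℝ → ℝ)
    (hψ : ∀ β : ℝ, 0 ≤ β →
      ψ β = μ * β + σ ^ 2 / 2 * β ^ 2 +
        ∫ z, (Real.exp (β * z) - 1 -
          Set.indicator (Set.Ioi (-1 : ℝ)) (fun t => β * t) z) ∂ν)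
    (Φ : ℝ → ℝ)
    (hΦ : ∀ s : ℝ, 0 ≤ s → 0 ≤ Φ s ∧ ψ (Φ s) = s ∧ ∀ β : ℝ, Φ s < β → s < ψ β)
    (W : ℝ → ℝ → ℝ)
    (hWnn : ∀ s : ℝ, 0 ≤ s → ∀ x : ℝ, 0 ≤ W s x)
    (hWzero : ∀ s : ℝ, 0 ≤ s → ∀ x : ℝ, x < 0 → W s x = 0)
    (hWcont : ∀ s : ℝ, 0 ≤ s → ContinuousOn (W s) (Set.Ici 0))
    (hWmono : ∀ s : ℝ, 0 ≤ s → MonotoneOn (W s) (Set.Ici 0))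
    (hWlap : ∀ s : ℝ, 0 ≤ s → ∀ β : ℝ, Φ s < β →
      ∫ x in Set.Ioi (0 : ℝ), Real.exp (-β * x) * W s x = 1 / (ψ β - s))
    (r q : ℝ) (hr : 0 < r) (hq : 0 < q)
    (I : ℝ → ℝ)
    (hI : ∀ x : ℝ, I x = ∫ u in Set.Ioi (0 : ℝ), Real.exp (-Φ (r + q) * u) * W r (u + x))
    (hσ : 0 < σ)
    (W' : ℝ → ℝ)
    (hW' : ∀ x : ℝ, 0 < x → HasDerivAt (W r) (W' x) x)
    (hW'c : ContinuousOn W' (Set.Ioi 0))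
    (hW0 : W r 0 = 0)
    (hW'0 : Filter.Tendsto W' (nhdsWithin 0 (Set.Ioi 0)) (nhds (2 / σ ^ 2)))
    (I' I'' : ℝ → ℝ)
    (hI' : ∀ x : ℝ, 0 < x → HasDerivAt I (I' x) x)
    (hI'' : ∀ x : ℝ, 0 < x → HasDerivAt I' (I'' x) x) :
    (0 < ψ 1 → max (ψ (r / ψ 1) - r) 0 < q → ∃ x : ℝ, 0 < x ∧ I'' x < I' x) ∧
    ((∀ x : ℝ, 0 < x → I' x ≤ I'' x) →
      ψ 1 ≤ 0 ∨ (0 < ψ 1 ∧ q ≤ ψ (r / ψ 1) - r)) := by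
  have key : 0 < ψ 1 → max (ψ (r / ψ 1) - r) 0 < q → ∃ x : ℝ, 0 < x ∧ I'' x < I' x := by
    intro hψ1 hmax
    by_contra! hcon
    have hq1 : ψ (r / ψ 1) < r + q := by linarith [(max_lt_iff.mp hmax).1]
    obtain ⟨hΘ0, hψΘ, hΘgt⟩ := hΦ (r + q) (by positivity)
    obtain ⟨-, hψr, hrgt⟩ := hΦ r hr.le
    set Θ := Φ (r + q)
    have hψ0 : ψ 0 = 0 := by simp [hψ 0 le_rfl]
    have hΘpos : 0 < Θ := by
      refine lt_of_le_of_ne hΘ0 fun h => ?_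
      rw [← h, hψ0] at hψΘ
      linarith
    have hΘr : r < Θ * ψ 1 := by
      rw [← div_lt_iff₀ hψ1]
      by_contra! h
      rcases h.eq_or_lt with h | h
      · rw [← h] at hq1
        linarith
      · linarith [hΘgt _ h]
    have hΦΘ : Φ r < Θ := by
      by_contra! h
      rcases h.eq_or_lt with h | h
      · rw [← h] at hψr
        linarith
      · linarith [hΘgt _ h]
    have hlap : ∫ x in Set.Ioi (0 : ℝ), Real.exp (-Θ * x) * W r x = 1 / q := by
      rw [hWlap r hr.le Θ hΦΘ, hψΘ, add_sub_cancel_left]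
    have hint : IntegrableOn (fun x => Real.exp (-Θ * x) * W r x) (Set.Ioi 0) := by
      by_contra h
      rw [integral_undef h] at hlap
      exact (one_div_pos.mpr hq).ne hlap
    have hWc : Continuous (W r) := by
      have h : W r = fun x => W r (max x 0) := by
        funext x
        rcases lt_or_ge x 0 with hx | hx
        · rw [max_eq_right hx.le, hW0, hWzero r hr.le x hx]
        · rw [max_eq_left hx]
      rw [h]
      exact (hWcont r hr.le).comp_continuous (by fun_prop) fun x => le_max_right x 0
    set g : ℝ → ℝ := fun v => Real.exp (-Θ * v) * W r v with hg
    have hgc : Continuous g := by fun_prop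
    set G : ℝ → ℝ := fun x => Real.exp (Θ * x) * (1 / q - ∫ v in (0 : ℝ)..x, g v) with hG
    have hIG : ∀ x, 0 ≤ x → I x = G x := fun x hx => by
      rw [hI x]
      exact integral_Ioi_exp_mul_shift hint hlap hx
    have hGd : ∀ x, HasDerivAt G (Θ * G x - W r x) x := by
      intro x
      have h1 : HasDerivAt (fun x : ℝ => ∫ v in (0 : ℝ)..x, g v) (g x) x :=
        intervalIntegral.integral_hasDerivAt_right (hgc.intervalIntegrable 0 x)
          (hgc.stronglyMeasurableAtFilter _ _) hgc.continuousAt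
      have h2 : HasDerivAt (fun x : ℝ => Real.exp (Θ * x)) (Real.exp (Θ * x) * (Θ * 1)) x :=
        ((hasDerivAt_id x).const_mul Θ).exp
      have h3 := h2.mul (h1.const_sub (1 / q))
      refine h3.congr_deriv ?_
      have he : Real.exp (Θ * x) * Real.exp (-Θ * x) = 1 := by
        rw [← Real.exp_add]
        simp
      simp only [hG, hg]
      linear_combination (-W r x) * he
    have hI'eq : ∀ x, 0 < x → I' x = Θ * G x - W r x := fun x hx => by
      refine (hI' x hx).unique ((hGd x).congr_of_eventuallyEq ?_)
      filter_upwards [Ioi_mem_nhds hx] with y hy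
      exact hIG y (le_of_lt hy)
    have hI''eq : ∀ x, 0 < x → I'' x = Θ * (Θ * G x - W r x) - W' x := fun x hx => by
      refine (hI'' x hx).unique
        ((((hGd x).const_mul Θ).sub (hW' x hx)).congr_of_eventuallyEq ?_)
      filter_upwards [Ioi_mem_nhds hx] with y hy
      exact hI'eq y hy
    have hGc : Continuous G := continuous_iff_continuousAt.mpr fun x => (hGd x).continuousAt
    have hG0 : G 0 = 1 / q := by simp [hG]
    have hlim' : Tendsto (fun x => Θ * G x - W r x) (𝓝[>] 0) (𝓝 (Θ / q)) := by
      have h : Continuous fun x => Θ * G x - W r x := by fun_prop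
      have := (h.tendsto 0).mono_left (nhdsWithin_le_nhds (s := Set.Ioi 0))
      simpa [hG0, hW0, div_eq_mul_inv] using this
    rcases lt_or_ge Θ 1 with hΘ1 | hΘ1
    · have hmono : MonotoneOn (fun x => Real.exp (-x) * I' x) (Set.Ioi 0) := by
        have hd : ∀ x, 0 < x → HasDerivAt (fun x => Real.exp (-x) * I' x)
            (Real.exp (-x) * (I'' x - I' x)) x := fun x hx => by
          refine ((hasDerivAt_id x).neg.exp.mul (hI'' x hx)).congr_deriv ?_
          simp only [id, Pi.neg_apply]
          ring
        refine monotoneOn_of_deriv_nonneg (convex_Ioi 0)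
          (fun x hx => (hd x hx).continuousAt.continuousWithinAt) ?_ ?_
        · rw [interior_Ioi]
          exact fun x hx => (hd x hx).differentiableAt.differentiableWithinAt
        · rw [interior_Ioi]
          intro x hx
          rw [(hd x hx).deriv]
          exact mul_nonneg (Real.exp_pos _).le (sub_nonneg.mpr (hcon x hx))
      have hlimh : Tendsto (fun x => Real.exp (-x) * I' x) (𝓝[>] 0) (𝓝 (Θ / q)) := by
        have he : Tendsto (fun x : ℝ => Real.exp (-x)) (𝓝[>] 0) (𝓝 1) := by
          have h : Continuous fun x : ℝ => Real.exp (-x) := by fun_prop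
          simpa using (h.tendsto 0).mono_left (nhdsWithin_le_nhds (s := Set.Ioi 0))
        have h := he.mul hlim'
        rw [one_mul] at h
        refine h.congr' ?_
        filter_upwards [self_mem_nhdsWithin] with x hx
        rw [hI'eq x hx]
      have hle : Θ / q ≤ Real.exp (-1) * I' 1 := by
        refine le_of_tendsto hlimh ?_
        filter_upwards [Ioo_mem_nhdsGT (zero_lt_one (α := ℝ))] with x hx
        exact hmono hx.1 (Set.mem_Ioi.mpr one_pos) hx.2.le
      have hGle : G 1 ≤ Real.exp Θ * (1 / q) := by
        have h0 : 0 ≤ ∫ v in (0 : ℝ)..1, g v :=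
          intervalIntegral.integral_nonneg zero_le_one fun u _ =>
            mul_nonneg (Real.exp_pos _).le (hWnn r hr.le u)
        simp only [hG, mul_one]
        gcongr
        linarith
      have hI1 : I' 1 ≤ Θ * (Real.exp Θ * (1 / q)) := by
        rw [hI'eq 1 one_pos]
        have := mul_le_mul_of_nonneg_left hGle hΘ0
        linarith [hWnn r hr.le 1]
      have hlt : Real.exp (-1) * Real.exp Θ < 1 := by
        rw [← Real.exp_add, Real.exp_lt_one_iff]
        linarith
      have hpos : 0 < Θ / q := div_pos hΘpos hq
      have h4 := mul_le_mul_of_nonneg_left hI1 (Real.exp_pos (-1)).le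
      have h5 : Real.exp (-1) * (Θ * (Real.exp Θ * (1 / q))) =
          (Real.exp (-1) * Real.exp Θ) * (Θ / q) := by ring
      nlinarith
    · have hlim'' := ((hlim'.const_mul Θ).sub hW'0).sub hlim'
      have hnn : 0 ≤ Θ * (Θ / q) - 2 / σ ^ 2 - Θ / q := by
        refine ge_of_tendsto hlim'' ?_
        filter_upwards [self_mem_nhdsWithin] with x hx
        rw [← hI'eq x hx, sub_nonneg]
        have := hcon x hx
        rwa [hI''eq x hx, ← hI'eq x hx] at this
      have hqle : q ≤ σ ^ 2 / 2 * (Θ ^ 2 - Θ) := by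
        have h : 0 ≤ (Θ * (Θ / q) - 2 / σ ^ 2 - Θ / q) * (q * σ ^ 2 / 2) :=
          mul_nonneg hnn (by positivity)
        have h' : (Θ * (Θ / q) - 2 / σ ^ 2 - Θ / q) * (q * σ ^ 2 / 2) =
            σ ^ 2 / 2 * (Θ ^ 2 - Θ) - q := by
          field_simp
          ring
        linarith
      have hA := mul_integral_levy_exponent_le hν hνint hΘ1
      rw [hψ Θ hΘ0] at hψΘ
      rw [hψ 1 zero_le_one] at hΘr
      nlinarith
  refine ⟨key, fun hall => ?_⟩
  rcases le_or_gt (ψ 1) 0 with h1 | h1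
  · exact Or.inl h1
  · refine Or.inr ⟨h1, ?_⟩
    by_contra! hlt
    obtain ⟨x, hx, hxlt⟩ := key h1 (max_lt hlt hq)
    exact (hall x hx).not_gt hxlt
end

section
/- The function h satisfies h(x) = (K/(Φ_q − 1)) e^{Φ_q (x − k̲)} − e^x + K for x ≤ k̲ and h(x) = 0 for x > k̲. Moreover: h is continuously differentiable on ℝ with h(k̲) = 0 and h′(k̲) = 0; h is strictly decreasing on (−∞, k̲] with 0 < h(x) < K for every x < k̲ and lim_{x→−∞} h(x) = K; and the function S ↦ h(log S) is convex on (0, K̲] with derivative taking values in [−1, 0) on (0, K̲). -/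
open MeasureTheory Real Set Filter Topology

/-- Smooth fit: gluing `f` on `Iic a` to the zero function beyond `a`, when `f a = 0` and
`f' a = 0`, gives a continuously differentiable function. -/
lemma hasDerivAt_glue_zero {f f' h : ℝ → ℝ} {a : ℝ} (hf : ∀ x, HasDerivAt f (f' x) x)
    (hfa : f a = 0) (hfa' : f' a = 0) (h_le : ∀ x ≤ a, h x = f x) (h_gt : ∀ x, a < x → h x = 0)
    (x : ℝ) : HasDerivAt h (if x ≤ a then f' x else 0) x := by
  rcases lt_trichotomy x a with hx | rfl | hx
  · rw [if_pos hx.le]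
    refine (hf x).congr_of_eventuallyEq ?_
    filter_upwards [Iio_mem_nhds hx] with y hy using h_le y (le_of_lt hy)
  · rw [if_pos le_rfl]
    have h_left : HasDerivWithinAt h (f' x) (Iic x) x :=
      (hf x).hasDerivWithinAt.congr h_le (h_le x le_rfl)
    have h_right : HasDerivWithinAt h (f' x) (Ici x) x := by
      rw [hfa']
      refine (hasDerivWithinAt_const x (Ici x) (0 : ℝ)).congr (fun y hy => ?_)
        ((h_le x le_rfl).trans hfa)
      rcases eq_or_lt_of_le (mem_Ici.1 hy) with rfl | hlt
      · exact (h_le x le_rfl).trans hfa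
      · exact h_gt y hlt
    have h_union := h_left.union h_right
    rwa [Iic_union_Ici, hasDerivWithinAt_univ] at h_union
  · rw [if_neg hx.not_ge]
    refine (hasDerivAt_const x (0 : ℝ)).congr_of_eventuallyEq ?_
    filter_upwards [Ioi_mem_nhds hx] with y hy using h_gt y hy

/-- Properties of the time-value function
`h(x) = v̲(x) − (eˣ − K)` (Lemma 4.5 preliminaries / Appendix): explicit
formula below `k̲`, vanishing above `k̲`, `C¹` smoothness with smooth fit at
`k̲`, strict monotonicity, bounds, limit at `−∞`, and convexity in the price
scale with derivative in `[−1, 0)`. -/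
theorem stmt8
    (μ σ : ℝ) (ν : MeasureTheory.Measure ℝ)
    (hν : ν (Set.Ici 0) = 0)
    (hνint : ∫⁻ x, ENNReal.ofReal (min 1 (x ^ 2)) ∂ν ≠ ⊤)
    (ψ : ℝ → ℝ)
    (hψ : ∀ β : ℝ, 0 ≤ β →
      ψ β = μ * β + σ ^ 2 / 2 * β ^ 2 +
        ∫ z, (Real.exp (β * z) - 1 -
          Set.indicator (Set.Ioi (-1 : ℝ)) (fun t => β * t) z) ∂ν)
    (Φ : ℝ → ℝ)
    (hΦ : ∀ s : ℝ, 0 ≤ s → 0 ≤ Φ s ∧ ψ (Φ s) = s ∧ ∀ β : ℝ, Φ s < β → s < ψ β)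
    (r q : ℝ) (hr : 0 < r) (hq : 0 < q)
    (hrψ : ψ 1 < r)
    (K : ℝ) (hK : 0 < K)
    (Kl kl : ℝ)
    (hKl : Kl = Φ (r + q) * K / (Φ (r + q) - 1))
    (hkl : kl = Real.log Kl)
    (v : ℝ → ℝ)
    (hv1 : ∀ x : ℝ, x ≤ kl → v x = (Kl - K) * Real.exp (Φ (r + q) * (x - kl)))
    (hv2 : ∀ x : ℝ, kl < x → v x = Real.exp x - K)
    (h : ℝ → ℝ) (hh : ∀ x : ℝ, h x = v x - (Real.exp x - K))
    :
    (∀ x : ℝ, x ≤ kl →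
      h x = K / (Φ (r + q) - 1) * Real.exp (Φ (r + q) * (x - kl)) - Real.exp x + K) ∧
    (∀ x : ℝ, kl < x → h x = 0) ∧
    (∃ hd : ℝ → ℝ, (∀ x : ℝ, HasDerivAt h (hd x) x) ∧ Continuous hd ∧ hd kl = 0) ∧
    h kl = 0 ∧
    StrictAntiOn h (Set.Iic kl) ∧
    (∀ x : ℝ, x < kl → 0 < h x ∧ h x < K) ∧
    Filter.Tendsto h Filter.atBot (nhds K) ∧
    ConvexOn ℝ (Set.Ioc 0 Kl) (fun S => h (Real.log S)) ∧
    (∀ S : ℝ, 0 < S → S < Kl →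
      -1 ≤ deriv (fun t => h (Real.log t)) S ∧ deriv (fun t => h (Real.log t)) S < 0) := by
  obtain ⟨-, hψΦ, hψ_gt⟩ := hΦ (r + q) (by positivity)
  have hp : 1 < Φ (r + q) := by
    by_contra! hle
    rcases hle.lt_or_eq with hlt | heq
    · linarith [hψ_gt 1 hlt]
    · rw [heq] at hψΦ
      linarith
  generalize Φ (r + q) = p at *
  have hp1 : 0 < p - 1 := sub_pos.2 hp
  set a := K / (p - 1) with ha
  have ha_pos : 0 < a := by positivity
  have haK : a * (p - 1) = K := div_mul_cancel₀ K hp1.ne'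
  have hKla : Kl = p * a := by rw [hKl, ha, mul_div_assoc]
  have hKl_pos : 0 < Kl := by rw [hKla]; positivity
  have hexp : Real.exp kl = p * a := by rw [hkl, Real.exp_log hKl_pos, hKla]
  set f : ℝ → ℝ := fun x => a * Real.exp (p * (x - kl)) - Real.exp x + K with hf_def
  set f' : ℝ → ℝ := fun x => p * a * Real.exp (p * (x - kl)) - Real.exp x with hf'_def
  have hf : ∀ x, HasDerivAt f (f' x) x := fun x => by
    have h1 : HasDerivAt (fun y : ℝ => p * (y - kl)) p x := by
      simpa using ((hasDerivAt_id x).sub_const kl).const_mul p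
    have h2 := ((h1.exp.const_mul a).sub (Real.hasDerivAt_exp x)).add_const K
    refine h2.congr_deriv ?_
    simp only [hf'_def]
    ring
  have h_le : ∀ x ≤ kl, h x = f x := fun x hx => by
    have hKlK : Kl - K = a := by rw [hKla, ← haK]; ring
    rw [hh, hv1 x hx, hKlK]
    simp only [hf_def]
    ring
  have h_gt : ∀ x, kl < x → h x = 0 := fun x hx => by rw [hh, hv2 x hx, sub_self]
  have hf_kl : f kl = 0 := by
    simp only [hf_def, sub_self, mul_zero, Real.exp_zero, hexp]
    linarith
  have hf'_kl : f' kl = 0 := by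
    simp only [hf'_def, sub_self, mul_zero, Real.exp_zero, hexp]
    ring
  have hf'_eq : ∀ x, f' x = Real.exp x * (Real.exp ((p - 1) * (x - kl)) - 1) := fun x => by
    simp only [hf'_def]
    rw [← hexp, ← Real.exp_add, mul_sub (Real.exp x), ← Real.exp_add, mul_one]
    ring_nf
  have hfac : ∀ x < kl, Real.exp ((p - 1) * (x - kl)) < 1 := fun x hx =>
    Real.exp_lt_one_iff.2 (mul_neg_of_pos_of_neg hp1 (sub_neg.2 hx))
  have hf'_neg : ∀ x < kl, f' x < 0 := fun x hx => by
    rw [hf'_eq]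
    exact mul_neg_of_pos_of_neg (Real.exp_pos x) (sub_neg.2 (hfac x hx))
  have hderiv := hasDerivAt_glue_zero hf hf_kl hf'_kl h_le h_gt
  have h_kl : h kl = 0 := (h_le kl le_rfl).trans hf_kl
  have h_anti : StrictAntiOn h (Iic kl) := by
    refine strictAntiOn_of_deriv_neg (convex_Iic kl)
      (fun x _ => (hderiv x).continuousAt.continuousWithinAt) fun x hx => ?_
    rw [interior_Iic] at hx
    rw [(hderiv x).deriv, if_pos (le_of_lt hx)]
    exact hf'_neg x hx
  refine ⟨h_le, h_gt, ⟨_, hderiv, ?_, ?_⟩, h_kl, h_anti, ?_, ?_, ?_, ?_⟩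
  · refine Continuous.if_le (by fun_prop) continuous_const continuous_id continuous_const ?_
    rintro x rfl
    exact hf'_kl
  · rw [if_pos le_rfl]
    exact hf'_kl
  · intro x hx
    refine ⟨h_kl ▸ h_anti hx.le self_mem_Iic hx, ?_⟩
    have h1 := hf'_neg x hx
    have h2 : 0 < a * Real.exp (p * (x - kl)) := by positivity
    rw [h_le x hx.le]
    simp only [hf_def, hf'_def] at h1 ⊢
    nlinarith
  · have h_lin : Tendsto (fun x : ℝ => p * (x - kl)) atBot atBot :=
      (tendsto_atBot_add_const_right _ (-kl) tendsto_id).const_mul_atBot (by linarith)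
    have h_lim : Tendsto f atBot (𝓝 (a * 0 - 0 + K)) :=
      (((Real.tendsto_exp_atBot.comp h_lin).const_mul a).sub Real.tendsto_exp_atBot).add_const K
    rw [mul_zero, sub_zero, zero_add] at h_lim
    refine h_lim.congr' ?_
    filter_upwards [Iic_mem_atBot kl] with x hx using (h_le x hx).symm
  · have h_conv : ConvexOn ℝ (Ioc 0 Kl)
        (fun S : ℝ => (a * Real.exp (-(p * kl))) • S ^ p + (-S + K)) := by
      refine ConvexOn.add (ConvexOn.smul (by positivity) ?_)
        (ConvexOn.add_const (LinearMap.convexOn (-LinearMap.id) (convex_Ioc 0 Kl)) K)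
      exact (convexOn_rpow hp.le).subset (fun S hS => hS.1.le) (convex_Ioc 0 Kl)
    refine h_conv.congr fun S hS => ?_
    have h_log : Real.log S ≤ kl := hkl ▸ Real.log_le_log hS.1 hS.2
    simp only [h_le _ h_log, hf_def, Real.exp_log hS.1, smul_eq_mul, Real.rpow_def_of_pos hS.1]
    rw [mul_assoc, ← Real.exp_add]
    ring_nf
  · intro S hS hSKl
    have h_log : Real.log S < kl := hkl ▸ Real.log_lt_log hS hSKl
    have h_comp := (hderiv (Real.log S)).comp S (Real.hasDerivAt_log hS.ne')
    have h_deriv : deriv (fun t => h (Real.log t)) S =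
        Real.exp ((p - 1) * (Real.log S - kl)) - 1 := by
      refine h_comp.deriv.trans ?_
      rw [if_pos h_log.le, hf'_eq, Real.exp_log hS]
      field_simp
    rw [h_deriv]
    have h_pos := Real.exp_pos ((p - 1) * (Real.log S - kl))
    have h_lt := hfac _ h_log
    constructor <;> linarith
end
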